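/- Let f be a Steinhaus random multiplicative function. For ℓ ≥ 2 and T ≥ 1 define the event E_ℓ := { sup over test points x_i with X_{ℓ−1} < x_i ≤ X_ℓ of V(x_i)·√(log log x_i)/x_i ≤ T }. There exists a constant C = C(ε) > 0 such that for every T ≥ 1 and every sufficiently large ℓ (in terms of ε), ℙ(complement of E_ℓ) ≤ C·[ (√(ℓ^K)/T)^{4/ε} · 2^{−ℓ^K/ε} + T^{−1/4} ]. -/

import Mathlib

open MeasureTheory ProbabilityTheory Real

noncomputable section

/-- A Steinhaus random multiplicative function. -/
structure IsSteinhausRMF {Ω : Type*} [MeasurableSpace Ω] (μ : Measure Ω)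
    (f : Ω → ℕ → ℂ) : Prop where
  meas : ∀ n : ℕ, Measurable fun ω => f ω n
  indep : iIndepFun (m := fun _ : Nat.Primes => (inferInstance : MeasurableSpace ℂ))
    (fun (p : Nat.Primes) (ω : Ω) => f ω (p : ℕ)) μ
  unif : ∀ p : ℕ, p.Prime →
    Measure.map (fun ω => f ω p) μ =
      Measure.map (fun θ : ℝ => Complex.exp (2 * π * θ * Complex.I))
        (volume.restrict (Set.Ioc (0 : ℝ) 1))
  map_one : ∀ ω : Ω, f ω 1 = 1
  map_mul : ∀ (ω : Ω) (m n : ℕ), 1 ≤ m → 1 ≤ n → f ω (m * n) = f ω m * f ω n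

/-- The test points `x_i := ⌊exp(i^ε)⌋`. -/
def testPoint (ε : ℝ) (i : ℕ) : ℕ := ⌊Real.exp ((i : ℝ) ^ ε)⌋₊

/-- `X_ℓ := exp(2^{ℓ^K})` with `K = 1/(4ε)` (here `ℓ` is a real number). -/
def Xpt (ε ℓ : ℝ) : ℝ := Real.exp ((2 : ℝ) ^ (ℓ ^ (1 / (4 * ε))))

/-- `V(x) := ∑_{√x < p ≤ x} |∑_{m ≤ x/p} f(m)|²`, for a natural number `x`. -/
def Vst {Ω : Type*} (f : Ω → ℕ → ℂ) (ω : Ω) (x : ℕ) : ℝ :=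
  ∑ p ∈ (Finset.Icc 1 x).filter (fun p : ℕ => Nat.Prime p ∧ Real.sqrt x < (p : ℝ)),
    ‖∑ m ∈ Finset.Icc 1 ⌊(x : ℝ) / (p : ℝ)⌋₊, f ω m‖ ^ 2


noncomputable section

/-- Abstract ballot-type estimate for a martingale with bounded increments. -/
theorem ballot_core {Ω : Type*} {m0 : MeasurableSpace Ω} (P : Measure Ω) [IsProbabilityMeasure P]
    (F : ℕ → MeasurableSpace Ω) (hF : ∀ k, F k ≤ m0) (hFm : Monotone F)
    (X : ℕ → Ω → ℝ) (hXm : ∀ k, Measurable[F (k + 1)] (X k)) (c : ℝ) (hc : 0 ≤ c)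
    (hXc : ∀ k ω, |X k ω| ≤ c) (v : ℕ → ℝ) (hv : ∀ k, 0 ≤ v k)
    (h1 : ∀ k (Ψ : Ω → ℝ), Measurable[F k] Ψ → (∃ b, ∀ ω, |Ψ ω| ≤ b) →
      ∫ ω, Ψ ω * X k ω ∂P = 0)
    (h2 : ∀ k (Ψ : Ω → ℝ), Measurable[F k] Ψ → (∃ b, ∀ ω, |Ψ ω| ≤ b) →
      ∫ ω, Ψ ω * X k ω ^ 2 ∂P = v k * ∫ ω, Ψ ω ∂P)
    (h : ℕ → ℝ) (hh : Monotone h) (hh0 : 0 ≤ h 0) (n : ℕ) (H : ℝ) (hH : 0 < H) :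
    (∑ k ∈ Finset.range n, v k) * P.real {ω | ∀ i ≤ n, ∑ k ∈ Finset.range i, X k ω ≤ h i} ≤
      ((∑ k ∈ Finset.range n, v k) / H + 2 * (H + h n + c)) *
      (c + h 0 + ∑ k ∈ Finset.range n, (h (k + 1) - h k) *
        P.real {ω | ∀ i ≤ k, ∑ k ∈ Finset.range i, X k ω ≤ h i}) := by
  classical
  set W : ℕ → Ω → ℝ := fun i ω => ∑ k ∈ Finset.range i, X k ω with hW
  set D : ℕ → Set Ω := fun k => {ω | ∀ i ≤ k, W i ω ≤ h i} with hD
  set E : ℕ → Set Ω := fun k => {ω | ∀ i ≤ k, -H ≤ W i ω ∧ W i ω ≤ h i} with hE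
  change (∑ k ∈ Finset.range n, v k) * P.real (D n) ≤
      ((∑ k ∈ Finset.range n, v k) / H + 2 * (H + h n + c)) *
      (c + h 0 + ∑ k ∈ Finset.range n, (h (k + 1) - h k) * P.real (D k))
  have hWm : ∀ i, Measurable[F i] (W i) := by
    intro i
    refine Finset.measurable_sum _ ?_
    intro k hk
    exact (hXm k).mono (hFm (by simpa using hk)) le_rfl
  have hDm : ∀ k, MeasurableSet (D k) := by
    intro k
    have : D k = ⋂ i, ⋂ (_ : i ≤ k), {ω | W i ω ≤ h i} := by ext; simp [hD]
    rw [this]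
    refine MeasurableSet.iInter fun i => MeasurableSet.iInter fun _ => ?_
    exact measurableSet_le ((hWm i).mono (hF i) le_rfl) measurable_const
  have hEmF : ∀ k, MeasurableSet[F k] (E k) := by
    intro k
    have : E k = ⋂ i, ⋂ (_ : i ≤ k), ({ω | -H ≤ W i ω} ∩ {ω | W i ω ≤ h i}) := by
      ext; simp [hE]
    rw [this]
    refine MeasurableSet.iInter fun i => MeasurableSet.iInter fun hi => ?_
    have hm : Measurable[F k] (W i) := (hWm i).mono (hFm hi) le_rfl
    exact (hm measurableSet_Ici : MeasurableSet[F k] (W i ⁻¹' Set.Ici (-H))).inter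
      (hm measurableSet_Iic : MeasurableSet[F k] (W i ⁻¹' Set.Iic (h i)))
  have hEm : ∀ k, MeasurableSet (E k) := fun k => hF k _ (hEmF k)
  set e : ℕ → Ω → ℝ := fun k => (E k).indicator (fun _ => 1) with he
  have hemF : ∀ k, Measurable[F k] (e k) := fun k =>
    (@measurable_const _ _ _ (F k) (1:ℝ)).indicator (hEmF k)
  have heb : ∀ k ω, |e k ω| ≤ 1 := by
    intro k ω
    simp only [he, Set.indicator]; split_ifs <;> simp
  set S : ℕ → Ω → ℝ := fun n ω => ∑ k ∈ Finset.range n, e k ω * X k ω with hS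
  set hs : ℕ → Ω → ℝ := fun n ω => h 0 + ∑ k ∈ Finset.range n, e k ω * (h (k + 1) - h k) with hhs
  have hEsub : ∀ k, E (k + 1) ⊆ E k := fun k ω hω i hi => hω i (by omega)
  have hDsub : ∀ k, D (k + 1) ⊆ D k := fun k ω hω i hi => hω i (by omega)
  have hED : ∀ k, E k ⊆ D k := fun k ω hω i hi => (hω i hi).2
  have hem1 : ∀ k ω, ω ∈ E k → e k ω = 1 := fun k ω hω => by simp [he, hω]
  have hem0 : ∀ k ω, ω ∉ E k → e k ω = 0 := fun k ω hω => by simp [he, hω]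
  have hSs : ∀ k ω, S (k + 1) ω = S k ω + e k ω * X k ω := fun k ω => by
    simp [hS, Finset.sum_range_succ]
  have hWs : ∀ k ω, W (k + 1) ω = W k ω + X k ω := fun k ω => by
    simp [hW, Finset.sum_range_succ]
  have hhss : ∀ k ω, hs (k + 1) ω = hs k ω + e k ω * (h (k + 1) - h k) := fun k ω => by
    simp [hhs, Finset.sum_range_succ, add_assoc]
  have i1 : ∀ k ω, ω ∈ E k → S k ω = W k ω ∧ hs k ω = h k := by
    intro k
    induction k with
    | zero => intro ω _; simp [hS, hW, hhs]
    | succ k ih =>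
      intro ω hω
      have h' := hEsub k hω
      obtain ⟨ha, hb⟩ := ih ω h'
      rw [hSs, hWs, hhss, hem1 k ω h', ha, hb]
      constructor <;> ring
  have i2 : ∀ k ω, S k ω ≤ hs k ω + c ∧ -H - c ≤ S k ω ∧ hs k ω ≤ h k ∧ h 0 ≤ hs k ω := by
    intro k
    induction k with
    | zero => intro ω; simp [hS, hhs]; constructor <;> linarith
    | succ k ih =>
      intro ω
      obtain ⟨a1, a2, a3, a4⟩ := ih ω
      have hm := hh (Nat.le_succ k)
      have hx := abs_le.1 (hXc k ω)
      by_cases hω : ω ∈ E k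
      · obtain ⟨ha, hb⟩ := i1 k ω hω
        have h3 := hω k le_rfl
        rw [hSs, hhss, hem1 k ω hω, ha, hb]
        simp only [Nat.succ_eq_add_one] at hm
        refine ⟨by linarith, by linarith, by linarith, ?_⟩
        have := hh (Nat.zero_le (k+1)); linarith
      · rw [hSs, hhss, hem0 k ω hω]
        simp only [Nat.succ_eq_add_one] at hm
        refine ⟨by linarith, by linarith, by linarith, by linarith⟩
  have i3 : ∀ k ω, ω ∈ D k → ω ∉ E k → S k ω ≤ -H := by
    intro k
    induction k with
    | zero =>
      intro ω _ hω
      exfalso; apply hω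
      intro i hi
      obtain rfl : i = 0 := by omega
      simp only [hW, Finset.range_zero, Finset.sum_empty]
      constructor <;> linarith
    | succ k ih =>
      intro ω hω1 hω2
      by_cases hω : ω ∈ E k
      · have ha := (i1 k ω hω).1
        have hWeq : S (k + 1) ω = W (k + 1) ω := by rw [hSs, hWs, hem1 k ω hω, ha]; ring
        by_contra hcon
        push Not at hcon
        apply hω2
        intro i hi
        rcases Nat.lt_or_ge i (k+1) with hi' | hi'
        · exact hω i (by omega)
        · obtain rfl : i = k + 1 := by omega
          exact ⟨by rw [← hWeq]; exact hcon.le, hω1 _ le_rfl⟩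
      · rw [hSs, hem0 k ω hω]
        simpa using ih ω (hDsub k hω1) hω
  -- measurability and integrability
  have bdI : ∀ (g : Ω → ℝ) (b : ℝ), Measurable g → (∀ ω, |g ω| ≤ b) → Integrable g P := by
    intro g b hg hb
    exact Integrable.of_bound hg.aestronglyMeasurable b (Filter.Eventually.of_forall hb)
  have hXmm : ∀ k, Measurable (X k) := fun k => (hXm k).mono (hF _) le_rfl
  have hemm : ∀ k, Measurable (e k) := fun k => (hemF k).mono (hF _) le_rfl
  have hSmF : ∀ k, Measurable[F k] (S k) := by
    intro k
    refine Finset.measurable_sum _ ?_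
    intro i hi
    have hi : i + 1 ≤ k := by simpa using hi
    exact ((hemF i).mono (hFm (by omega)) le_rfl).mul ((hXm i).mono (hFm hi) le_rfl)
  have hSmm : ∀ k, Measurable (S k) := fun k => (hSmF k).mono (hF _) le_rfl
  have hSb : ∀ k ω, |S k ω| ≤ H + h k + c := by
    intro k ω
    obtain ⟨a1, a2, a3, a4⟩ := i2 k ω
    rw [abs_le]; constructor <;> linarith
  have hSI : ∀ k, Integrable (S k) P := fun k => bdI _ _ (hSmm k) (hSb k)
  have heX : ∀ k, Integrable (fun ω => e k ω * X k ω) P := by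
    intro k
    refine bdI _ (1 * c) ((hemm k).mul (hXmm k)) ?_
    intro ω; rw [abs_mul]
    exact mul_le_mul (heb k ω) (hXc k ω) (abs_nonneg _) zero_le_one
  have hES : ∀ k, ∫ ω, S k ω ∂P = 0 := by
    intro k
    simp only [hS]
    rw [integral_finsetSum _ (fun i _ => heX i)]
    exact Finset.sum_eq_zero fun i _ => h1 i _ (hemF i) ⟨1, heb i⟩
  have hEe : ∀ k, ∫ ω, e k ω ∂P = P.real (E k) := by
    intro k
    simp only [he]
    rw [integral_indicator (hEm k)]; simp
  have hES2 : ∀ k, ∫ ω, S k ω ^ 2 ∂P = ∑ i ∈ Finset.range k, v i * P.real (E i) := by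
    intro k
    induction k with
    | zero => simp [hS]
    | succ k ih =>
      rw [Finset.sum_range_succ, ← ih, ← hEe, ← h2 k _ (hemF k) ⟨1, heb k⟩]
      have hz := h1 k (fun ω => 2 * (S k ω * e k ω))
        (((hSmF k).mul (hemF k)).const_mul (2:ℝ)) ⟨2 * ((H + h k + c) * 1), fun ω => by
          rw [abs_mul, abs_mul, abs_two]
          have := hSb k ω
          have := abs_nonneg (S k ω)
          gcongr
          · linarith
          · exact heb k ω⟩
      have ee : ∀ ω, S (k+1) ω ^ 2 = S k ω ^ 2 + (2 * (S k ω * e k ω) * X k ω + e k ω * X k ω ^ 2) := by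
        intro ω
        have : e k ω ^ 2 = e k ω := by
          by_cases hω : ω ∈ E k
          · rw [hem1 k ω hω]; norm_num
          · rw [hem0 k ω hω]; norm_num
        rw [hSs]
        linear_combination (X k ω ^ 2) * this
      have hSk2 : Integrable (fun ω => S k ω ^ 2) P := by
        refine bdI _ ((H + h k + c)^2) ((hSmm k).pow_const 2) fun ω => ?_
        rw [abs_pow]; exact pow_le_pow_left₀ (abs_nonneg _) (hSb k ω) 2
      have hi2 : Integrable (fun ω => 2 * (S k ω * e k ω) * X k ω) P := by
        refine bdI _ (2 * ((H + h k + c) * 1) * c) ((((hSmm k).mul (hemm k)).const_mul 2).mul (hXmm k)) fun ω => ?_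
        rw [abs_mul, abs_mul, abs_mul, abs_two]
        have := hSb k ω
        have := abs_nonneg (S k ω)
        have h0 : 0 ≤ H + h k + c := by linarith
        gcongr
        · exact heb k ω
        · exact hXc k ω
      have hi3 : Integrable (fun ω => e k ω * X k ω ^ 2) P := by
        refine bdI _ (1 * c ^ 2) ((hemm k).mul ((hXmm k).pow_const 2)) fun ω => ?_
        rw [abs_mul, abs_pow]
        gcongr
        · exact heb k ω
        · exact hXc k ω
      simp only [ee]
      have hi23 : Integrable (fun ω => 2 * (S k ω * e k ω) * X k ω + e k ω * X k ω ^ 2) P :=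
        hi2.add hi3
      rw [integral_add hSk2 hi23, integral_add hi2 hi3, hz, zero_add]
  -- the main quantities
  set R := c + h 0 + ∑ k ∈ Finset.range n, (h (k + 1) - h k) * P.real (D k) with hR
  have hsm : Measurable (hs n) := by
    refine measurable_const.add (Finset.measurable_sum _ fun i _ => (hemm i).mul_const _)
  have hsI : Integrable (hs n) P := by
    refine bdI _ (h n) hsm fun ω => ?_
    obtain ⟨a1, a2, a3, a4⟩ := i2 n ω
    rw [abs_le]; constructor <;> linarith
  have hEhs : ∫ ω, hs n ω ∂P + c ≤ R := by
    have : ∫ ω, hs n ω ∂P = h 0 + ∑ k ∈ Finset.range n, (h (k + 1) - h k) * P.real (E k) := by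
      simp only [hhs]
      rw [integral_add (integrable_const _) (integrable_finsetSum _ fun i _ =>
        (bdI _ 1 (hemm i) (heb i)).mul_const _), integral_finsetSum _ (fun i _ =>
        (bdI _ 1 (hemm i) (heb i)).mul_const _)]
      simp only [integral_const, probReal_univ, one_smul, integral_mul_const, hEe, smul_eq_mul, one_mul]
      congr 1
      exact Finset.sum_congr rfl fun i _ => mul_comm _ _
    rw [this, hR]
    have : ∑ k ∈ Finset.range n, (h (k + 1) - h k) * P.real (E k) ≤
        ∑ k ∈ Finset.range n, (h (k + 1) - h k) * P.real (D k) := by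
      refine Finset.sum_le_sum fun i _ => mul_le_mul_of_nonneg_left (measureReal_mono (hED i))
        (by have := hh (Nat.le_succ i); simp only [Nat.succ_eq_add_one] at this; linarith)
    linarith
  -- first part
  have p1 : H * P.real (D n \ E n) ≤ R := by
    have hY : ∫ ω, (hs n ω + c - S n ω) ∂P ≤ R := by
      have hsI' : Integrable (fun ω => hs n ω + c) P := hsI.add (integrable_const _)
      rw [integral_sub hsI' (hSI n), integral_add hsI (integrable_const _), hES]
      simpa using hEhs
    refine le_trans ?_ hY
    have : H * P.real (D n \ E n) = ∫ ω, (D n \ E n).indicator (fun _ => H) ω ∂P := by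
      rw [integral_indicator ((hDm n).diff (hEm n))]; simp [mul_comm]
    rw [this]
    refine integral_mono ((integrable_const _).indicator ((hDm n).diff (hEm n)))
      ((hsI.add (integrable_const _)).sub (hSI n)) fun ω => ?_
    obtain ⟨a1, a2, a3, a4⟩ := i2 n ω
    by_cases hω : ω ∈ D n \ E n
    · rw [Set.indicator_of_mem hω]
      have := i3 n ω hω.1 hω.2
      simp only; linarith
    · rw [Set.indicator_of_notMem hω]; simp only; linarith
  have p2 : (∑ k ∈ Finset.range n, v k) * P.real (E n) ≤ 2 * (H + h n + c) * R := by
    have q1 : (∑ k ∈ Finset.range n, v k) * P.real (E n) ≤ ∫ ω, S n ω ^ 2 ∂P := by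
      rw [hES2, Finset.sum_mul]
      refine Finset.sum_le_sum fun i hi => mul_le_mul_of_nonneg_left (measureReal_mono ?_) (hv i)
      intro ω hω j hj
      exact hω j (by have := Finset.mem_range.1 hi; omega)
    have q2 : ∫ ω, S n ω ^ 2 ∂P ≤ ∫ ω, (H + h n + c) * (2 * (hs n ω + c) - S n ω) ∂P := by
      refine integral_mono ?_ (((((hsI.add (integrable_const _)).const_mul 2).sub (hSI n))).const_mul _) fun ω => ?_
      · refine bdI _ ((H + h n + c)^2) ((hSmm n).pow_const 2) fun ω => ?_
        rw [abs_pow]; exact pow_le_pow_left₀ (abs_nonneg _) (hSb n ω) 2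
      · obtain ⟨a1, a2, a3, a4⟩ := i2 n ω
        have hb := hSb n ω
        simp only
        have : |S n ω| ≤ 2 * (hs n ω + c) - S n ω := by
          rw [abs_le]; constructor <;> linarith
        rw [← sq_abs, sq]
        exact mul_le_mul hb this (abs_nonneg _) (le_trans (abs_nonneg _) hb)
    have q3 : ∫ ω, (H + h n + c) * (2 * (hs n ω + c) - S n ω) ∂P =
        (H + h n + c) * (2 * (∫ ω, hs n ω ∂P + c)) := by
      have hsI' : Integrable (fun ω => hs n ω + c) P := hsI.add (integrable_const _)
      rw [integral_const_mul, integral_sub (hsI'.const_mul 2) (hSI n),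
        integral_const_mul, integral_add hsI (integrable_const _), hES]
      simp
    rw [q3] at q2
    have : 0 ≤ H + h n + c := by have := hh (Nat.zero_le n); linarith
    nlinarith
  have hsub : P.real (D n) ≤ P.real (D n \ E n) + P.real (E n) := by
    refine le_trans (measureReal_mono ?_) (measureReal_union_le _ _)
    intro ω hω; by_cases h' : ω ∈ E n
    · right; exact h'
    · left; exact ⟨hω, h'⟩
  have hs0 : 0 ≤ ∑ k ∈ Finset.range n, v k := Finset.sum_nonneg fun i _ => hv i
  calc (∑ k ∈ Finset.range n, v k) * P.real (D n)
      ≤ (∑ k ∈ Finset.range n, v k) * P.real (D n \ E n) + (∑ k ∈ Finset.range n, v k) * P.real (E n) := by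
        rw [← mul_add]; exact mul_le_mul_of_nonneg_left hsub hs0
    _ ≤ (∑ k ∈ Finset.range n, v k) * (R / H) + 2 * (H + h n + c) * R := by
        gcongr
        rw [le_div_iff₀ hH]; linarith
    _ = _ := by ring

theorem ballot_strong {Ω : Type*} {m0 : MeasurableSpace Ω} (P : Measure Ω) [IsProbabilityMeasure P]
    (F : ℕ → MeasurableSpace Ω) (hF : ∀ k, F k ≤ m0) (hFm : Monotone F)
    (X : ℕ → Ω → ℝ) (hXm : ∀ k, Measurable[F (k + 1)] (X k)) (c : ℝ) (hc : 0 ≤ c)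
    (hXc : ∀ k ω, |X k ω| ≤ c) (v : ℕ → ℝ) (hv : ∀ k, 0 ≤ v k)
    (h1 : ∀ k (Ψ : Ω → ℝ), Measurable[F k] Ψ → (∃ b, ∀ ω, |Ψ ω| ≤ b) →
      ∫ ω, Ψ ω * X k ω ∂P = 0)
    (h2 : ∀ k (Ψ : Ω → ℝ), Measurable[F k] Ψ → (∃ b, ∀ ω, |Ψ ω| ≤ b) →
      ∫ ω, Ψ ω * X k ω ^ 2 ∂P = v k * ∫ ω, Ψ ω ∂P)
    (h : ℕ → ℝ) (hh : Monotone h) (hh0 : 0 ≤ h 0) (n : ℕ) (R : ℝ)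
    (hR : (c + h 0 + ∑ k ∈ Finset.range n, (h (k + 1) - h k) *
        P.real {ω | ∀ i ≤ k, ∑ k ∈ Finset.range i, X k ω ≤ h i}) ≤ R)
    (hn : h n + c ≤ √(∑ k ∈ Finset.range n, v k)) :
    √(∑ k ∈ Finset.range n, v k) * P.real {ω | ∀ i ≤ n, ∑ k ∈ Finset.range i, X k ω ≤ h i}
      ≤ 5 * R := by
  have hR0 : 0 ≤ R := by
    refine le_trans ?_ hR
    have : 0 ≤ ∑ k ∈ Finset.range n, (h (k + 1) - h k) *
        P.real {ω | ∀ i ≤ k, ∑ k ∈ Finset.range i, X k ω ≤ h i} :=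
      Finset.sum_nonneg fun k _ => mul_nonneg (sub_nonneg.2 (hh (Nat.le_succ k)))
        measureReal_nonneg
    linarith
  have hs0 : 0 ≤ ∑ k ∈ Finset.range n, v k := Finset.sum_nonneg fun i _ => hv i
  set V := ∑ k ∈ Finset.range n, v k with hV
  rcases hs0.eq_or_lt with h0 | h0
  · rw [← h0]; simp; linarith
  have hH : 0 < √V := Real.sqrt_pos.2 h0
  have key := ballot_core P F hF hFm X hXm c hc hXc v hv h1 h2 h hh hh0 n (√V) hH
  rw [← hV] at key
  have e1 : V / √V = √V := Real.div_sqrt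
  rw [e1] at key
  have hn0 : 0 ≤ h n := le_trans hh0 (hh (Nat.zero_le n))
  have key2 : V * P.real {ω | ∀ i ≤ n, ∑ k ∈ Finset.range i, X k ω ≤ h i} ≤ (5 * √V) * R := by
    refine key.trans (mul_le_mul ?_ hR ?_ (by positivity))
    · linarith
    · have : 0 ≤ ∑ k ∈ Finset.range n, (h (k + 1) - h k) *
        P.real {ω | ∀ i ≤ k, ∑ k ∈ Finset.range i, X k ω ≤ h i} :=
        Finset.sum_nonneg fun k _ => mul_nonneg (sub_nonneg.2 (hh (Nat.le_succ k)))
          measureReal_nonneg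
      linarith
  have e2 : V = √V * √V := (Real.mul_self_sqrt hs0).symm
  rw [e2] at key2
  have : √V * (√V * P.real {ω | ∀ i ≤ n, ∑ k ∈ Finset.range i, X k ω ≤ h i}) ≤ √V * (5 * R) := by
    rw [Real.sqrt_mul_self hH.le] at key2
    nlinarith
  exact le_of_mul_le_mul_left this hH

theorem ballot_weak {Ω : Type*} {m0 : MeasurableSpace Ω} (P : Measure Ω) [IsProbabilityMeasure P]
    (F : ℕ → MeasurableSpace Ω) (hF : ∀ k, F k ≤ m0) (hFm : Monotone F)
    (X : ℕ → Ω → ℝ) (hXm : ∀ k, Measurable[F (k + 1)] (X k)) (c : ℝ) (hc : 0 ≤ c)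
    (hXc : ∀ k ω, |X k ω| ≤ c) (v : ℕ → ℝ) (hv : ∀ k, 0 ≤ v k)
    (h1 : ∀ k (Ψ : Ω → ℝ), Measurable[F k] Ψ → (∃ b, ∀ ω, |Ψ ω| ≤ b) →
      ∫ ω, Ψ ω * X k ω ∂P = 0)
    (h2 : ∀ k (Ψ : Ω → ℝ), Measurable[F k] Ψ → (∃ b, ∀ ω, |Ψ ω| ≤ b) →
      ∫ ω, Ψ ω * X k ω ^ 2 ∂P = v k * ∫ ω, Ψ ω ∂P)
    (h : ℕ → ℝ) (hh : Monotone h) (hh0 : 0 ≤ h 0) (n : ℕ) :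
    √(∑ k ∈ Finset.range n, v k) * P.real {ω | ∀ i ≤ n, ∑ k ∈ Finset.range i, X k ω ≤ h i}
      ≤ 5 * (h n + c) := by
  have hn0 : 0 ≤ h n := le_trans hh0 (hh (Nat.zero_le n))
  rcases le_total (h n + c) (√(∑ k ∈ Finset.range n, v k)) with hle | hle
  · have key := ballot_strong P F hF hFm X hXm c hc hXc v hv h1 h2 (fun _ => h n) monotone_const hn0
      n (c + h n) (by simp) hle
    rw [add_comm c] at key
    refine le_trans (mul_le_mul_of_nonneg_left (measureReal_mono ?_) (Real.sqrt_nonneg _)) key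
    intro ω hω i hi
    exact (hω i hi).trans (hh hi)
  · calc _ ≤ √(∑ k ∈ Finset.range n, v k) * 1 :=
        mul_le_mul_of_nonneg_left measureReal_le_one (Real.sqrt_nonneg _)
      _ ≤ _ := by linarith

end

noncomputable section

theorem sqrt_add_le' {x y : ℝ} (hx : 0 ≤ x) (hy : 0 ≤ y) : √(x + y) ≤ √x + √y := by
  rw [Real.sqrt_le_iff]
  refine ⟨by positivity, ?_⟩
  nlinarith [Real.sq_sqrt hx, Real.sq_sqrt hy, mul_nonneg (Real.sqrt_nonneg x) (Real.sqrt_nonneg y)]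

theorem ballot_log_const (c0 C0 c : ℝ) (hc0 : 0 < c0) (hC0 : 0 ≤ C0) (hc : 0 ≤ c) :
    ∃ C : ℝ, 0 < C ∧ ∀ {Ω : Type*} {m0 : MeasurableSpace Ω} (P : Measure Ω) [IsProbabilityMeasure P]
    (F : ℕ → MeasurableSpace Ω) (hF : ∀ k, F k ≤ m0) (hFm : Monotone F)
    (X : ℕ → Ω → ℝ) (hXm : ∀ k, Measurable[F (k + 1)] (X k))
    (hXc : ∀ k ω, |X k ω| ≤ c) (v : ℕ → ℝ) (hv : ∀ k, 0 ≤ v k)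
    (h1 : ∀ k (Ψ : Ω → ℝ), Measurable[F k] Ψ → (∃ b, ∀ ω, |Ψ ω| ≤ b) →
      ∫ ω, Ψ ω * X k ω ∂P = 0)
    (h2 : ∀ k (Ψ : Ω → ℝ), Measurable[F k] Ψ → (∃ b, ∀ ω, |Ψ ω| ≤ b) →
      ∫ ω, Ψ ω * X k ω ^ 2 ∂P = v k * ∫ ω, Ψ ω ∂P)
    (B : ℝ) (hB : 0 ≤ B) (n : ℕ) (j : ℕ → ℕ) (hj0 : j 0 = 0) (hjm : Monotone j)
    (hj1 : ∀ k, j (k + 1) ≤ j k + 1)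
    (hS : ∀ k ≤ n, c0 * j k - C0 ≤ ∑ i ∈ Finset.range k, v i),
    √(1 + j n : ℝ) * P.real {ω | ∀ i ≤ n, ∑ k ∈ Finset.range i, X k ω ≤ B + Real.log (1 + j i)}
      ≤ C * (1 + B) := by
  set a : ℝ := 1 / √c0 with ha
  set b : ℝ := √(C0 / c0 + 1) with hb
  have ha0 : 0 ≤ a := by positivity
  have hb0 : 0 ≤ b := by positivity
  set C1 : ℝ := 5 * a * (1 + 4 + c) + b with hC1
  have hC10 : 0 ≤ C1 := by positivity
  set g : ℕ → ℝ := fun j => ((j : ℝ) + 1) ^ (-(5 / 4 : ℝ)) with hg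
  have hgs : Summable g := by
    have : Summable fun n : ℕ => (n : ℝ) ^ (-(5 / 4 : ℝ)) :=
      Real.summable_nat_rpow.2 (by norm_num)
    have := (summable_nat_add_iff 1).2 this
    refine this.congr fun n => ?_
    simp [hg]
  have hg0 : ∀ j, 0 ≤ g j := fun j => by positivity
  set G : ℝ := ∑' j, g j with hG
  have hG0 : 0 ≤ G := tsum_nonneg hg0
  set C2 : ℝ := a * (5 * (c + 1 + C1 * G)) + b with hC2
  set C3 : ℝ := 2 * (a + a * c + b) + 16 * a ^ 2 with hC3
  refine ⟨C2 + C3 + 1, by positivity, ?_⟩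
  intro Ω m0 P _ F hF hFm X hXm hXc v hv h1 h2 B hB n j hj0 hjm hj1 hS
  set h : ℕ → ℝ := fun i => B + Real.log (1 + j i) with hh
  have hhm : Monotone h := by
    intro x y hxy
    have : (j x : ℝ) ≤ j y := by exact_mod_cast hjm hxy
    simp only [hh]
    have := Real.log_le_log (by positivity : (0 : ℝ) < 1 + j x) (by linarith : (1 : ℝ) + j x ≤ 1 + j y)
    linarith
  have hh0 : h 0 = B := by simp [hh, hj0]
  have hh0' : 0 ≤ h 0 := by rw [hh0]; exact hB
  set D : ℕ → Set Ω := fun k => {ω | ∀ i ≤ k, ∑ k ∈ Finset.range i, X k ω ≤ h i} with hD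
  have hP1 : ∀ k, P.real (D k) ≤ 1 := fun k => by
    exact measureReal_le_one
  have hP0 : ∀ k, 0 ≤ P.real (D k) := fun k => measureReal_nonneg
  -- square-root comparison
  have hsq : ∀ k ≤ n, √(1 + j k : ℝ) ≤ a * √(∑ i ∈ Finset.range k, v i) + b := by
    intro k hk
    have hS0 : 0 ≤ ∑ i ∈ Finset.range k, v i := Finset.sum_nonneg fun i _ => hv i
    have e1 : (1 + j k : ℝ) ≤ (∑ i ∈ Finset.range k, v i) / c0 + (C0 / c0 + 1) := by
      have := hS k hk
      have : (j k : ℝ) ≤ (∑ i ∈ Finset.range k, v i + C0) / c0 := by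
        rw [le_div_iff₀ hc0]; linarith
      rw [add_div] at this
      linarith
    refine (Real.sqrt_le_sqrt e1).trans ((sqrt_add_le' (by positivity) (by positivity)).trans ?_)
    rw [Real.sqrt_div hS0, ha, hb]
    apply le_of_eq; ring
  have hq : ∀ k, √(1 + j k : ℝ) = ((1 + j k : ℝ) ^ (1 / 4 : ℝ)) ^ 2 := by
    intro k
    rw [Real.sqrt_eq_rpow, ← Real.rpow_natCast, ← Real.rpow_mul (by positivity)]
    norm_num
  have hq1 : ∀ k, 1 ≤ (1 + j k : ℝ) ^ (1 / 4 : ℝ) := fun k =>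
    Real.one_le_rpow (by linarith [(Nat.cast_nonneg (j k) : (0 : ℝ) ≤ j k)]) (by norm_num)
  have hlog : ∀ k, Real.log (1 + j k) ≤ 4 * (1 + j k : ℝ) ^ (1 / 4 : ℝ) := by
    intro k
    have := Real.log_le_rpow_div (x := 1 + j k) (by positivity) (ε := 1 / 4) (by norm_num)
    linarith
  -- weak bound
  have hweak : ∀ k ≤ n, P.real (D k) ≤ C1 * (1 + B) * (1 + j k : ℝ) ^ (-(1 / 4 : ℝ)) := by
    intro k hk
    have w := ballot_weak P F hF hFm X hXm c hc hXc v hv h1 h2 h hhm hh0' k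
    change √(∑ k ∈ Finset.range k, v k) * P.real (D k) ≤ 5 * (h k + c) at w
    set y := (1 + j k : ℝ) ^ (1 / 4 : ℝ) with hy
    have hy1 := hq1 k
    have hyl := hlog k
    have e := hsq k hk
    rw [hq k] at e
    have e2 : y ^ 2 * P.real (D k) ≤ C1 * (1 + B) * y := by
      calc y ^ 2 * P.real (D k) ≤ (a * √(∑ i ∈ Finset.range k, v i) + b) * P.real (D k) :=
            mul_le_mul_of_nonneg_right e (hP0 k)
        _ = a * (√(∑ i ∈ Finset.range k, v i) * P.real (D k)) + b * P.real (D k) := by ring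
        _ ≤ a * (5 * (h k + c)) + b * 1 := by
            gcongr; exact hP1 k
        _ ≤ a * (5 * ((1 + 4 + c) * (1 + B) * y)) + b * ((1 + B) * y) := by
            have t1 : h k + c ≤ (1 + 4 + c) * (1 + B) * y := by
              have : h k + c ≤ B + 4 * y + c := by simp only [hh]; linarith
              have p1 : 0 ≤ B * (y - 1) := mul_nonneg hB (by linarith)
              have p2 : 0 ≤ c * (y - 1) := mul_nonneg hc (by linarith)
              have p3 : 0 ≤ c * B * y := by positivity
              have p4 : 0 ≤ B * y := by positivity
              nlinarith
            have t2 : 1 ≤ (1 + B) * y := by nlinarith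
            gcongr
        _ = C1 * (1 + B) * y := by rw [hC1]; ring
    have ey : (1 + j k : ℝ) ^ (-(1 / 4 : ℝ)) = y⁻¹ := by
      rw [Real.rpow_neg (by positivity)]
    have hy0 : 0 < y := by linarith
    rw [ey]
    have : P.real (D k) * y ≤ C1 * (1 + B) := by
      have : (P.real (D k) * y) * y ≤ C1 * (1 + B) * y := by nlinarith
      exact le_of_mul_le_mul_right this hy0
    rw [← div_eq_mul_inv, le_div_iff₀ hy0]
    exact this
  -- the sum
  have hsum : ∑ k ∈ Finset.range n, (h (k + 1) - h k) * P.real (D k) ≤ C1 * (1 + B) * G := by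
    have hterm : ∀ k ∈ Finset.range n, (h (k + 1) - h k) * P.real (D k) ≤
        C1 * (1 + B) * (∑ i ∈ Finset.range (j (k + 1)), g i - ∑ i ∈ Finset.range (j k), g i) := by
      intro k hk
      have hkn : k ≤ n := (Finset.mem_range.1 hk).le
      have hmono := hjm (Nat.le_succ k)
      rcases Nat.lt_or_ge (j k) (j (k + 1)) with hlt | hge
      · have hjj : j (k + 1) = j k + 1 := le_antisymm (hj1 k) hlt
        rw [hjj, Finset.sum_range_succ, add_sub_cancel_left]
        have d : h (k + 1) - h k ≤ (1 + j k : ℝ)⁻¹ := by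
          simp only [hh, hjj]
          push_cast
          have p : (0 : ℝ) < 1 + j k := by positivity
          have := Real.log_le_sub_one_of_pos (x := (1 + (j k + 1)) / (1 + j k : ℝ)) (by positivity)
          rw [Real.log_div (by positivity) (by positivity)] at this
          have e : (1 + (j k + 1)) / (1 + j k : ℝ) - 1 = (1 + j k : ℝ)⁻¹ := by
            field_simp; ring
          linarith
        calc (h (k + 1) - h k) * P.real (D k)
            ≤ (1 + j k : ℝ)⁻¹ * (C1 * (1 + B) * (1 + j k : ℝ) ^ (-(1 / 4 : ℝ))) := by
              refine mul_le_mul d (hweak k hkn) (hP0 k) (by positivity)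
          _ = C1 * (1 + B) * g (j k) := by
              simp only [hg]
              rw [← Real.rpow_neg_one, show ((j k : ℝ) + 1) = 1 + j k by ring,
                show (-(5 / 4 : ℝ)) = -1 + -(1 / 4) by norm_num, Real.rpow_add (by positivity)]
              ring
      · have hjj : j (k + 1) = j k := le_antisymm hge hmono
        have : h (k + 1) = h k := by simp only [hh, hjj]
        rw [this, hjj]; simp
    refine (Finset.sum_le_sum hterm).trans ?_
    rw [← Finset.mul_sum, Finset.sum_range_sub (fun k => ∑ i ∈ Finset.range (j k), g i)]
    simp only [hj0, Finset.range_zero, Finset.sum_empty, sub_zero]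
    refine mul_le_mul_of_nonneg_left ?_ (by positivity)
    exact hgs.sum_le_tsum _ fun i _ => hg0 i
  change √(1 + j n : ℝ) * P.real (D n) ≤ _
  have hC20 : 0 ≤ C2 := by positivity
  have hC30 : 0 ≤ C3 := by positivity
  rcases le_total (h n + c) (√(∑ k ∈ Finset.range n, v k)) with hle | hle
  · have key := ballot_strong P F hF hFm X hXm c hc hXc v hv h1 h2 h hhm hh0'
      n (c + B + C1 * (1 + B) * G) (by rw [hh0]; linarith) hle
    change √(∑ k ∈ Finset.range n, v k) * P.real (D n) ≤ _ at key
    calc √(1 + j n : ℝ) * P.real (D n) ≤ (a * √(∑ i ∈ Finset.range n, v i) + b) * P.real (D n) :=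
          mul_le_mul_of_nonneg_right (hsq n le_rfl) (hP0 n)
      _ = a * (√(∑ i ∈ Finset.range n, v i) * P.real (D n)) + b * P.real (D n) := by ring
      _ ≤ a * (5 * (c + B + C1 * (1 + B) * G)) + b * 1 := by
          gcongr; exact hP1 n
      _ ≤ a * (5 * ((c + 1 + C1 * G) * (1 + B))) + b * (1 + B) := by
          gcongr
          · have : 0 ≤ c * B := by positivity
            nlinarith
          · linarith
      _ = C2 * (1 + B) := by rw [hC2]; ring
      _ ≤ (C2 + C3 + 1) * (1 + B) := by gcongr; linarith
  · have e := hsq n le_rfl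
    have hyl := hlog n
    rw [hq n] at e ⊢
    set y := (1 + j n : ℝ) ^ (1 / 4 : ℝ) with hy
    have : y ^ 2 ≤ a * (B + 4 * y + c) + b := by
      refine e.trans ?_
      gcongr
      refine hle.trans ?_
      simp only [hh]; linarith
    have hy2 : y ^ 2 ≤ C3 * (1 + B) := by
      have s1 : 0 ≤ (y - 4 * a) ^ 2 := sq_nonneg _
      have p1 : 0 ≤ a * c * B := by positivity
      have p2 : 0 ≤ b * B := by positivity
      have p3 : 0 ≤ a ^ 2 * B := by positivity
      rw [hC3]
      nlinarith
    calc y ^ 2 * P.real (D n) ≤ y ^ 2 * 1 := by gcongr; exact hP1 n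
      _ ≤ C3 * (1 + B) := by linarith
      _ ≤ (C2 + C3 + 1) * (1 + B) := by gcongr; linarith

end

noncomputable section

/-- The uniform law on the unit circle. -/
def circ : Measure ℂ := Measure.map (fun θ : ℝ => Complex.exp (2 * π * θ * Complex.I))
        (volume.restrict (Set.Ioc (0 : ℝ) 1))

theorem circ_meas : Measurable (fun θ : ℝ => Complex.exp (2 * π * θ * Complex.I)) := by
  fun_prop

instance circ_prob : IsProbabilityMeasure circ := by
  have : IsProbabilityMeasure (volume.restrict (Set.Ioc (0 : ℝ) 1)) := ⟨by simp⟩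
  exact Measure.isProbabilityMeasure_map circ_meas.aemeasurable

theorem circ_norm : ∀ᵐ z ∂circ, ‖z‖ = 1 := by
  unfold circ
  rw [ae_map_iff circ_meas.aemeasurable (measurableSet_eq_fun measurable_norm measurable_const)]
  refine Filter.Eventually.of_forall fun θ => ?_
  have : (2 * π * θ * Complex.I : ℂ) = ((2 * π * θ : ℝ) : ℂ) * Complex.I := by push_cast; ring
  rw [this, Complex.norm_exp_ofReal_mul_I]

theorem circ_integral {E : Type*} [NormedAddCommGroup E] [NormedSpace ℝ E]
    {φ : ℂ → E} (hφ : StronglyMeasurable φ) :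
    ∫ z, φ z ∂circ = Real.circleAverage φ 0 1 := by
  unfold circ
  rw [integral_map circ_meas.aemeasurable hφ.aestronglyMeasurable, Real.circleAverage_def,
    ← intervalIntegral.integral_of_le zero_le_one]
  have h := intervalIntegral.smul_integral_comp_mul_left (a := 0) (b := 1)
    (fun θ : ℝ => φ (circleMap 0 1 θ)) (2 * π)
  rw [mul_zero, mul_one] at h
  rw [← h, smul_smul, inv_mul_cancel₀ (by positivity), one_smul]
  refine intervalIntegral.integral_congr fun θ _ => ?_
  simp [circleMap]

theorem circ_neg {φ : ℂ → ℝ} (hφ : Measurable φ) :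
    ∫ z, φ (-z) ∂circ = ∫ z, φ z ∂circ := by
  rw [circ_integral (φ := fun z => φ (-z)) (hφ.comp measurable_neg).stronglyMeasurable,
    circ_integral hφ.stronglyMeasurable, Real.circleAverage_def, Real.circleAverage_def]
  congr 1
  have h1 : ∀ θ : ℝ, φ (- circleMap 0 1 θ) = φ (circleMap 0 1 (θ + π)) := by
    intro θ
    congr 1
    simp only [circleMap]
    push_cast
    rw [add_mul, Complex.exp_add, Complex.exp_pi_mul_I]
    simp
  simp_rw [h1]
  rw [intervalIntegral.integral_comp_add_right (fun θ => φ (circleMap 0 1 θ))]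
  have hp : Function.Periodic (fun θ => φ (circleMap 0 1 θ)) (2 * π) := by
    intro θ
    simp only [periodic_circleMap 0 1 θ]
  have := hp.intervalIntegral_add_eq (0 + π) 0
  simp only [zero_add] at this ⊢
  rw [← this]
  congr 1
  ring

/-- Poisson weight. -/
def pw (a z : ℂ) : ℝ := (1 - ‖a‖ ^ 2) / ‖1 - a * z‖ ^ 2

/-- Centered logarithmic increment. -/
def yw (a z : ℂ) : ℝ := -Real.log ‖1 - a * z‖ + Real.log (1 - ‖a‖ ^ 2)

theorem pw_meas (a : ℂ) : Measurable (pw a) := by unfold pw; fun_prop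
theorem yw_meas (a : ℂ) : Measurable (yw a) := by
  unfold yw; exact ((measurable_log.comp (by fun_prop)).neg).add_const _

theorem norm_one_sub_bounds {a z : ℂ} (hz : ‖z‖ = 1) :
    1 - ‖a‖ ≤ ‖1 - a * z‖ ∧ ‖1 - a * z‖ ≤ 1 + ‖a‖ := by
  have h : ‖a * z‖ = ‖a‖ := by rw [norm_mul, hz, mul_one]
  constructor
  · have := norm_sub_norm_le (1:ℂ) (a * z)
    rw [h, norm_one] at this; exact this
  · have := norm_sub_le (1:ℂ) (a * z)
    rw [h, norm_one] at this; exact this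

theorem pw_nonneg {a : ℂ} (ha : ‖a‖ < 1) (z : ℂ) : 0 ≤ pw a z := by
  unfold pw
  have : 0 ≤ 1 - ‖a‖ ^ 2 := by nlinarith [norm_nonneg a]
  positivity

theorem pw_bounds {a z : ℂ} (ha : ‖a‖ < 1) (hz : ‖z‖ = 1) :
    (1 - ‖a‖) / (1 + ‖a‖) ≤ pw a z ∧ pw a z ≤ (1 + ‖a‖) / (1 - ‖a‖) := by
  obtain ⟨h1, h2⟩ := norm_one_sub_bounds (a := a) hz
  have h0 := norm_nonneg a
  have h3 : 0 < 1 - ‖a‖ := by linarith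
  have h4 : 0 < ‖1 - a * z‖ := by linarith
  have hA : (1 - ‖a‖) / (1 + ‖a‖) = (1 - ‖a‖ ^ 2) / (1 + ‖a‖) ^ 2 := by
    field_simp; ring
  have hB : (1 + ‖a‖) / (1 - ‖a‖) = (1 - ‖a‖ ^ 2) / (1 - ‖a‖) ^ 2 := by
    field_simp; ring
  have h5 : 0 ≤ 1 - ‖a‖ ^ 2 := by nlinarith
  unfold pw
  rw [hA, hB]
  constructor
  · gcongr
  · gcongr

theorem yw_bound {a z : ℂ} (ha : ‖a‖ < 1) (hz : ‖z‖ = 1) :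
    |yw a z| ≤ - Real.log (1 - ‖a‖) + Real.log (1 + ‖a‖) := by
  obtain ⟨h1, h2⟩ := norm_one_sub_bounds (a := a) hz
  have h0 := norm_nonneg a
  have h3 : 0 < 1 - ‖a‖ := by linarith
  have l1 := Real.log_le_log h3 h1
  have l2 := Real.log_le_log (by linarith) h2
  have e : Real.log (1 - ‖a‖ ^ 2) = Real.log (1 - ‖a‖) + Real.log (1 + ‖a‖) := by
    rw [← Real.log_mul (by linarith) (by linarith)]; congr 1; ring
  have p1 : Real.log (1 - ‖a‖) ≤ 0 := Real.log_nonpos (by linarith) (by linarith)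
  have p2 : 0 ≤ Real.log (1 + ‖a‖) := Real.log_nonneg (by linarith)
  unfold yw
  rw [e, abs_le]
  constructor <;> linarith

theorem circ_poisson {a : ℂ} (ha : ‖a‖ < 1) {g : ℂ → ℂ} (hgm : Measurable g)
    (hg : DifferentiableOn ℂ g (Metric.closedBall 0 1)) :
    ∫ z, (pw a z : ℂ) * g z ∂circ = g (starRingEnd ℂ a) := by
  have hd : DiffContOnCl ℂ g (Metric.ball 0 1) := by
    apply DifferentiableOn.diffContOnCl
    rwa [closure_ball _ one_ne_zero]
  have hw : (starRingEnd ℂ a) ∈ Metric.ball (0:ℂ) 1 := by simpa using ha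
  rw [circ_integral (φ := fun z => (pw a z : ℂ) * g z) (((Complex.measurable_ofReal.comp (pw_meas a)).mul hgm).stronglyMeasurable),
    ← DiffContOnCl.circleAverage_poissonKernel_smul hd hw]
  refine Real.circleAverage_congr_sphere fun z hz => ?_
  have hz1 : ‖z‖ = 1 := by simpa using hz
  have hzz : z * starRingEnd ℂ z = 1 := by
    rw [Complex.mul_conj, Complex.normSq_eq_norm_sq, hz1]; simp
  have key : ‖z - starRingEnd ℂ a‖ = ‖1 - a * z‖ := by
    have : z - starRingEnd ℂ a = z * starRingEnd ℂ (1 - a * z) := by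
      simp only [map_sub, map_mul, map_one]
      linear_combination (-(starRingEnd ℂ a)) * hzz.symm
    rw [this, norm_mul, hz1, one_mul, Complex.norm_conj]
  simp only [Pi.smul_apply', poissonKernel_def, sub_zero, pw, hz1, key, Complex.norm_conj,
    Complex.real_smul, one_pow]

theorem circ_pw {a : ℂ} (ha : ‖a‖ < 1) : ∫ z, pw a z ∂circ = 1 := by
  have h := circ_poisson ha (g := fun _ => 1) measurable_const (by fun_prop)
  simp only [mul_one] at h
  rw [integral_complex_ofReal] at h
  exact_mod_cast h

theorem circ_int_of_bdd {φ : ℂ → ℝ} (hφ : Measurable φ) {b : ℝ}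
    (hb : ∀ z, ‖z‖ = 1 → |φ z| ≤ b) : Integrable φ circ := by
  refine Integrable.of_bound hφ.aestronglyMeasurable b ?_
  filter_upwards [circ_norm] with z hz using hb z hz

theorem circ_pw_yw {a : ℂ} (ha : ‖a‖ < 1) : ∫ z, pw a z * yw a z ∂circ = 0 := by
  have hre : ∀ z : ℂ, ‖z‖ ≤ 1 → (1 - a * z) ∈ Complex.slitPlane := by
    intro z hz
    left
    have : (a * z).re ≤ ‖a * z‖ := Complex.re_le_norm _
    have h2 : ‖a * z‖ ≤ ‖a‖ := by
      rw [norm_mul]; exact mul_le_of_le_one_right (norm_nonneg _) hz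
    simp only [Complex.sub_re, Complex.one_re]
    linarith
  have h := circ_poisson ha (g := fun z => -Complex.log (1 - a * z))
    (Complex.measurable_log.comp (by fun_prop)).neg (by
      intro z hz
      apply DifferentiableAt.differentiableWithinAt
      have hd : DifferentiableAt ℂ (fun z => 1 - a * z) z := by fun_prop
      exact (DifferentiableAt.clog hd (hre z (by simpa using hz))).neg)
  have h' := congrArg Complex.re h
  have hb : ∀ z : ℂ, ‖z‖ = 1 → ‖Complex.log (1 - a * z)‖ ≤
      (-Real.log (1 - ‖a‖) + Real.log (1 + ‖a‖)) + π := by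
    intro z hz
    obtain ⟨h1, h2⟩ := norm_one_sub_bounds (a := a) hz
    have h0 := norm_nonneg a
    have h3 : 0 < 1 - ‖a‖ := by linarith
    have l1 := Real.log_le_log h3 h1
    have l2 := Real.log_le_log (by linarith) h2
    have p1 : Real.log (1 - ‖a‖) ≤ 0 := Real.log_nonpos (by linarith) (by linarith)
    have p2 : 0 ≤ Real.log (1 + ‖a‖) := Real.log_nonneg (by linarith)
    refine (Complex.norm_le_abs_re_add_abs_im _).trans ?_
    refine add_le_add ?_ ?_
    · rw [Complex.log_re, abs_le]; constructor <;> linarith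
    · rw [Complex.log_im]; exact Complex.abs_arg_le_pi _
  have hIntg : Integrable (fun z => (pw a z : ℂ) * -Complex.log (1 - a * z)) circ := by
    refine Integrable.of_bound (((Complex.measurable_ofReal.comp (pw_meas a)).mul
      (Complex.measurable_log.comp (by fun_prop)).neg).aestronglyMeasurable)
      ((1 + ‖a‖) / (1 - ‖a‖) * ((-Real.log (1 - ‖a‖) + Real.log (1 + ‖a‖)) + π)) ?_
    filter_upwards [circ_norm] with z hz
    rw [norm_mul, norm_neg]
    refine mul_le_mul ?_ (hb z hz) (norm_nonneg _) ?_
    · rw [Complex.norm_real, Real.norm_of_nonneg (pw_nonneg ha z)]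
      exact (pw_bounds ha hz).2
    · exact (pw_nonneg ha z).trans (pw_bounds ha hz).2
  have e1 : (∫ z, (pw a z : ℂ) * -Complex.log (1 - a * z) ∂circ).re
      = ∫ z, pw a z * (-Real.log ‖1 - a * z‖) ∂circ := by
    rw [← RCLike.re_eq_complex_re, ← integral_re hIntg]
    refine integral_congr_ae (Filter.Eventually.of_forall fun z => ?_)
    simp [Complex.log_re]
  rw [e1] at h'
  have e2 : a * starRingEnd ℂ a = ((‖a‖ ^ 2 : ℝ) : ℂ) := by
    rw [Complex.mul_conj, Complex.normSq_eq_norm_sq]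
  have e3 : (-Complex.log (1 - a * starRingEnd ℂ a)).re = -Real.log (1 - ‖a‖ ^ 2) := by
    rw [e2, Complex.neg_re, Complex.log_re]
    congr 2
    rw [show (1 : ℂ) - ((‖a‖ ^ 2 : ℝ) : ℂ) = ((1 - ‖a‖ ^ 2 : ℝ) : ℂ) by push_cast; ring,
      Complex.norm_real, Real.norm_of_nonneg]
    nlinarith [norm_nonneg a]
  rw [e3] at h'
  have i1 : Integrable (fun z => pw a z * (-Real.log ‖1 - a * z‖)) circ := by
    have := hIntg.re
    refine this.congr (Filter.Eventually.of_forall fun z => ?_)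
    simp [Complex.log_re]
  have i2 : Integrable (fun z => pw a z * Real.log (1 - ‖a‖ ^ 2)) circ := by
    refine Integrable.mul_const ?_ _
    refine circ_int_of_bdd (pw_meas a) (b := (1 + ‖a‖) / (1 - ‖a‖)) fun z hz => ?_
    rw [abs_of_nonneg (pw_nonneg ha z)]; exact (pw_bounds ha hz).2
  unfold yw
  simp_rw [mul_add]
  rw [integral_add i1 i2, h', integral_mul_const, circ_pw ha]
  ring

theorem circ_re_sq (a : ℂ) : ∫ z, (a * z).re ^ 2 ∂circ = ‖a‖ ^ 2 / 2 := by
  have h : ∫ z, (a * z) ^ 2 ∂circ = 0 := by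
    rw [circ_integral (by fun_prop : Measurable fun z : ℂ => (a * z) ^ 2).stronglyMeasurable]
    have hd : DiffContOnCl ℂ (fun z : ℂ => (a * z) ^ 2) (Metric.ball 0 |1|) := by
      apply Differentiable.diffContOnCl; fun_prop
    rw [hd.circleAverage]; simp
  have hIntg : Integrable (fun z => (a * z) ^ 2) circ := by
    refine Integrable.of_bound (by fun_prop) (‖a‖ ^ 2) ?_
    filter_upwards [circ_norm] with z hz
    simp [hz]
  have h' := congrArg Complex.re h
  rw [← RCLike.re_eq_complex_re, ← integral_re hIntg] at h'
  have e : ∀ᵐ z ∂circ, (a * z).re ^ 2 = (RCLike.re ((a * z) ^ 2)) / 2 + ‖a‖ ^ 2 / 2 := by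
    filter_upwards [circ_norm] with z hz
    have h1 : ‖a‖ ^ 2 = (a * z).re ^ 2 + (a * z).im ^ 2 := by
      have : ‖a‖ = ‖a * z‖ := by rw [norm_mul, hz, mul_one]
      rw [this, ← Complex.normSq_eq_norm_sq, Complex.normSq_apply]; ring
    have h2 : ((a * z) ^ 2).re = (a * z).re ^ 2 - (a * z).im ^ 2 := by
      rw [sq (a * z), Complex.mul_re (a * z) (a * z)]; ring
    rw [h1, RCLike.re_eq_complex_re, h2]
    ring
  rw [integral_congr_ae e, integral_add (hIntg.re.div_const _) (integrable_const _),
    integral_div, h']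
  simp

theorem log_ratio_sq {s y : ℝ} (h : |y| < s) (hs : s ≤ 2) :
    (y / 2) ^ 2 ≤ (Real.log (s + y) - Real.log (s - y)) ^ 2 := by
  rw [abs_lt] at h
  have aux : ∀ y : ℝ, 0 ≤ y → y < s → y / 2 ≤ Real.log (s + y) - Real.log (s - y) := by
    intro y h0 h1
    rw [← Real.log_div (by linarith) (by linarith)]
    have := Real.one_sub_inv_le_log_of_pos (x := (s + y) / (s - y))
      (div_pos (by linarith) (by linarith))
    refine le_trans ?_ this
    rw [inv_div, one_sub_div (by linarith), div_le_div_iff₀ (by norm_num) (by linarith)]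
    nlinarith
  rcases le_total 0 y with h0 | h0
  · have := aux y h0 h.2
    exact pow_le_pow_left₀ (by linarith) this 2
  · have := aux (-y) (by linarith) (by linarith)
    rw [show s + -y = s - y by ring, show s - -y = s + y by ring] at this
    have := pow_le_pow_left₀ (by linarith) this 2
    calc (y / 2) ^ 2 = (-y / 2) ^ 2 := by ring
      _ ≤ _ := this
      _ = _ := by ring

/-- Variance lower bound. -/
theorem circ_var {a : ℂ} (ha : ‖a‖ ^ 2 ≤ 1 / 2) :
    ‖a‖ ^ 2 / 384 ≤ ∫ z, pw a z * yw a z ^ 2 ∂circ := by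
  have h0 := norm_nonneg a
  have ha1 : ‖a‖ ≤ 5 / 7 := by nlinarith
  have hlt : ‖a‖ < 1 := by linarith
  set b := - Real.log (1 - ‖a‖) + Real.log (1 + ‖a‖)
  have iy : Integrable (fun z => yw a z ^ 2) circ := by
    refine circ_int_of_bdd ((yw_meas a).pow_const 2) (b := b ^ 2) fun z hz => ?_
    rw [abs_pow]; exact pow_le_pow_left₀ (abs_nonneg _) (yw_bound hlt hz) 2
  have iy' : Integrable (fun z => yw a (-z) ^ 2) circ := by
    refine circ_int_of_bdd (((yw_meas a).comp measurable_neg).pow_const 2) (b := b ^ 2)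
      fun z hz => ?_
    rw [abs_pow]; exact pow_le_pow_left₀ (abs_nonneg _) (yw_bound hlt (by simpa using hz)) 2
  have ir : Integrable (fun z : ℂ => (a * z).re ^ 2) circ := by
    refine circ_int_of_bdd (by fun_prop) (b := ‖a‖ ^ 2) fun z hz => ?_
    rw [abs_pow]
    refine pow_le_pow_left₀ (abs_nonneg _) ?_ 2
    refine (Complex.abs_re_le_norm _).trans ?_
    rw [norm_mul, hz, mul_one]
  have ip : Integrable (fun z => pw a z * yw a z ^ 2) circ := by
    refine circ_int_of_bdd ((pw_meas a).mul ((yw_meas a).pow_const 2))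
      (b := (1 + ‖a‖) / (1 - ‖a‖) * b ^ 2) fun z hz => ?_
    rw [abs_mul, abs_pow, abs_of_nonneg (pw_nonneg hlt z)]
    have := (pw_bounds hlt hz).2
    exact mul_le_mul this (pow_le_pow_left₀ (abs_nonneg _) (yw_bound hlt hz) 2) (by positivity)
      ((pw_nonneg hlt z).trans this)
  have hsym : ∫ z, yw a z ^ 2 ∂circ = ∫ z, (yw a z ^ 2 + yw a (-z) ^ 2) / 2 ∂circ := by
    rw [integral_div, integral_add iy iy', circ_neg ((yw_meas a).pow_const 2)]; ring
  have hpt : ∀ᵐ z ∂circ, (a * z).re ^ 2 * (1 / 16) ≤ (yw a z ^ 2 + yw a (-z) ^ 2) / 2 := by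
    filter_upwards [circ_norm] with z hz
    set x := (a * z).re with hx
    have hn : ∀ w : ℂ, ‖w‖ = 1 → Real.log ‖1 - a * w‖ =
        Real.log (1 + ‖a‖ ^ 2 - 2 * (a * w).re) / 2 := by
      intro w hw
      have : ‖1 - a * w‖ ^ 2 = 1 + ‖a‖ ^ 2 - 2 * (a * w).re := by
        have e : ‖a‖ = ‖a * w‖ := by rw [norm_mul, hw, mul_one]
        rw [e, ← Complex.normSq_eq_norm_sq, ← Complex.normSq_eq_norm_sq, Complex.normSq_apply,
          Complex.normSq_apply]
        simp only [Complex.sub_re, Complex.sub_im, Complex.one_re, Complex.one_im]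
        ring
      rw [← this, Real.log_pow]; push_cast; ring
    have e1 := hn z hz
    have e2 := hn (-z) (by simpa using hz)
    have e3 : (a * -z).re = -x := by simp [hx]
    rw [e3] at e2
    have habs : |x| ≤ ‖a‖ := by
      refine (Complex.abs_re_le_norm _).trans ?_
      rw [norm_mul, hz, mul_one]
    have hl := log_ratio_sq (s := 1 + ‖a‖ ^ 2) (y := 2 * x) (by
      rw [abs_mul, abs_two]; nlinarith) (by linarith)
    have d : yw a z - yw a (-z) = (Real.log (1 + ‖a‖ ^ 2 + 2 * x)
        - Real.log (1 + ‖a‖ ^ 2 - 2 * x)) / 2 := by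
      unfold yw; rw [e1, e2, show 1 + ‖a‖ ^ 2 - 2 * -x = 1 + ‖a‖ ^ 2 + 2 * x by ring]; ring
    have hq : x ^ 2 / 4 ≤ (yw a z - yw a (-z)) ^ 2 := by
      rw [d]; nlinarith
    nlinarith [sq_nonneg (yw a z + yw a (-z))]
  have hI : ‖a‖ ^ 2 / 2 * (1 / 16) ≤ ∫ z, yw a z ^ 2 ∂circ := by
    rw [hsym, ← circ_re_sq a, ← integral_mul_const]
    exact integral_mono_ae (ir.mul_const _) ((iy.add iy').div_const 2) hpt
  have hJ : ∫ z, (1 / 6) * yw a z ^ 2 ∂circ ≤ ∫ z, pw a z * yw a z ^ 2 ∂circ := by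
    refine integral_mono_ae (iy.const_mul _) ip ?_
    filter_upwards [circ_norm] with z hz
    refine mul_le_mul_of_nonneg_right ?_ (sq_nonneg _)
    refine le_trans ?_ (pw_bounds hlt hz).1
    rw [div_le_div_iff₀ (by norm_num) (by linarith)]; linarith
  rw [integral_const_mul] at hJ
  have : ‖a‖ ^ 2 / 384 ≤ 1 / 6 * (‖a‖ ^ 2 / 2 * (1 / 16)) := by nlinarith [sq_nonneg ‖a‖]
  linarith

end

noncomputable section

/-- Sigma-algebra generated by the values at primes in `S`. -/
def gen {Ω : Type*} (f : Ω → ℕ → ℂ) (S : Set Nat.Primes) : MeasurableSpace Ω :=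
  ⨆ p ∈ S, MeasurableSpace.comap (fun ω => f ω (p : ℕ)) inferInstance

/-- The natural filtration. -/
def fil {Ω : Type*} (f : Ω → ℕ → ℂ) (k : ℕ) : MeasurableSpace Ω :=
  gen f {p | (p : ℕ) < k}

/-- Normalised Steinhaus function: unimodular everywhere. -/
structure SN {Ω : Type*} [MeasurableSpace Ω] (μ : Measure Ω)
    (f : Ω → ℕ → ℂ) : Prop extends IsSteinhausRMF μ f where
  nrm : ∀ ω n, 1 ≤ n → ‖f ω n‖ = 1

section
variable {Ω : Type*} {m0 : MeasurableSpace Ω} {μ : Measure Ω} {f : Ω → ℕ → ℂ}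

theorem gen_le (hf : IsSteinhausRMF μ f) (S : Set Nat.Primes) : gen f S ≤ m0 := by
  unfold gen
  refine iSup₂_le fun p _ => ?_
  exact (hf.meas p).comap_le

theorem gen_mono {S T : Set Nat.Primes} (h : S ⊆ T) : gen f S ≤ gen f T :=
  biSup_mono h

theorem fil_le (hf : IsSteinhausRMF μ f) (k : ℕ) : fil f k ≤ m0 := gen_le hf _

theorem fil_mono : Monotone (fil f) := by
  intro a b h
  exact gen_mono fun p hp => lt_of_lt_of_le hp h

theorem gen_meas {S : Set Nat.Primes} {p : Nat.Primes} (hp : p ∈ S) :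
    Measurable[gen f S] fun ω => f ω (p : ℕ) := by
  have h : MeasurableSpace.comap (fun ω => f ω (p : ℕ)) inferInstance ≤ gen f S :=
    le_iSup₂_of_le p hp le_rfl
  exact (comap_measurable (fun ω => f ω (p : ℕ))).mono h le_rfl

theorem fil_meas {k p : ℕ} (hp : p.Prime) (h : p < k) :
    Measurable[fil f k] fun ω => f ω p :=
  gen_meas (f := f) (S := {q | (q : ℕ) < k}) (p := ⟨p, hp⟩) h

theorem gen_indep (hf : IsSteinhausRMF μ f) {S : Set Nat.Primes} {p : Nat.Primes} (hp : p ∉ S) :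
    Indep (gen f S) (MeasurableSpace.comap (fun ω => f ω (p : ℕ)) inferInstance) μ := by
  have h := indep_iSup_of_disjoint (m := fun p : Nat.Primes =>
    MeasurableSpace.comap (fun ω => f ω (p : ℕ)) inferInstance)
    (fun p => (hf.meas p).comap_le) hf.indep.iIndep (S := S) (T := {p}) (by simpa using hp)
  simpa [gen] using h

theorem law_eq (hf : IsSteinhausRMF μ f) {p : ℕ} (hp : p.Prime) :
    Measure.map (fun ω => f ω p) μ = circ := hf.unif p hp

theorem lint_indep (hf : IsSteinhausRMF μ f) {S : Set Nat.Primes} {p : Nat.Primes} (hp : p ∉ S)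
    {Ψ : Ω → ENNReal} (hΨ : Measurable[gen f S] Ψ) {φ : ℂ → ENNReal} (hφ : Measurable φ) :
    ∫⁻ ω, Ψ ω * φ (f ω p) ∂μ = (∫⁻ ω, Ψ ω ∂μ) * ∫⁻ z, φ z ∂circ := by
  have h := lintegral_mul_eq_lintegral_mul_lintegral_of_independent_measurableSpace (gen_le hf S)
    (hf.meas p).comap_le (gen_indep hf hp) hΨ (hφ.comp (comap_measurable _))
  simp only [Function.comp_apply] at h
  rw [h, ← law_eq hf p.2, lintegral_map hφ (hf.meas p)]

theorem int_indep (hf : IsSteinhausRMF μ f) {𝕜 : Type*} [RCLike 𝕜]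
    {S : Set Nat.Primes} {p : Nat.Primes} (hp : p ∉ S)
    {Ψ : Ω → 𝕜} (hΨ : Measurable[gen f S] Ψ) {φ : ℂ → 𝕜} (hφ : Measurable φ) :
    ∫ ω, Ψ ω * φ (f ω p) ∂μ = (∫ ω, Ψ ω ∂μ) * ∫ z, φ z ∂circ := by
  have hi : IndepFun Ψ (fun ω => φ (f ω p)) μ := by
    rw [IndepFun_iff_Indep]
    refine indep_of_indep_of_le_left (indep_of_indep_of_le_right (gen_indep hf hp) ?_) ?_
    · exact (hφ.comp (comap_measurable (fun ω => f ω (p : ℕ)))).comap_le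
    · exact hΨ.comap_le
  rw [hi.integral_fun_mul_eq_mul_integral (hΨ.mono (gen_le hf S) le_rfl).aestronglyMeasurable
    (hφ.comp (hf.meas p)).aestronglyMeasurable, ← law_eq hf p.2,
    integral_map (hf.meas p).aemeasurable hφ.aestronglyMeasurable]

/-- Reduction to the unimodular case. -/
theorem exists_SN [IsProbabilityMeasure μ] (hf : IsSteinhausRMF μ f) :
    ∃ g : Ω → ℕ → ℂ, SN μ g ∧ ∀ᵐ ω ∂μ, f ω = g ω := by
  classical
  set A : Set Ω := {ω | ∀ p : Nat.Primes, ‖f ω p‖ = 1} with hA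
  have hAm : MeasurableSet A := by
    rw [hA, Set.setOf_forall]
    refine MeasurableSet.iInter fun p => ?_
    exact measurableSet_eq_fun (hf.meas p).norm measurable_const
  have hAe : ∀ᵐ ω ∂μ, ω ∈ A := by
    rw [hA]
    simp only [Set.mem_setOf_eq]
    rw [ae_all_iff]
    intro p
    have h := circ_norm
    rw [← law_eq hf p.2, ae_map_iff (hf.meas p).aemeasurable
      (measurableSet_eq_fun measurable_norm measurable_const)] at h
    exact h
  set g : Ω → ℕ → ℂ := fun ω n => if ω ∈ A then f ω n else 1 with hg
  have hfg : ∀ᵐ ω ∂μ, f ω = g ω := by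
    filter_upwards [hAe] with ω h
    funext n
    simp [hg, h]
  have hmul : ∀ (ω : Ω) (m n : ℕ), 1 ≤ m → 1 ≤ n → g ω (m * n) = g ω m * g ω n := by
    intro ω m n hm hn
    by_cases h : ω ∈ A
    · simp [hg, h, hf.map_mul ω m n hm hn]
    · simp [hg, h]
  have hone : ∀ ω, g ω 1 = 1 := by
    intro ω; simp [hg, hf.map_one]
  refine ⟨g, ⟨⟨?_, ?_, ?_, hone, hmul⟩, ?_⟩, hfg⟩
  · intro n
    exact Measurable.ite hAm (hf.meas n) measurable_const
  · refine iIndepFun.congr (fun p => ?_) hf.indep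
    filter_upwards [hfg] with ω h
    rw [h]
  · intro p hp
    rw [← hf.unif p hp]
    refine Measure.map_congr ?_
    filter_upwards [hfg] with ω h
    rw [h]
  · intro ω n
    induction n using Nat.recOnMul with
    | zero => intro h; omega
    | one => intro _; rw [hone]; simp
    | prime p hp =>
      intro _
      by_cases h : ω ∈ A
      · simp only [hg, h, if_true]; exact h ⟨p, hp⟩
      · simp [hg, h]
    | mul a b ha hb =>
      intro h
      have ha0 : 1 ≤ a := Nat.one_le_iff_ne_zero.2 (by rintro rfl; simp at h)
      have hb0 : 1 ≤ b := Nat.one_le_iff_ne_zero.2 (by rintro rfl; simp at h)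
      rw [hmul ω a b ha0 hb0, norm_mul, ha ha0, hb hb0, one_mul]

theorem circ_pow_conj {a b : ℕ} (h : a ≠ b) : ∫ z, z ^ a * (starRingEnd ℂ z) ^ b ∂circ = 0 := by
  have key : ∀ n : ℕ, n ≠ 0 → ∫ z, z ^ n ∂circ = 0 := by
    intro n hn
    rw [circ_integral (by fun_prop : Measurable fun z : ℂ => z ^ n).stronglyMeasurable]
    have hd : DiffContOnCl ℂ (fun z : ℂ => z ^ n) (Metric.ball 0 |1|) := by
      apply Differentiable.diffContOnCl; fun_prop
    rw [hd.circleAverage]; simp [hn]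
  have hzz : ∀ z : ℂ, ‖z‖ = 1 → z * starRingEnd ℂ z = 1 := by
    intro z hz
    rw [Complex.mul_conj, Complex.normSq_eq_norm_sq, hz]; simp
  rcases lt_or_gt_of_ne h with h | h
  · obtain ⟨d, rfl⟩ := Nat.exists_eq_add_of_lt h
    have e : ∀ᵐ z ∂circ, z ^ a * (starRingEnd ℂ z) ^ (a + d + 1) = starRingEnd ℂ (z ^ (d + 1)) := by
      filter_upwards [circ_norm] with z hz
      rw [add_assoc, pow_add, ← mul_assoc, ← mul_pow, hzz z hz, one_pow, one_mul, map_pow]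
    rw [integral_congr_ae e, integral_conj, key _ (by omega), map_zero]
  · obtain ⟨d, rfl⟩ := Nat.exists_eq_add_of_lt h
    have e : ∀ᵐ z ∂circ, z ^ (b + d + 1) * (starRingEnd ℂ z) ^ b = z ^ (d + 1) := by
      filter_upwards [circ_norm] with z hz
      rw [add_assoc, pow_add, mul_comm, ← mul_assoc, ← mul_pow, mul_comm (starRingEnd ℂ z), hzz z hz, one_pow, one_mul]
    rw [integral_congr_ae e, key _ (by omega)]

theorem f_pow (hf : IsSteinhausRMF μ f) (ω : Ω) {p : ℕ} (hp : 1 ≤ p) (a : ℕ) :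
    f ω (p ^ a) = f ω p ^ a := by
  induction a with
  | zero => simp [hf.map_one]
  | succ a ih => rw [pow_succ, hf.map_mul ω _ _ (Nat.one_le_pow _ _ hp) hp, ih, pow_succ]

theorem f_gen_meas (hf : IsSteinhausRMF μ f) {p : Nat.Primes} :
    ∀ m : ℕ, 1 ≤ m → ¬ (p : ℕ) ∣ m → Measurable[gen f {q | q ≠ p}] fun ω => f ω m := by
  intro m
  induction m using Nat.recOnMul with
  | zero => intro h; omega
  | one =>
    intro _ _
    have : (fun ω => f ω 1) = fun _ => 1 := by funext ω; exact hf.map_one ω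
    rw [this]; exact measurable_const
  | prime q hq =>
    intro _ hd
    refine gen_meas (f := f) (S := {q | q ≠ p}) (p := ⟨q, hq⟩) ?_
    rintro h
    apply hd
    rw [← h]
  | mul a b ha hb =>
    intro h hd
    have ha0 : 1 ≤ a := Nat.one_le_iff_ne_zero.2 (by rintro rfl; simp at h)
    have hb0 : 1 ≤ b := Nat.one_le_iff_ne_zero.2 (by rintro rfl; simp at h)
    have e : (fun ω => f ω (a * b)) = fun ω => f ω a * f ω b := by
      funext ω; exact hf.map_mul ω a b ha0 hb0
    rw [e]
    exact Measurable.mul (ha ha0 fun h => hd (h.mul_right b)) (hb hb0 fun h => hd (h.mul_left a))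

/-- Orthogonality. -/
theorem f_orth (hf : IsSteinhausRMF μ f) {m n : ℕ} (hm : 1 ≤ m) (hn : 1 ≤ n) (h : m ≠ n) :
    ∫ ω, f ω m * starRingEnd ℂ (f ω n) ∂μ = 0 := by
  obtain ⟨p, hp, hv⟩ : ∃ p : ℕ, p.Prime ∧ m.factorization p ≠ n.factorization p := by
    by_contra hcon
    push Not at hcon
    apply h
    refine Nat.eq_of_factorization_eq (by omega) (by omega) fun p => ?_
    by_cases hp : p.Prime
    · exact hcon p hp
    · simp [Nat.factorization_eq_zero_of_not_prime _ hp]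
  have dec : ∀ m : ℕ, 1 ≤ m → 1 ≤ m / p ^ m.factorization p ∧
      ¬ p ∣ m / p ^ m.factorization p ∧
      ∀ ω, f ω m = f ω p ^ m.factorization p * f ω (m / p ^ m.factorization p) := by
    intro m hm
    have h1 : 1 ≤ m / p ^ m.factorization p := Nat.one_le_iff_ne_zero.2
      (Nat.pos_iff_ne_zero.1 (Nat.ordCompl_pos p (by omega)))
    refine ⟨h1, Nat.not_dvd_ordCompl hp (by omega), fun ω => ?_⟩
    rw [← f_pow hf ω hp.one_lt.le, ← hf.map_mul ω _ _ (Nat.one_le_pow _ _ hp.pos) h1,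
      Nat.ordProj_mul_ordCompl_eq_self]
  obtain ⟨m1, m2, m3⟩ := dec m hm
  obtain ⟨n1, n2, n3⟩ := dec n hn
  have e : ∀ ω, f ω m * starRingEnd ℂ (f ω n) =
      (f ω (m / p ^ m.factorization p) * starRingEnd ℂ (f ω (n / p ^ n.factorization p))) *
      (f ω p ^ m.factorization p * (starRingEnd ℂ (f ω p)) ^ n.factorization p) := by
    intro ω
    rw [m3, n3, map_mul, map_pow]; ring
  simp_rw [e]
  have cm : Measurable (starRingEnd ℂ : ℂ → ℂ) := Complex.continuous_conj.measurable
  have := int_indep hf (𝕜 := ℂ) (p := ⟨p, hp⟩) (S := {q | q ≠ (⟨p, hp⟩ : Nat.Primes)})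
    (fun h => h rfl)
    (Ψ := fun ω => f ω (m / p ^ m.factorization p) *
      starRingEnd ℂ (f ω (n / p ^ n.factorization p)))
    (Measurable.mul (f_gen_meas hf (p := ⟨p, hp⟩) _ m1 m2)
      (cm.comp (f_gen_meas hf (p := ⟨p, hp⟩) _ n1 n2)))
    (φ := fun z => z ^ m.factorization p * (starRingEnd ℂ z) ^ n.factorization p)
    ((measurable_id.pow_const _).mul (cm.pow_const _))
  rw [this, circ_pow_conj hv, mul_zero]

/-- `E |∑_{m ∈ A} f m|^2 = |A|`. -/
theorem f_l2 [IsProbabilityMeasure μ] (hf : SN μ f) (A : Finset ℕ) (hA : ∀ m ∈ A, 1 ≤ m) :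
    ∫ ω, ‖∑ m ∈ A, f ω m‖ ^ 2 ∂μ = A.card := by
  have cm : Measurable (starRingEnd ℂ : ℂ → ℂ) := Complex.continuous_conj.measurable
  have e : ∀ ω, ((‖∑ m ∈ A, f ω m‖ ^ 2 : ℝ) : ℂ) =
      ∑ m ∈ A, ∑ n ∈ A, f ω m * starRingEnd ℂ (f ω n) := by
    intro ω
    rw [← Finset.sum_mul_sum, ← map_sum, Complex.mul_conj, Complex.normSq_eq_norm_sq]
  have hIntg : ∀ m ∈ A, ∀ n ∈ A, Integrable (fun ω => f ω m * starRingEnd ℂ (f ω n)) μ := by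
    intro m hm n hn
    refine Integrable.of_bound ((hf.meas m).mul (cm.comp (hf.meas n))).aestronglyMeasurable 1 ?_
    refine Filter.Eventually.of_forall fun ω => ?_
    rw [norm_mul, Complex.norm_conj, hf.nrm ω m (hA m hm), hf.nrm ω n (hA n hn), one_mul]
  have : ((∫ ω, ‖∑ m ∈ A, f ω m‖ ^ 2 ∂μ : ℝ) : ℂ) = (A.card : ℂ) := by
    rw [← integral_complex_ofReal]
    simp_rw [e]
    rw [integral_finsetSum _ fun m hm => integrable_finsetSum _ fun n hn => hIntg m hm n hn]
    have : ∀ m ∈ A, ∫ ω, ∑ n ∈ A, f ω m * starRingEnd ℂ (f ω n) ∂μ = 1 := by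
      intro m hm
      rw [integral_finsetSum _ fun n hn => hIntg m hm n hn, Finset.sum_eq_single m]
      · have : ∀ ω, f ω m * starRingEnd ℂ (f ω m) = 1 := by
          intro ω
          rw [Complex.mul_conj, Complex.normSq_eq_norm_sq, hf.nrm ω m (hA m hm)]; simp
        simp_rw [this]; simp
      · intro n hn hne
        exact f_orth hf.toIsSteinhausRMF (hA m hm) (hA n hn) hne.symm
      · intro h; exact absurd hm h
    rw [Finset.sum_congr rfl this]; simp
  exact_mod_cast this

end
end

noncomputable section

/-- Normalised Euler product density. -/
def Dk {Ω : Type*} (f : Ω → ℕ → ℂ) (k : ℕ) (s : ℂ) (ω : Ω) : ℝ :=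
  ∏ p ∈ k.primesBelow, pw ((p : ℂ) ^ (-s)) (f ω p)

/-- The normalised mass martingale. -/
def Mk {Ω : Type*} (f : Ω → ℕ → ℂ) (k : ℕ) (σ : ℝ) (ω : Ω) : ENNReal :=
  ∫⁻ t : ℝ, ENNReal.ofReal (Dk f k (σ + t * Complex.I) ω / (σ ^ 2 + t ^ 2))

theorem coef_norm {p : ℕ} (hp : p.Prime) (s : ℂ) : ‖(p : ℂ) ^ (-s)‖ = (p : ℝ) ^ (-s.re) := by
  rw [Complex.norm_natCast_cpow_of_pos hp.pos]; simp

theorem coef_lt {p : ℕ} (hp : p.Prime) {s : ℂ} (hs : 0 < s.re) : ‖(p : ℂ) ^ (-s)‖ < 1 := by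
  rw [coef_norm hp]
  exact Real.rpow_lt_one_of_one_lt_of_neg (by exact_mod_cast hp.one_lt) (by linarith)

section
variable {Ω : Type*} {m0 : MeasurableSpace Ω} {μ : Measure Ω} {f : Ω → ℕ → ℂ}

theorem Dk_succ (k : ℕ) (s : ℂ) (ω : Ω) :
    Dk f (k + 1) s ω = Dk f k s ω * if k.Prime then pw ((k : ℂ) ^ (-s)) (f ω k) else 1 := by
  unfold Dk
  rw [Nat.primesBelow_succ]
  split_ifs with h
  · rw [Finset.prod_insert (Nat.notMem_primesBelow k), mul_comm]
  · rw [mul_one]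

theorem Dk_nonneg (k : ℕ) {s : ℂ} (hs : 0 < s.re) (ω : Ω) : 0 ≤ Dk f k s ω := by
  unfold Dk
  refine Finset.prod_nonneg fun p hp => ?_
  exact pw_nonneg (coef_lt (Nat.prime_of_mem_primesBelow hp) hs) _

theorem Dk_meas (k : ℕ) (s : ℂ) : Measurable[fil f k] (Dk f k s) := by
  unfold Dk
  refine Finset.measurable_prod _ fun p hp => ?_
  exact (pw_meas _).comp (fil_meas (Nat.prime_of_mem_primesBelow hp) (Nat.lt_of_mem_primesBelow hp))

theorem pw_meas2 {α : Type*} [MeasurableSpace α] {a b : α → ℂ} (ha : Measurable a)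
    (hb : Measurable b) : Measurable (fun q : α => pw (a q) (b q)) := by
  unfold pw
  have h1 : Measurable (fun q : α => 1 - ‖a q‖ ^ 2) :=
    measurable_const.sub (ha.norm.pow_const 2)
  have h2 : Measurable (fun q : α => ‖1 - a q * b q‖ ^ 2) :=
    (measurable_const.sub (ha.mul hb)).norm.pow_const 2
  exact h1.div h2

theorem prod_pw_meas {α : Type*} [MeasurableSpace α] (S : Finset ℕ) (g : ℕ → α → ℂ)
    (c : ℕ → ℝ → ℂ) (hg : ∀ p ∈ S, Measurable (g p)) (hc : ∀ p ∈ S, Measurable (c p)) :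
    Measurable (fun q : α × ℝ => ∏ p ∈ S, pw (c p q.2) (g p q.1)) := by
  refine Finset.measurable_prod S fun p hp => ?_
  exact pw_meas2 ((hc p hp).comp measurable_snd) ((hg p hp).comp measurable_fst)

theorem Dk_meas2 (k : ℕ) (σ : ℝ) : Measurable[(fil f k).prod inferInstance]
    (fun q : Ω × ℝ => Dk f k (σ + q.2 * Complex.I) q.1) := by
  refine @prod_pw_meas Ω (fil f k) k.primesBelow (fun p ω => f ω p)
    (fun p t => (p : ℂ) ^ (-(σ + t * Complex.I) : ℂ)) ?_ ?_
  · intro p hp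
    exact fil_meas (f := f) (Nat.prime_of_mem_primesBelow hp) (Nat.lt_of_mem_primesBelow hp)
  · intro p hp
    have hp0 : (p : ℂ) ≠ 0 := by exact_mod_cast (Nat.prime_of_mem_primesBelow hp).ne_zero
    apply Continuous.measurable
    exact Continuous.const_cpow (by fun_prop) (Or.inl hp0)

theorem Mk_meas (k : ℕ) (σ : ℝ) : Measurable[fil f k] (Mk f k σ) := by
  unfold Mk
  refine @Measurable.lintegral_prod_right' Ω ℝ (fil f k) _ volume _
    (fun q : Ω × ℝ => ENNReal.ofReal (Dk f k (σ + q.2 * Complex.I) q.1 / (σ ^ 2 + q.2 ^ 2))) ?_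
  refine ENNReal.measurable_ofReal.comp ?_
  refine Measurable.div (Dk_meas2 k σ) ?_
  have : Measurable (fun t : ℝ => σ ^ 2 + t ^ 2) := by fun_prop
  exact this.comp (@measurable_snd Ω ℝ (fil f k) _)

theorem Dk_lint_succ (hf : IsSteinhausRMF μ f) (k : ℕ) {s : ℂ} (hs : 0 < s.re) {Ψ : Ω → ENNReal}
    (hΨ : Measurable[fil f k] Ψ) :
    ∫⁻ ω, Ψ ω * ENNReal.ofReal (Dk f (k + 1) s ω) ∂μ =
      ∫⁻ ω, Ψ ω * ENNReal.ofReal (Dk f k s ω) ∂μ := by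
  simp_rw [Dk_succ]
  by_cases hk : k.Prime
  · simp only [hk, if_true]
    have hlt := coef_lt hk hs
    have e : ∀ ω, Ψ ω * ENNReal.ofReal (Dk f k s ω * pw ((k : ℂ) ^ (-s)) (f ω k)) =
        (Ψ ω * ENNReal.ofReal (Dk f k s ω)) *
          (fun z => ENNReal.ofReal (pw ((k : ℂ) ^ (-s)) z)) (f ω k) := by
      intro ω
      rw [ENNReal.ofReal_mul (Dk_nonneg k hs ω), mul_assoc]
    simp_rw [e]
    have h := lint_indep hf (S := {p | (p : ℕ) < k}) (p := ⟨k, hk⟩) (lt_irrefl k)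
      (Ψ := fun ω => Ψ ω * ENNReal.ofReal (Dk f k s ω))
      (hΨ.mul (ENNReal.measurable_ofReal.comp (Dk_meas k s)))
      (φ := fun z => ENNReal.ofReal (pw ((k : ℂ) ^ (-s)) z))
      (ENNReal.measurable_ofReal.comp (pw_meas _))
    refine h.trans ?_
    rw [← ofReal_integral_eq_lintegral_ofReal, circ_pw hlt, ENNReal.ofReal_one, mul_one]
    · exact circ_int_of_bdd (pw_meas _) (b := (1 + ‖(k : ℂ) ^ (-s)‖) / (1 - ‖(k : ℂ) ^ (-s)‖))
        fun z hz => by rw [abs_of_nonneg (pw_nonneg hlt z)]; exact (pw_bounds hlt hz).2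
    · exact Filter.Eventually.of_forall fun z => pw_nonneg hlt z
  · simp [hk]

theorem lint_swap_aux {Ψ : Ω → ENNReal} (hΨ : Measurable Ψ) {g : Ω → ℝ → ENNReal} [SFinite μ]
    (hg : Measurable (Function.uncurry g)) :
    ∫⁻ ω, (Ψ ω * ∫⁻ t : ℝ, g ω t) ∂μ = ∫⁻ t : ℝ, ∫⁻ ω, Ψ ω * g ω t ∂μ := by
  have : ∀ ω, Ψ ω * ∫⁻ t : ℝ, g ω t = ∫⁻ t : ℝ, Ψ ω * g ω t := by
    intro ω
    rw [lintegral_const_mul]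
    exact hg.of_uncurry_left
  simp_rw [this]
  rw [lintegral_lintegral_swap]
  exact ((hΨ.comp measurable_fst).mul hg).aemeasurable

theorem Mk_lint_succ (hf : IsSteinhausRMF μ f) [IsProbabilityMeasure μ]
    (k : ℕ) {σ : ℝ} (hs : 0 < σ) {Ψ : Ω → ENNReal}
    (hΨ : Measurable[fil f k] Ψ) :
    ∫⁻ ω, Ψ ω * Mk f (k + 1) σ ω ∂μ = ∫⁻ ω, Ψ ω * Mk f k σ ω ∂μ := by
  have hΨ0 : Measurable Ψ := hΨ.mono (fil_le hf k) le_rfl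
  have jm : ∀ k, Measurable (fun q : Ω × ℝ =>
      ENNReal.ofReal (Dk f k (σ + q.2 * Complex.I) q.1 / (σ ^ 2 + q.2 ^ 2))) := by
    intro k
    refine ENNReal.measurable_ofReal.comp (Measurable.div ?_ (by fun_prop))
    exact (Dk_meas2 k σ).mono (sup_le_sup (MeasurableSpace.comap_mono (fil_le hf k)) le_rfl) le_rfl
  have key : ∀ k, ∫⁻ ω, Ψ ω * Mk f k σ ω ∂μ =
      ∫⁻ t : ℝ, ∫⁻ ω, Ψ ω * ENNReal.ofReal (Dk f k (σ + t * Complex.I) ω / (σ ^ 2 + t ^ 2)) ∂μ := by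
    intro k
    exact lint_swap_aux hΨ0 (jm k)
  rw [key, key]
  refine lintegral_congr fun t => ?_
  have hre : 0 < ((σ : ℂ) + t * Complex.I).re := by simpa using hs
  have e : ∀ k ω, Ψ ω * ENNReal.ofReal (Dk f k (σ + t * Complex.I) ω / (σ ^ 2 + t ^ 2)) =
      (Ψ ω * ENNReal.ofReal ((σ ^ 2 + t ^ 2)⁻¹)) *
        ENNReal.ofReal (Dk f k (σ + t * Complex.I) ω) := by
    intro k ω
    rw [div_eq_mul_inv, ENNReal.ofReal_mul (Dk_nonneg k hre ω)]; ring
  simp_rw [e]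
  exact Dk_lint_succ hf k hre (hΨ.mul_const _)

theorem Dk_zero (s : ℂ) (ω : Ω) : Dk f 0 s ω = 1 := by
  simp [Dk, Nat.primesBelow]

theorem lint_poisson {σ : ℝ} (hs : 0 < σ) :
    ∫⁻ t : ℝ, ENNReal.ofReal (1 / (σ ^ 2 + t ^ 2)) = ENNReal.ofReal (π / σ) := by
  have e : ∀ t : ℝ, 1 / (σ ^ 2 + t ^ 2) = (σ ^ 2)⁻¹ * (1 + (t / σ) ^ 2)⁻¹ := by
    intro t; field_simp
  have hi : Integrable (fun t : ℝ => 1 / (σ ^ 2 + t ^ 2)) := by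
    simp_rw [e]
    exact (integrable_inv_one_add_sq.comp_div hs.ne').const_mul _
  rw [← ofReal_integral_eq_lintegral_ofReal hi (Filter.Eventually.of_forall fun t => by
    show 0 ≤ 1 / (σ ^ 2 + t ^ 2); positivity)]
  congr 1
  simp_rw [e]
  rw [integral_const_mul, Measure.integral_comp_div (fun x : ℝ => (1 + x ^ 2)⁻¹),
    integral_univ_inv_one_add_sq, abs_of_pos hs, smul_eq_mul]
  field_simp

theorem Mk_mean (hf : IsSteinhausRMF μ f) [IsProbabilityMeasure μ] (k : ℕ) {σ : ℝ} (hs : 0 < σ) :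
    ∫⁻ ω, Mk f k σ ω ∂μ = ENNReal.ofReal (π / σ) := by
  induction k with
  | zero =>
    unfold Mk
    simp_rw [Dk_zero, lint_poisson hs]
    simp
  | succ k ih =>
    have := Mk_lint_succ hf k hs (Ψ := fun _ => 1) measurable_const
    simp only [one_mul] at this
    rw [this, ih]

/-- Doob maximal inequality, localised to an event. -/
theorem doob {F : ℕ → MeasurableSpace Ω} (hF : ∀ k, F k ≤ m0) (hFm : Monotone F)
    {M : ℕ → Ω → ENNReal} (hM : ∀ k, Measurable[F k] (M k))
    (hmart : ∀ k (S : Set Ω), MeasurableSet[F k] S → ∫⁻ ω in S, M (k + 1) ω ∂μ ≤ ∫⁻ ω in S, M k ω ∂μ)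
    (lam : ENNReal) (n : ℕ) : ∀ (a : ℕ) (S : Set Ω), MeasurableSet[F a] S →
    lam * μ (S ∩ {ω | ∃ k, a ≤ k ∧ k ≤ a + n ∧ lam < M k ω}) ≤ ∫⁻ ω in S, M a ω ∂μ := by
  have markov : ∀ (a : ℕ) (S : Set Ω), MeasurableSet[F a] S →
      lam * μ (S ∩ {ω | lam < M a ω}) ≤ ∫⁻ ω in S ∩ {ω | lam < M a ω}, M a ω ∂μ := by
    intro a S hS
    have hm : MeasurableSet (S ∩ {ω | lam < M a ω}) :=
      hF a _ (hS.inter (hM a measurableSet_Ioi))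
    rw [← setLIntegral_const]
    exact setLIntegral_mono_ae ((hM a).mono (hF a) le_rfl).aemeasurable
      (Filter.Eventually.of_forall fun ω hω => hω.2.le)
  induction n with
  | zero =>
    intro a S hS
    have e : {ω | ∃ k, a ≤ k ∧ k ≤ a + 0 ∧ lam < M k ω} = {ω | lam < M a ω} := by
      ext ω
      constructor
      · rintro ⟨k, h1, h2, h3⟩
        obtain rfl : k = a := by omega
        exact h3
      · intro h
        exact ⟨a, le_rfl, le_rfl, h⟩
    rw [e]
    exact (markov a S hS).trans (lintegral_mono_set Set.inter_subset_left)
  | succ n ih =>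
    intro a S hS
    have hA : MeasurableSet[F a] {ω | lam < M a ω} :=
      hM a measurableSet_Ioi
    have hS' : MeasurableSet[F a] (S ∩ {ω | lam < M a ω}ᶜ) := hS.inter hA.compl
    have h1 := ih (a + 1) _ (hFm (Nat.le_succ a) _ hS')
    have sub : S ∩ {ω | ∃ k, a ≤ k ∧ k ≤ a + (n + 1) ∧ lam < M k ω} ⊆
        (S ∩ {ω | lam < M a ω}) ∪ ((S ∩ {ω | lam < M a ω}ᶜ) ∩
          {ω | ∃ k, a + 1 ≤ k ∧ k ≤ a + 1 + n ∧ lam < M k ω}) := by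
      rintro ω ⟨hω, k, k1, k2, k3⟩
      by_cases h : lam < M a ω
      · exact Or.inl ⟨hω, h⟩
      · refine Or.inr ⟨⟨hω, h⟩, k, ?_, by omega, k3⟩
        rcases Nat.lt_or_ge a k with h' | h'
        · exact h'
        · obtain rfl : k = a := by omega
          exact absurd k3 h
    calc lam * μ (S ∩ {ω | ∃ k, a ≤ k ∧ k ≤ a + (n + 1) ∧ lam < M k ω})
        ≤ lam * (μ (S ∩ {ω | lam < M a ω}) + μ ((S ∩ {ω | lam < M a ω}ᶜ) ∩
          {ω | ∃ k, a + 1 ≤ k ∧ k ≤ a + 1 + n ∧ lam < M k ω})) := by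
          gcongr
          exact (measure_mono sub).trans (measure_union_le _ _)
      _ ≤ (∫⁻ ω in S ∩ {ω | lam < M a ω}, M a ω ∂μ) +
          ∫⁻ ω in S ∩ {ω | lam < M a ω}ᶜ, M a ω ∂μ := by
          rw [mul_add]
          exact add_le_add (markov a S hS) (h1.trans (hmart a _ hS'))
      _ = ∫⁻ ω in S, M a ω ∂μ := by
          exact lintegral_inter_add_diff _ _ (hF a _ hA)

theorem Mk_doob (hf : IsSteinhausRMF μ f) [IsProbabilityMeasure μ] {σ : ℝ} (hs : 0 < σ)
    (lam : ENNReal) (n a : ℕ) {S : Set Ω} (hS : MeasurableSet[fil f a] S) :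
    lam * μ (S ∩ {ω | ∃ k, a ≤ k ∧ k ≤ a + n ∧ lam < Mk f k σ ω}) ≤ ∫⁻ ω in S, Mk f a σ ω ∂μ := by
  refine doob (fil_le hf) fil_mono (fun k => Mk_meas k σ) ?_ lam n a S hS
  intro k S hS
  refine le_of_eq ?_
  have := Mk_lint_succ hf k hs (Ψ := S.indicator fun _ => 1)
    ((@measurable_const _ _ _ (fil f k) _).indicator hS)
  have e : ∀ (j : ℕ) ω, (S.indicator (fun _ => (1 : ENNReal)) ω) * Mk f j σ ω =
      S.indicator (Mk f j σ) ω := by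
    intro j ω
    by_cases h : ω ∈ S <;> simp [h]
  simp_rw [e] at this
  rwa [lintegral_indicator (fil_le hf k _ hS), lintegral_indicator (fil_le hf k _ hS)] at this

end
end

noncomputable section

section
variable {Ω : Type*} {m0 : MeasurableSpace Ω} {μ : Measure Ω} {f : Ω → ℕ → ℂ}

theorem Dk_bdd (hf : SN μ f) (k : ℕ) {s : ℂ} (hs : 0 < s.re) : ∃ b, ∀ ω, |Dk f k s ω| ≤ b := by
  refine ⟨∏ p ∈ k.primesBelow, (1 + ‖(p : ℂ) ^ (-s)‖) / (1 - ‖(p : ℂ) ^ (-s)‖), fun ω => ?_⟩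
  rw [abs_of_nonneg (Dk_nonneg k hs ω)]
  unfold Dk
  refine Finset.prod_le_prod (fun p hp => ?_) fun p hp => ?_
  · exact pw_nonneg (coef_lt (Nat.prime_of_mem_primesBelow hp) hs) _
  · have hpp := Nat.prime_of_mem_primesBelow hp
    exact (pw_bounds (coef_lt hpp hs) (hf.nrm ω p hpp.one_lt.le)).2

theorem Dk_int_succ (hf : SN μ f) (k : ℕ) {s : ℂ} (hs : 0 < s.re) {Ψ : Ω → ℝ}
    (hΨ : Measurable[fil f k] Ψ) :
    ∫ ω, Ψ ω * Dk f (k + 1) s ω ∂μ = ∫ ω, Ψ ω * Dk f k s ω ∂μ := by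
  simp_rw [Dk_succ]
  by_cases hk : k.Prime
  · simp only [hk, if_true]
    have hlt := coef_lt hk hs
    simp_rw [← mul_assoc]
    have h := int_indep hf.toIsSteinhausRMF (𝕜 := ℝ) (S := {p | (p : ℕ) < k}) (p := ⟨k, hk⟩)
      (lt_irrefl k) (Ψ := fun ω => Ψ ω * Dk f k s ω) (hΨ.mul (Dk_meas k s))
      (φ := fun z => pw ((k : ℂ) ^ (-s)) z) (pw_meas _)
    refine h.trans ?_
    rw [circ_pw hlt, mul_one]
  · simp [hk]

theorem Dk_int_le (hf : SN μ f) {k n : ℕ} (hkn : k ≤ n) {s : ℂ} (hs : 0 < s.re) {Ψ : Ω → ℝ}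
    (hΨ : Measurable[fil f k] Ψ) :
    ∫ ω, Ψ ω * Dk f n s ω ∂μ = ∫ ω, Ψ ω * Dk f k s ω ∂μ := by
  induction n, hkn using Nat.le_induction with
  | base => rfl
  | succ n hn ih => rw [Dk_int_succ hf n hs (hΨ.mono (fil_mono hn) le_rfl), ih]

/-- tilted measure -/
def tilt (μ : Measure Ω) (f : Ω → ℕ → ℂ) (n : ℕ) (s : ℂ) : Measure Ω :=
  μ.withDensity fun ω => ENNReal.ofReal (Dk f n s ω)

theorem Dk_meas0 (hf : SN μ f) (n : ℕ) (s : ℂ) : Measurable (Dk f n s) :=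
  (Dk_meas n s).mono (fil_le hf.toIsSteinhausRMF n) le_rfl

theorem tilt_prob (hf : SN μ f) [IsProbabilityMeasure μ] (n : ℕ) {s : ℂ} (hs : 0 < s.re) :
    IsProbabilityMeasure (tilt μ f n s) := by
  constructor
  unfold tilt
  rw [withDensity_apply _ MeasurableSet.univ, setLIntegral_univ]
  induction n with
  | zero => simp [Dk_zero]
  | succ n ih =>
    have := Dk_lint_succ hf.toIsSteinhausRMF n hs (Ψ := fun _ => 1) measurable_const
    simp only [one_mul] at this
    rw [this, ih]

theorem tilt_int (hf : SN μ f) (n : ℕ) {s : ℂ} (hs : 0 < s.re) (g : Ω → ℝ) :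
    ∫ ω, g ω ∂(tilt μ f n s) = ∫ ω, g ω * Dk f n s ω ∂μ := by
  unfold tilt
  rw [integral_withDensity_eq_integral_toReal_smul (f := fun ω => ENNReal.ofReal (Dk f n s ω))
    (ENNReal.measurable_ofReal.comp (Dk_meas0 hf n s))
    (Filter.Eventually.of_forall fun ω => ENNReal.ofReal_lt_top)]
  refine integral_congr_ae (Filter.Eventually.of_forall fun ω => ?_)
  simp only [smul_eq_mul, ENNReal.toReal_ofReal (Dk_nonneg n hs ω)]
  ring

theorem coef_half {p : ℕ} (hp : p.Prime) {s : ℂ} (hs : s.re = 1 / 2) :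
    ‖(p : ℂ) ^ (-s)‖ ^ 2 = 1 / p := by
  rw [coef_norm hp, hs, ← Real.rpow_natCast, ← Real.rpow_mul (by positivity)]
  norm_num
  rw [Real.rpow_neg_one]

theorem yw_le_four {p : ℕ} (hp : p.Prime) {s : ℂ} (hs : s.re = 1 / 2) {z : ℂ} (hz : ‖z‖ = 1) :
    |yw ((p : ℂ) ^ (-s)) z| ≤ 4 := by
  have h1 := coef_half hp hs
  set r := ‖(p : ℂ) ^ (-s)‖ with hr
  have hr0 : 0 ≤ r := norm_nonneg _
  have h2 : r ^ 2 ≤ 1 / 2 := by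
    rw [h1]
    have : (2 : ℝ) ≤ p := by exact_mod_cast hp.two_le
    exact one_div_le_one_div_of_le (by norm_num) this
  have h3 : r ≤ 5 / 7 := by nlinarith
  refine (yw_bound (coef_lt hp (by rw [hs]; norm_num)) hz).trans ?_
  rw [← hr]
  have e1 := Real.one_sub_inv_le_log_of_pos (x := 1 - r) (by linarith)
  have e2 := Real.log_le_sub_one_of_pos (x := 1 + r) (by linarith)
  have e3 : (1 - r)⁻¹ ≤ 7 / 2 := by
    rw [inv_le_comm₀ (by linarith) (by norm_num)]; norm_num; linarith
  linarith

open Classical in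
/-- Walk increments. -/
def Xw (f : Ω → ℕ → ℂ) (n : ℕ) (s : ℂ) (k : ℕ) (ω : Ω) : ℝ :=
  if k.Prime ∧ k < n then yw ((k : ℂ) ^ (-s)) (f ω k) else 0

open Classical in
/-- Walk variances. -/
def vw (n : ℕ) (s : ℂ) (k : ℕ) : ℝ :=
  if k.Prime ∧ k < n then ∫ z, pw ((k : ℂ) ^ (-s)) z * yw ((k : ℂ) ^ (-s)) z ^ 2 ∂circ else 0

theorem tilt_moment (hf : SN μ f) [IsProbabilityMeasure μ] {n k : ℕ} (hk : k.Prime) (hkn : k < n)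
    {s : ℂ} (hs : 0 < s.re) {Ψ : Ω → ℝ} (hΨ : Measurable[fil f k] Ψ)
    {φ : ℂ → ℝ} (hφ : Measurable φ) :
    ∫ ω, Ψ ω * φ (f ω k) ∂(tilt μ f n s) =
      (∫ z, pw ((k : ℂ) ^ (-s)) z * φ z ∂circ) * ∫ ω, Ψ ω ∂(tilt μ f n s) := by
  rw [tilt_int hf n hs, tilt_int hf n hs, Dk_int_le hf hkn.le hs hΨ]
  have hm : Measurable[fil f (k + 1)] fun ω => Ψ ω * φ (f ω k) :=
    (hΨ.mono (fil_mono (Nat.le_succ k)) le_rfl).mul (hφ.comp (fil_meas hk (Nat.lt_succ_self k)))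
  rw [Dk_int_le hf (show k + 1 ≤ n from hkn) hs hm]
  have h := int_indep hf.toIsSteinhausRMF (𝕜 := ℝ) (S := {p | (p : ℕ) < k}) (p := ⟨k, hk⟩)
      (lt_irrefl k) (Ψ := fun ω => Ψ ω * Dk f k s ω) (hΨ.mul (Dk_meas k s))
      (φ := fun z => pw ((k : ℂ) ^ (-s)) z * φ z) ((pw_meas _).mul hφ)
  rw [mul_comm, ← h]
  refine integral_congr_ae (Filter.Eventually.of_forall fun ω => ?_)
  simp only [Dk_succ, hk, if_true]
  ring

theorem tilt_ballot (c0 C0 : ℝ) (hc0 : 0 < c0) (hC0 : 0 ≤ C0) :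
    ∃ C : ℝ, 0 < C ∧ ∀ {Ω : Type*} {m0 : MeasurableSpace Ω} {μ : Measure Ω} {f : Ω → ℕ → ℂ}
      [IsProbabilityMeasure μ] (_ : SN μ f) (n : ℕ) (s : ℂ) (_ : s.re = 1 / 2)
      (B : ℝ) (_ : 0 ≤ B) (j : ℕ → ℕ) (_ : j 0 = 0) (_ : Monotone j)
      (_ : ∀ k, j (k + 1) ≤ j k + 1)
      (_ : ∀ k ≤ n, c0 * j k - C0 ≤ ∑ p ∈ k.primesBelow, (1 / p : ℝ)),
      (tilt μ f n s).real {ω | ∀ i ≤ n, ∑ p ∈ i.primesBelow, yw ((p : ℂ) ^ (-s)) (f ω p)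
        ≤ B + Real.log (1 + j i)} ≤ C * (1 + B) / √(1 + j n : ℝ) := by
  obtain ⟨C, hC, H⟩ := ballot_log_const (c0 / 384) (C0 / 384) 4 (by positivity) (by positivity)
    (by norm_num)
  refine ⟨C, hC, ?_⟩
  intro Ω m0 μ f _ hf n s hs B hB j hj0 hjm hj1 hS
  have hs0 : 0 < s.re := by rw [hs]; norm_num
  have : IsProbabilityMeasure (tilt μ f n s) := tilt_prob hf n hs0
  have key := H (tilt μ f n s) (fil f) (fil_le hf.toIsSteinhausRMF) fil_mono (Xw f n s) ?_ ?_
    (vw n s) ?_ ?_ ?_ B hB n j hj0 hjm hj1 ?_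
  · rw [le_div_iff₀ (by positivity), mul_comm]
    refine le_trans (le_of_eq ?_) key
    congr 2
    have : ∀ ω, ∀ i ≤ n, ∑ p ∈ i.primesBelow, yw ((p : ℂ) ^ (-s)) (f ω p) =
        ∑ k ∈ Finset.range i, Xw f n s k ω := by
      intro ω i hi
      unfold Nat.primesBelow
      rw [Finset.sum_filter]
      refine Finset.sum_congr rfl fun k hk => ?_
      have : k < n := lt_of_lt_of_le (Finset.mem_range.1 hk) hi
      simp [Xw, this]
    ext ω
    constructor
    · intro h i hi
      rw [← this ω i hi]; exact h i hi
    · intro h i hi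
      rw [this ω i hi]; exact h i hi
  · intro k
    by_cases h : k.Prime ∧ k < n
    · have e : Xw f n s k = fun ω => yw ((k : ℂ) ^ (-s)) (f ω k) := by
        funext ω; simp [Xw, h]
      rw [e]
      exact (yw_meas _).comp (fil_meas h.1 (Nat.lt_succ_self k))
    · have e : Xw f n s k = fun ω => 0 := by
        funext ω; simp only [Xw, h, if_false]
      rw [e]; exact measurable_const
  · intro k ω
    by_cases h : k.Prime ∧ k < n
    · simp only [Xw, h, and_self, if_true]
      exact yw_le_four h.1 hs (hf.nrm ω k h.1.one_lt.le)
    · simp only [Xw, h, if_false]; norm_num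
  · intro k
    unfold vw
    split_ifs with h
    · exact integral_nonneg fun z => mul_nonneg (pw_nonneg (coef_lt h.1 hs0) z) (sq_nonneg _)
    · exact le_rfl
  · intro k Ψ hΨ _
    by_cases h : k.Prime ∧ k < n
    · simp only [Xw, h, and_self, if_true]
      rw [tilt_moment hf h.1 h.2 hs0 hΨ (yw_meas _), circ_pw_yw (coef_lt h.1 hs0), zero_mul]
    · simp only [Xw, h, if_false]; simp
  · intro k Ψ hΨ _
    by_cases h : k.Prime ∧ k < n
    · simp only [Xw, vw, h, and_self, if_true]
      rw [tilt_moment hf h.1 h.2 hs0 hΨ ((yw_meas _).pow_const 2)]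
    · simp only [Xw, vw, h, if_false]; simp
  · intro k hk
    have h1 := hS k hk
    have h2 : (∑ p ∈ k.primesBelow, (1 / p : ℝ)) / 384 ≤ ∑ i ∈ Finset.range k, vw n s i := by
      unfold Nat.primesBelow
      rw [Finset.sum_filter, Finset.sum_div]
      refine Finset.sum_le_sum fun i hi => ?_
      have hin : i < n := lt_of_lt_of_le (Finset.mem_range.1 hi) hk
      by_cases hp : i.Prime
      · simp only [vw, hp, hin, and_self, if_true]
        rw [← coef_half hp hs]
        apply circ_var
        rw [coef_half hp hs]
        have : (2 : ℝ) ≤ i := by exact_mod_cast hp.two_le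
        exact one_div_le_one_div_of_le (by norm_num) this
      · simp [vw, hp]
    linarith

end
end

noncomputable section

section Sieve
open Finset Polynomial

theorem geom_bound {z : ℂ} (hz : ‖z‖ = 1) {q : ℕ} (hq : 0 < q) (hzq : z ^ q = 1) (h1 : z ≠ 1)
    (h : ℕ) : ‖∑ i ∈ range h, z ^ i‖ ≤ q := by
  have h0 : ∑ i ∈ range q, z ^ i = 0 := by
    have := mul_geom_sum z q
    rw [hzq, sub_self] at this
    exact (mul_eq_zero.1 this).resolve_left (sub_ne_zero.2 h1)
  induction h using Nat.strong_induction_on with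
  | _ h ih =>
    by_cases hlt : h < q
    · refine (norm_sum_le _ _).trans ?_
      simp only [norm_pow, hz, one_pow, sum_const, card_range, nsmul_eq_mul, mul_one]
      exact_mod_cast hlt.le
    · push Not at hlt
      obtain ⟨r, rfl⟩ := Nat.exists_eq_add_of_le hlt
      rw [sum_range_add, h0, zero_add]
      simp_rw [pow_add, hzq, one_mul]
      exact ih r (by omega)

theorem roots_sum {n : ℕ} (hn : 0 < n) (p : ℕ) :
    ∑ ζ ∈ nthRootsFinset n (1 : ℂ), ζ ^ p = if n ∣ p then (n : ℂ) else 0 := by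
  have hζ := Complex.isPrimitiveRoot_exp n hn.ne'
  set ζ := Complex.exp (2 * π * Complex.I / n)
  have e : nthRootsFinset n (1 : ℂ) = (range n).image fun i => ζ ^ i := by
    ext x
    rw [mem_nthRootsFinset hn, mem_image]
    constructor
    · intro hx
      haveI : NeZero n := ⟨hn.ne'⟩
      obtain ⟨i, hi, h⟩ := hζ.eq_pow_of_pow_eq_one hx
      exact ⟨i, mem_range.2 hi, h⟩
    · rintro ⟨i, -, rfl⟩
      rw [← pow_mul, mul_comm, pow_mul, hζ.pow_eq_one, one_pow]
  rw [e, sum_image]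
  · have : ∀ i, (ζ ^ i) ^ p = (ζ ^ p) ^ i := fun i => by rw [← pow_mul, ← pow_mul, mul_comm]
    simp_rw [this]
    split_ifs with h
    · rw [(hζ.pow_eq_one_iff_dvd p).2 h]; simp
    · have h1 : ζ ^ p ≠ 1 := fun h' => h ((hζ.pow_eq_one_iff_dvd p).1 h')
      have := mul_geom_sum (ζ ^ p) n
      rw [← pow_mul, mul_comm p n, pow_mul, hζ.pow_eq_one, one_pow, sub_self] at this
      exact (mul_eq_zero.1 this).resolve_left (sub_ne_zero.2 h1)
  · intro i hi j hj hij
    exact hζ.pow_inj (by simpa using hi) (by simpa using hj) hij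

theorem ramanujan_coprime {e p : ℕ} (he : 0 < e) (hc : Nat.Coprime e p) :
    ∑ ζ ∈ primitiveRoots e ℂ, ζ ^ p = (ArithmeticFunction.moebius e : ℂ) := by
  have H := (ArithmeticFunction.sum_eq_iff_sum_mul_moebius_eq (R := ℂ)
    (f := fun i => ∑ ζ ∈ primitiveRoots i ℂ, ζ ^ p)
    (g := fun n => if n ∣ p then (n : ℂ) else 0)).1 (by
      intro n hn
      rw [← roots_sum hn p, IsPrimitiveRoot.nthRoots_one_eq_biUnion_primitiveRoots, sum_biUnion]
      intro i _ j _ hij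
      exact IsPrimitiveRoot.disjoint hij) e he
  rw [← H, sum_eq_single (e, 1)]
  · simp
  · rintro ⟨a, b⟩ hab hne
    rw [Nat.mem_divisorsAntidiagonal] at hab
    simp only at hab ⊢
    rw [if_neg, mul_zero]
    intro hb
    have hbe : b ∣ e := ⟨a, by rw [mul_comm]; exact hab.1.symm⟩
    have hb1 : b = 1 := Nat.eq_one_of_dvd_coprimes hc hbe hb
    subst hb1
    apply hne
    rw [← hab.1, mul_one]
  · intro h; exact absurd (by simp [he.ne']) h

/-- squarefree moduli -/
def sqf (z : ℕ) : Finset ℕ := (Icc 1 z).filter Squarefree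
/-- normalising sum -/
def Gz (z : ℕ) : ℝ := ∑ e ∈ sqf z, (1 / e : ℝ)
/-- frequencies -/
def Rz (z : ℕ) : Finset ((_ : ℕ) × ℂ) := (sqf z).sigma fun e => primitiveRoots e ℂ

theorem sieve_dual (z h a : ℕ) :
    ∑ n ∈ range h, ‖∑ x ∈ Rz z, ((ArithmeticFunction.moebius x.1 / x.1 : ℝ) : ℂ) * x.2 ^ (a + n)‖ ^ 2
      ≤ h * Gz z + (z : ℝ) ^ 4 := by
  have hR : ∀ x ∈ Rz z, 0 < x.1 ∧ ‖x.2‖ = 1 ∧ IsPrimitiveRoot x.2 x.1 := by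
    intro x hx
    simp only [Rz, sqf, mem_sigma, mem_filter, mem_Icc] at hx
    have hp := isPrimitiveRoot_of_mem_primitiveRoots hx.2
    have h0 : 0 < x.1 := by omega
    exact ⟨h0, hp.norm'_eq_one h0.ne', hp⟩
  set β : ((_ : ℕ) × ℂ) → ℝ := fun x => (ArithmeticFunction.moebius x.1 / x.1 : ℝ) with hβ
  have hb : ∀ x ∈ Rz z, |β x| * x.1 ≤ 1 := by
    intro x hx
    have h0 : (0 : ℝ) < x.1 := by exact_mod_cast (hR x hx).1
    simp only [hβ]
    rw [abs_div, abs_of_pos h0, div_mul_cancel₀ _ h0.ne']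
    have := ArithmeticFunction.abs_moebius_le_one (n := x.1)
    exact_mod_cast this
  have hcard : ((Rz z).card : ℝ) ≤ (z : ℝ) ^ 2 := by
    have : (Rz z).card ≤ z ^ 2 := by
      unfold Rz
      rw [card_sigma]
      calc ∑ e ∈ sqf z, (primitiveRoots e ℂ).card ≤ ∑ e ∈ sqf z, z := by
            refine sum_le_sum fun e he => ?_
            rw [Complex.card_primitiveRoots]
            simp only [sqf, mem_filter, mem_Icc] at he
            exact (Nat.totient_le e).trans he.1.2
        _ ≤ z ^ 2 := by
            rw [sum_const, smul_eq_mul, pow_two]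
            refine Nat.mul_le_mul_right _ ((card_filter_le _ _).trans ?_)
            simp
    exact_mod_cast this
  have hexp : ∀ n, ((‖∑ x ∈ Rz z, ((β x : ℝ) : ℂ) * x.2 ^ (a + n)‖ ^ 2 : ℝ) : ℂ) =
      ∑ x ∈ Rz z, ∑ y ∈ Rz z, ((β x * β y : ℝ) : ℂ) * (x.2 / y.2) ^ (a + n) := by
    intro n
    rw [← Complex.normSq_eq_norm_sq, ← Complex.mul_conj, map_sum, sum_mul_sum]
    refine sum_congr rfl fun x hx => sum_congr rfl fun y hy => ?_
    have hy1 := (hR y hy).2.1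
    rw [map_mul, Complex.conj_ofReal, map_pow, div_pow, ← Complex.inv_eq_conj hy1]
    push_cast
    rw [inv_pow]
    ring
  have hsum : ((∑ n ∈ range h, ‖∑ x ∈ Rz z, ((β x : ℝ) : ℂ) * x.2 ^ (a + n)‖ ^ 2 : ℝ) : ℂ) =
      ∑ x ∈ Rz z, ∑ y ∈ Rz z, ((β x * β y : ℝ) : ℂ) * ∑ n ∈ range h, (x.2 / y.2) ^ (a + n) := by
    rw [Complex.ofReal_sum]
    simp_rw [hexp]
    rw [sum_comm]
    refine sum_congr rfl fun x _ => ?_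
    rw [sum_comm]
    refine sum_congr rfl fun y _ => ?_
    rw [mul_sum]
  have hpt : ∀ x ∈ Rz z, ∀ y ∈ Rz z,
      ‖((β x * β y : ℝ) : ℂ) * ∑ n ∈ range h, (x.2 / y.2) ^ (a + n)‖ ≤
        (if x = y then h * β x ^ 2 else 0) + 1 := by
    intro x hx y hy
    obtain ⟨hx0, hx1, hxp⟩ := hR x hx
    obtain ⟨hy0, hy1, hyp⟩ := hR y hy
    by_cases hxy : x = y
    · subst hxy
      have h2 : x.2 ≠ 0 := by rw [← norm_ne_zero_iff, hx1]; norm_num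
      rw [if_pos rfl, div_self h2]
      simp only [one_pow, sum_const, card_range, nsmul_eq_mul, mul_one, norm_mul,
        Complex.norm_real, Complex.norm_natCast, Real.norm_eq_abs]
      rw [abs_mul_abs_self]
      nlinarith
    · rw [if_neg hxy, zero_add]
      have hne : x.2 / y.2 ≠ 1 := by
        intro h'
        have h2 : y.2 ≠ 0 := by rw [← norm_ne_zero_iff, hy1]; norm_num
        rw [div_eq_one_iff_eq h2] at h'
        apply hxy
        obtain ⟨x1, x2⟩ := x
        obtain ⟨y1, y2⟩ := y
        simp only at h' hxp hyp
        subst h'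
        rw [hxp.unique hyp]
      have hn1 : ‖x.2 / y.2‖ = 1 := by rw [norm_div, hx1, hy1, div_one]
      have hpow : (x.2 / y.2) ^ (x.1 * y.1) = 1 := by
        rw [div_pow, pow_mul, hxp.pow_eq_one, one_pow, mul_comm, pow_mul, hyp.pow_eq_one, one_pow,
          div_one]
      have hg := geom_bound hn1 (Nat.mul_pos hx0 hy0) hpow hne h
      simp_rw [pow_add]
      rw [← mul_sum, norm_mul, norm_mul, norm_pow, hn1, one_pow, one_mul, Complex.norm_real,
        Real.norm_eq_abs, abs_mul]
      push_cast at hg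
      calc |β x| * |β y| * ‖∑ i ∈ range h, (x.2 / y.2) ^ i‖
          ≤ |β x| * |β y| * (x.1 * y.1) := by gcongr
        _ = (|β x| * x.1) * (|β y| * y.1) := by ring
        _ ≤ 1 * 1 := by
            exact mul_le_mul (hb x hx) (hb y hy) (by positivity) (by norm_num)
        _ = 1 := by norm_num
  have hdiag : ∑ x ∈ Rz z, β x ^ 2 ≤ Gz z := by
    unfold Rz Gz
    rw [sum_sigma]
    refine sum_le_sum fun e he => ?_
    simp only [sum_const, Complex.card_primitiveRoots, nsmul_eq_mul, hβ]
    simp only [sqf, mem_filter, mem_Icc] at he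
    have h0 : (0 : ℝ) < e := by exact_mod_cast he.1.1
    have h1 : ((ArithmeticFunction.moebius e : ℤ) : ℝ) ^ 2 ≤ 1 := by
      have := ArithmeticFunction.abs_moebius_le_one (n := e)
      have h' : |((ArithmeticFunction.moebius e : ℤ) : ℝ)| ≤ 1 := by exact_mod_cast this
      nlinarith [abs_nonneg ((ArithmeticFunction.moebius e : ℤ) : ℝ),
        sq_abs ((ArithmeticFunction.moebius e : ℤ) : ℝ)]
    have h2 : (Nat.totient e : ℝ) ≤ e := by exact_mod_cast Nat.totient_le e
    rw [div_pow]
    calc (Nat.totient e : ℝ) * ((ArithmeticFunction.moebius e : ℝ) ^ 2 / e ^ 2)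
        ≤ (e : ℝ) * (1 / (e : ℝ) ^ 2) := by gcongr
      _ = 1 / (e : ℝ) := by field_simp
  have hfin : (∑ n ∈ range h, ‖∑ x ∈ Rz z, ((β x : ℝ) : ℂ) * x.2 ^ (a + n)‖ ^ 2 : ℝ) ≤
      ∑ x ∈ Rz z, ∑ y ∈ Rz z, ((if x = y then h * β x ^ 2 else 0) + 1) := by
    have h1 : (∑ n ∈ range h, ‖∑ x ∈ Rz z, ((β x : ℝ) : ℂ) * x.2 ^ (a + n)‖ ^ 2 : ℝ) =
      ‖((∑ n ∈ range h, ‖∑ x ∈ Rz z, ((β x : ℝ) : ℂ) * x.2 ^ (a + n)‖ ^ 2 : ℝ) : ℂ)‖ := by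
      rw [Complex.norm_real, Real.norm_eq_abs, abs_of_nonneg]
      exact sum_nonneg fun _ _ => by positivity
    rw [h1, hsum]
    refine (norm_sum_le _ _).trans (sum_le_sum fun x hx => (norm_sum_le _ _).trans
      (sum_le_sum fun y hy => hpt x hx y hy))
  refine hfin.trans ?_
  have h2 : ∑ x ∈ Rz z, ∑ y ∈ Rz z, ((if x = y then h * β x ^ 2 else 0) + 1) =
      h * (∑ x ∈ Rz z, β x ^ 2) + ((Rz z).card : ℝ) ^ 2 := by
    rw [mul_sum, pow_two]
    simp_rw [sum_add_distrib]
    congr 1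
    · refine sum_congr rfl fun x hx => ?_
      rw [sum_ite_eq, if_pos hx]
    · simp
  rw [h2]
  have h3 : ((Rz z).card : ℝ) ^ 2 ≤ (z : ℝ) ^ 4 := by
    calc ((Rz z).card : ℝ) ^ 2 ≤ ((z : ℝ) ^ 2) ^ 2 := by gcongr
      _ = _ := by ring
  have : (0 : ℝ) ≤ h := by positivity
  nlinarith

theorem Gz_one_le {z : ℕ} (hz : 1 ≤ z) : 1 ≤ Gz z := by
  unfold Gz
  have : (1 : ℕ) ∈ sqf z := by simp [sqf, hz]
  refine le_trans ?_ (single_le_sum (f := fun e : ℕ => (1 / e : ℝ)) (fun e _ => by positivity) this)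
  simp

theorem sieve_count {z : ℕ} (hz : 1 ≤ z) (h a : ℕ) :
    (((range h).filter fun n => (a + n).Prime ∧ z < a + n).card : ℝ) ≤ h / Gz z + (z : ℝ) ^ 4 := by
  have hG := Gz_one_le hz
  have hS := sieve_dual z h a
  have h1 : ∀ n ∈ (range h).filter fun n => (a + n).Prime ∧ z < a + n,
      ‖∑ x ∈ Rz z, ((ArithmeticFunction.moebius x.1 / x.1 : ℝ) : ℂ) * x.2 ^ (a + n)‖ ^ 2
        = Gz z ^ 2 := by
    intro n hn
    rw [mem_filter] at hn
    have : ∑ x ∈ Rz z, ((ArithmeticFunction.moebius x.1 / x.1 : ℝ) : ℂ) * x.2 ^ (a + n)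
        = ((Gz z : ℝ) : ℂ) := by
      unfold Rz Gz
      rw [sum_sigma, Complex.ofReal_sum]
      refine sum_congr rfl fun e he => ?_
      simp only [sqf, mem_filter, mem_Icc] at he
      have hc : Nat.Coprime e (a + n) := by
        rw [Nat.coprime_comm, hn.2.1.coprime_iff_not_dvd]
        intro hd
        have := Nat.le_of_dvd (by omega) hd
        omega
      dsimp only
      rw [← mul_sum, ramanujan_coprime (by omega) hc]
      have h2 := ArithmeticFunction.moebius_sq_eq_one_of_squarefree he.2
      have h2' : ((ArithmeticFunction.moebius e : ℤ) : ℂ) ^ 2 = 1 := by exact_mod_cast h2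
      push_cast
      rw [div_mul_eq_mul_div, ← pow_two, h2']
    rw [this, Complex.norm_real, Real.norm_eq_abs, sq_abs]
  have h2 : (((range h).filter fun n => (a + n).Prime ∧ z < a + n).card : ℝ) * Gz z ^ 2
      ≤ h * Gz z + (z : ℝ) ^ 4 := by
    refine le_trans ?_ hS
    rw [← nsmul_eq_mul, ← sum_const, ← sum_congr rfl h1]
    exact sum_le_sum_of_subset_of_nonneg (filter_subset _ _) fun _ _ _ => by positivity
  have hG2 : 0 < Gz z ^ 2 := by positivity
  rw [← le_div_iff₀ hG2] at h2
  refine h2.trans ?_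
  rw [add_div]
  refine add_le_add (le_of_eq ?_) (div_le_self (by positivity) (one_le_pow₀ hG))
  field_simp

theorem Gz_log {z : ℕ} : Real.log (z + 1) ≤ 2 * Gz z := by
  have h1 : Real.log (z + 1) ≤ ∑ n ∈ Icc 1 z, (1 / n : ℝ) := by
    have := log_add_one_le_harmonic z
    rw [harmonic_eq_sum_Icc] at this
    push_cast at this
    simpa using this
  have h2 : ∑ n ∈ Icc 1 z, (1 / n : ℝ) ≤
      ∑ x ∈ (sqf z) ×ˢ (Icc 1 z), (1 / ((x.1 : ℝ) * (x.2 : ℝ) ^ 2)) := by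
    have : ∀ n ∈ Icc 1 z, ∃ x ∈ (sqf z) ×ˢ (Icc 1 z), x.2 ^ 2 * x.1 = n := by
      intro n hn
      rw [mem_Icc] at hn
      obtain ⟨a, b, ha, hb, hab, hsq⟩ := Nat.sq_mul_squarefree_of_pos (show 0 < n by omega)
      refine ⟨(a, b), ?_, hab⟩
      have h1 : a ≤ n := by rw [← hab]; exact Nat.le_mul_of_pos_left _ (by positivity)
      have h2 : b ≤ n := by
        rw [← hab]
        calc b ≤ b ^ 2 := Nat.le_self_pow (by norm_num) b
          _ ≤ b ^ 2 * a := Nat.le_mul_of_pos_right _ ha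
      simp only [sqf, mem_product, mem_filter, mem_Icc]
      exact ⟨⟨⟨ha, by omega⟩, hsq⟩, hb, by omega⟩
    choose! g hg hg2 using this
    calc ∑ n ∈ Icc 1 z, (1 / n : ℝ)
        = ∑ n ∈ Icc 1 z, (1 / (((g n).1 : ℝ) * ((g n).2 : ℝ) ^ 2)) := by
          refine sum_congr rfl fun n hn => ?_
          rw [mul_comm]
          congr 1
          exact_mod_cast (hg2 n hn).symm
      _ = ∑ x ∈ (Icc 1 z).image g, (1 / ((x.1 : ℝ) * (x.2 : ℝ) ^ 2)) := by
          rw [sum_image]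
          intro n hn m hm h
          rw [← hg2 n hn, ← hg2 m hm, h]
      _ ≤ _ := by
          refine sum_le_sum_of_subset_of_nonneg ?_ fun _ _ _ => by positivity
          intro x hx
          obtain ⟨n, hn, rfl⟩ := mem_image.1 hx
          exact hg n hn
  have h3 : ∑ x ∈ (sqf z) ×ˢ (Icc 1 z), (1 / ((x.1 : ℝ) * (x.2 : ℝ) ^ 2)) =
      Gz z * ∑ k ∈ Icc 1 z, (1 / (k : ℝ) ^ 2) := by
    unfold Gz
    rw [sum_mul_sum, sum_product]
    refine sum_congr rfl fun e _ => sum_congr rfl fun k _ => ?_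
    rw [one_div_mul_one_div]
  have h4 : ∀ z : ℕ, ∑ k ∈ Icc 1 z, (1 / (k : ℝ) ^ 2) ≤ 2 - 1 / (z : ℝ) := by
    intro z
    induction z with
    | zero => simp
    | succ n ih =>
      rw [sum_Icc_succ_top (by omega)]
      rcases Nat.eq_zero_or_pos n with rfl | hn
      · norm_num
      have : (1 : ℝ) / ((n + 1 : ℕ) : ℝ) ^ 2 ≤ 1 / (n : ℝ) - 1 / ((n + 1 : ℕ) : ℝ) := by
        push_cast
        have hn : (0 : ℝ) < n := by exact_mod_cast hn
        rw [div_sub_div _ _ (by positivity) (by positivity), div_le_div_iff₀ (by positivity)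
          (by positivity)]
        ring_nf
        nlinarith
      linarith
  have h4' : ∑ k ∈ Icc 1 z, (1 / (k : ℝ) ^ 2) ≤ 2 := by
    have := h4 z
    have h5 : (0 : ℝ) ≤ 1 / (z : ℝ) := by positivity
    linarith
  have hG0 : 0 ≤ Gz z := sum_nonneg fun _ _ => by positivity
  calc _ ≤ _ := h1
    _ ≤ _ := h2
    _ = _ := h3
    _ ≤ Gz z * 2 := by gcongr
    _ = _ := by ring

end Sieve
end

noncomputable section

section NT

/-- Partial Euler product of zeta. -/
def Zk (k : ℕ) (a : ℝ) : ℝ := ∏ p ∈ k.primesBelow, (1 - (p : ℝ) ^ (-a))⁻¹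

theorem rpow_neg_lt_one {p : ℕ} (hp : p.Prime) {a : ℝ} (ha : 0 < a) : (p : ℝ) ^ (-a) < 1 :=
  Real.rpow_lt_one_of_one_lt_of_neg (by exact_mod_cast hp.one_lt) (by linarith)

theorem Zk_pos (k : ℕ) {a : ℝ} (ha : 0 < a) : 0 < Zk k a := by
  refine Finset.prod_pos fun p hp => inv_pos.2 ?_
  have := rpow_neg_lt_one (Nat.prime_of_mem_primesBelow hp) ha
  linarith

theorem Zk_hasSum (k : ℕ) {a : ℝ} (ha : 0 < a) :
    Summable (fun m : k.smoothNumbers => (m : ℝ) ^ (-a)) ∧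
      HasSum (fun m : k.smoothNumbers => (m : ℝ) ^ (-a)) (Zk k a) := by
  let F : ℕ →* ℝ :=
    { toFun := fun n => (n : ℝ) ^ (-a)
      map_one' := by simp
      map_mul' := fun x y => by
        push_cast
        exact Real.mul_rpow (by positivity) (by positivity) }
  have h := EulerProduct.summable_and_hasSum_smoothNumbers_prod_primesBelow_geometric (f := F) (by
    intro p hp
    change ‖(p : ℝ) ^ (-a)‖ < 1
    rw [Real.norm_of_nonneg (by positivity)]
    exact rpow_neg_lt_one hp ha) k
  exact ⟨h.2.summable, h.2⟩

theorem weak_mertens (k : ℕ) (hk : 2 ≤ k) :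
    ∑ p ∈ k.primesBelow, Real.log p / p ≤ Real.log k + Real.log 4 := by
  have hk0 : (0 : ℝ) < k := by exact_mod_cast (by omega : 0 < k)
  have h1 : ∑ p ∈ k.primesBelow, Real.log p * ((k / p : ℕ) : ℝ) ≤ k * Real.log k := by
    calc ∑ p ∈ k.primesBelow, Real.log p * ((k / p : ℕ) : ℝ)
        = ∑ p ∈ k.primesBelow, ∑ m ∈ Finset.Ioc 0 k, if p ∣ m then Real.log p else 0 := by
          refine Finset.sum_congr rfl fun p _ => ?_
          rw [← Finset.sum_filter, Finset.sum_const, Nat.Ioc_filter_dvd_card_eq_div, nsmul_eq_mul,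
            mul_comm]
      _ = ∑ m ∈ Finset.Ioc 0 k, ∑ p ∈ k.primesBelow, if p ∣ m then Real.log p else 0 :=
          Finset.sum_comm
      _ ≤ ∑ m ∈ Finset.Ioc 0 k, Real.log k := by
          refine Finset.sum_le_sum fun m hm => ?_
          rw [Finset.mem_Ioc] at hm
          have hlog : Real.log m ≤ Real.log k :=
            Real.log_le_log (by exact_mod_cast hm.1) (by exact_mod_cast hm.2)
          refine le_trans ?_ hlog
          rw [← ArithmeticFunction.vonMangoldt_sum, ← Finset.sum_filter]
          calc ∑ p ∈ k.primesBelow with p ∣ m, Real.log p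
              = ∑ p ∈ k.primesBelow with p ∣ m, ArithmeticFunction.vonMangoldt p := by
                refine Finset.sum_congr rfl fun p hp => ?_
                rw [Finset.mem_filter] at hp
                rw [ArithmeticFunction.vonMangoldt_apply_prime (Nat.prime_of_mem_primesBelow hp.1)]
            _ ≤ _ := by
                refine Finset.sum_le_sum_of_subset_of_nonneg ?_ fun _ _ _ =>
                  ArithmeticFunction.vonMangoldt_nonneg
                intro p hp
                rw [Finset.mem_filter] at hp
                rw [Nat.mem_divisors]
                exact ⟨hp.2, by omega⟩
      _ = _ := by simp
  have h2 : ∑ p ∈ k.primesBelow, Real.log p ≤ Real.log 4 * k := by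
    refine le_trans ?_ (Chebyshev.theta_le_log4_mul_x hk0.le)
    rw [Chebyshev.theta_eq_sum_Icc, Nat.floor_natCast]
    refine Finset.sum_le_sum_of_subset_of_nonneg ?_ fun p hp _ => ?_
    · intro p hp
      have h1 := Nat.prime_of_mem_primesBelow hp
      have h2 := Nat.lt_of_mem_primesBelow hp
      simp [h1, h2.le]
    · exact Real.log_natCast_nonneg _
  have h3 : k * ∑ p ∈ k.primesBelow, Real.log p / p ≤
      ∑ p ∈ k.primesBelow, Real.log p * ((k / p : ℕ) : ℝ) + ∑ p ∈ k.primesBelow, Real.log p := by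
    rw [Finset.mul_sum, ← Finset.sum_add_distrib]
    refine Finset.sum_le_sum fun p hp => ?_
    have hpp := Nat.prime_of_mem_primesBelow hp
    have hp0 : (0 : ℝ) < p := by exact_mod_cast hpp.pos
    have h4 : (k : ℝ) / p ≤ ((k / p : ℕ) : ℝ) + 1 := by
      rw [← Nat.floor_div_eq_div (K := ℝ)]
      exact (Nat.lt_floor_add_one _).le
    have h5 : 0 ≤ Real.log p := Real.log_natCast_nonneg _
    calc k * (Real.log p / p) = Real.log p * (k / p) := by ring
      _ ≤ Real.log p * (((k / p : ℕ) : ℝ) + 1) := by gcongr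
      _ = _ := by ring
  have h6 : k * ∑ p ∈ k.primesBelow, Real.log p / p ≤ k * (Real.log k + Real.log 4) := by
    nlinarith
  exact le_of_mul_le_mul_left h6 hk0

theorem Zk_compare {k : ℕ} (hk : 2 ≤ k) {a b c : ℝ} (ha : 1 / 2 ≤ a) (ha1 : a ≤ 1) (hab : a ≤ b)
    (hc1 : (b - a) * Real.log k ≤ c) (hc2 : (1 - a) * Real.log k ≤ c) :
    Zk k a ≤ Real.exp (4 * Real.exp c * (3 * c)) * Zk k b := by
  have hlk : 0 ≤ Real.log k := Real.log_natCast_nonneg _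
  have hratio : ∀ p ∈ k.primesBelow, (1 - (p : ℝ) ^ (-a))⁻¹ ≤
      Real.exp (4 * Real.exp c * (b - a) * (Real.log p / p)) * (1 - (p : ℝ) ^ (-b))⁻¹ := by
    intro p hp
    have hpp := Nat.prime_of_mem_primesBelow hp
    have hpk := Nat.lt_of_mem_primesBelow hp
    have hp0 : (0 : ℝ) < p := by exact_mod_cast hpp.pos
    have hp2 : (2 : ℝ) ≤ p := by exact_mod_cast hpp.two_le
    have hlp : 0 ≤ Real.log p := Real.log_natCast_nonneg _
    have hlpk : Real.log p ≤ Real.log k := Real.log_le_log hp0 (by exact_mod_cast hpk.le)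
    have e1 : (p : ℝ) ^ (-a) ≤ 3 / 4 := by
      have h1 : (p : ℝ) ^ (-a) ≤ (2 : ℝ) ^ (-a) :=
        Real.rpow_le_rpow_of_nonpos (by norm_num) hp2 (by linarith)
      have h2 : (2 : ℝ) ^ (-a) ≤ (2 : ℝ) ^ (-(1 / 2 : ℝ)) :=
        Real.rpow_le_rpow_of_exponent_le (by norm_num) (by linarith)
      have h3 : ((2 : ℝ) ^ (-(1 / 2 : ℝ))) ^ 2 = 1 / 2 := by
        rw [← Real.rpow_natCast, ← Real.rpow_mul (by norm_num)]
        norm_num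
      have h4 : (0 : ℝ) ≤ (2 : ℝ) ^ (-(1 / 2 : ℝ)) := by positivity
      have h5 : (2 : ℝ) ^ (-(1 / 2 : ℝ)) ≤ 3 / 4 := by nlinarith
      linarith
    have e2 : (p : ℝ) ^ (-a) ≤ Real.exp c / p := by
      rw [Real.rpow_def_of_pos hp0, le_div_iff₀ hp0]
      nth_rewrite 2 [← Real.exp_log hp0]
      rw [← Real.exp_add]
      apply Real.exp_le_exp.2
      nlinarith
    have e3 : (p : ℝ) ^ (-a) - (p : ℝ) ^ (-b) ≤ (p : ℝ) ^ (-a) * ((b - a) * Real.log p) := by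
      have h1 : (p : ℝ) ^ (-b) = (p : ℝ) ^ (-a) * (p : ℝ) ^ (-(b - a)) := by
        rw [← Real.rpow_add hp0]; ring_nf
      have h2 : 1 - (b - a) * Real.log p ≤ (p : ℝ) ^ (-(b - a)) := by
        rw [Real.rpow_def_of_pos hp0]
        have := Real.add_one_le_exp (Real.log p * -(b - a))
        linarith
      have h3 : (0 : ℝ) ≤ (p : ℝ) ^ (-a) := by positivity
      rw [h1]
      nlinarith
    have e4 : (p : ℝ) ^ (-b) < 1 := rpow_neg_lt_one hpp (by linarith)
    have hu : 0 < 1 - (p : ℝ) ^ (-a) := by linarith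
    have hv : 0 < 1 - (p : ℝ) ^ (-b) := by linarith
    set w := 4 * Real.exp c * (b - a) * (Real.log p / p) with hw
    have hw0 : 0 ≤ w := by
      have : 0 ≤ b - a := by linarith
      positivity
    have e5 : 1 - (p : ℝ) ^ (-b) ≤ (1 + w) * (1 - (p : ℝ) ^ (-a)) := by
      have h1 : (p : ℝ) ^ (-a) * ((b - a) * Real.log p) ≤ w / 4 := by
        have h0 : 0 ≤ (b - a) * Real.log p := mul_nonneg (by linarith) hlp
        calc (p : ℝ) ^ (-a) * ((b - a) * Real.log p)
            ≤ Real.exp c / p * ((b - a) * Real.log p) := by gcongr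
          _ = w / 4 := by rw [hw]; ring
      nlinarith
    have e6 : 1 + w ≤ Real.exp w := by linarith [Real.add_one_le_exp w]
    rw [inv_le_iff_one_le_mul₀ hu, mul_assoc, mul_comm, mul_assoc, mul_comm,
      ← div_eq_mul_inv]
    rw [le_div_iff₀ hv, one_mul]
    nlinarith
  have hexp : Real.exp (4 * Real.exp c * (b - a) * ∑ p ∈ k.primesBelow, (Real.log p / p)) * Zk k b
      ≤ Real.exp (4 * Real.exp c * (3 * c)) * Zk k b := by
    have h1 := weak_mertens k hk
    have h2 : Real.log 4 ≤ 2 * Real.log k := by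
      have : (4 : ℝ) ≤ (k : ℝ) ^ 2 := by
        have : (2 : ℝ) ≤ k := by exact_mod_cast hk
        nlinarith
      calc Real.log 4 ≤ Real.log ((k : ℝ) ^ 2) := Real.log_le_log (by norm_num) this
        _ = 2 * Real.log k := by rw [Real.log_pow]; norm_num
    have h3 := (Zk_pos k (show 0 < b by linarith)).le
    have h4 : (b - a) * ∑ p ∈ k.primesBelow, (Real.log p / p) ≤ 3 * c := by
      have h0 : 0 ≤ b - a := by linarith
      calc (b - a) * ∑ p ∈ k.primesBelow, (Real.log p / p) ≤ (b - a) * (3 * Real.log k) := by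
            gcongr; linarith
        _ ≤ 3 * c := by linarith
    have h5 := Real.exp_pos c
    refine mul_le_mul_of_nonneg_right (Real.exp_le_exp.2 ?_) h3
    rw [mul_assoc (4 * Real.exp c)]
    gcongr
  refine le_trans ?_ hexp
  unfold Zk
  rw [Finset.mul_sum, Real.exp_sum, ← Finset.prod_mul_distrib]
  refine Finset.prod_le_prod (fun p hp => ?_) hratio
  have := rpow_neg_lt_one (Nat.prime_of_mem_primesBelow hp) (show 0 < a by linarith)
  exact inv_nonneg.2 (by linarith)

theorem Zk_ge_log {k : ℕ} : Real.log k ≤ Zk k 1 := by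
  rcases Nat.eq_zero_or_pos k with rfl | hk
  · simpa using (Zk_pos 0 one_pos).le
  obtain ⟨hs, h⟩ := Zk_hasSum k one_pos
  obtain ⟨n, rfl⟩ : ∃ n, k = n + 1 := ⟨k - 1, by omega⟩
  have h1 : Real.log ((n : ℝ) + 1) ≤ ∑ m ∈ Finset.Icc 1 n, (m : ℝ)⁻¹ := by
    have := log_add_one_le_harmonic n
    rw [harmonic_eq_sum_Icc] at this
    push_cast at this
    simpa using this
  push_cast
  refine h1.trans ?_
  have h2 := (hasSum_subtype_iff_indicator (f := fun m : ℕ => (m : ℝ) ^ (-1 : ℝ))).1 h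
  refine le_trans (le_of_eq ?_) (sum_le_hasSum (Finset.Icc 1 n) (fun m _ => ?_) h2)
  · refine Finset.sum_congr rfl fun m hm => ?_
    rw [Finset.mem_Icc] at hm
    rw [Set.indicator_of_mem (Nat.mem_smoothNumbers_of_lt hm.1 (by omega)), Real.rpow_neg_one]
  · exact Set.indicator_nonneg (fun x _ => by positivity) _

theorem Zk_le_zeta {k : ℕ} {b : ℝ} (hb : 1 < b) : Zk k b ≤ ∑' n : ℕ, 1 / (n : ℝ) ^ b := by
  obtain ⟨hs, h⟩ := Zk_hasSum k (show 0 < b by linarith)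
  have e : ∀ n : ℕ, 1 / (n : ℝ) ^ b = (n : ℝ) ^ (-b) := fun n => by
    rw [Real.rpow_neg (by positivity), one_div]
  have hsum : Summable fun n : ℕ => (n : ℝ) ^ (-b) := by
    simpa [e] using Real.summable_one_div_nat_rpow.2 hb
  simp_rw [e]
  have h2 := (hasSum_subtype_iff_indicator (f := fun m : ℕ => (m : ℝ) ^ (-b))).1 h
  exact hasSum_le (fun m => Set.indicator_le_self' (fun x _ => by positivity) m) h2 hsum.hasSum

theorem Zk_le_log : ∃ C : ℝ, 0 < C ∧ ∀ k : ℕ, 2 ≤ k → Zk k 1 ≤ C * Real.log k := by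
  have h := tendsto_sub_mul_tsum_nat_rpow.eventually (gt_mem_nhds (show (1 : ℝ) < 2 by norm_num))
  rw [eventually_nhdsWithin_iff, Metric.eventually_nhds_iff] at h
  obtain ⟨η, hη, h⟩ := h
  have hl2 : 0 < Real.log 2 := Real.log_pos (by norm_num)
  set c := η / 2 * Real.log 2 with hc
  have hc0 : 0 < c := by positivity
  refine ⟨Real.exp (4 * Real.exp c * (3 * c)) * (2 / c), by positivity, fun k hk => ?_⟩
  have hlk : Real.log 2 ≤ Real.log k := Real.log_le_log (by norm_num) (by exact_mod_cast hk)
  have hlk0 : 0 < Real.log k := by linarith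
  have hb : 1 < 1 + c / Real.log k := by
    have : 0 < c / Real.log k := by positivity
    linarith
  have h1 := Zk_compare hk (a := 1) (b := 1 + c / Real.log k) (c := c) (by norm_num) le_rfl hb.le
    (by rw [add_sub_cancel_left, div_mul_cancel₀ _ hlk0.ne']) (by simpa using hc0.le)
  have h2 := h (y := 1 + c / Real.log k) (by
    rw [Real.dist_eq, add_sub_cancel_left, abs_of_pos (by positivity), div_lt_iff₀ hlk0, hc]
    nlinarith) hb
  rw [add_sub_cancel_left] at h2
  have h3 := Zk_le_zeta (k := k) hb
  have h4 : Zk k (1 + c / Real.log k) ≤ 2 / c * Real.log k := by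
    have h5 : c / Real.log k * Zk k (1 + c / Real.log k) ≤ 2 :=
      (mul_le_mul_of_nonneg_left h3 (by positivity)).trans h2.le
    rw [div_mul_eq_mul_div, div_le_iff₀ hlk0] at h5
    rw [div_mul_eq_mul_div, le_div_iff₀ hc0]
    linarith
  calc Zk k 1 ≤ _ := h1
    _ ≤ Real.exp (4 * Real.exp c * (3 * c)) * (2 / c * Real.log k) := by gcongr
    _ = _ := by ring

theorem sum_inv_primes (k : ℕ) (hk : 2 ≤ k) :
    Real.log (Real.log k) - 4 ≤ ∑ p ∈ k.primesBelow, (1 / p : ℝ) := by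
  have hlk : 0 < Real.log k := Real.log_pos (by exact_mod_cast (by omega : 1 < k))
  have h1 : Real.log (Real.log k) ≤ Real.log (Zk k 1) := Real.log_le_log hlk Zk_ge_log
  have h2 : Real.log (Zk k 1) ≤ ∑ p ∈ k.primesBelow, ((1 / p : ℝ) + 2 * (1 / (p : ℝ) ^ 2)) := by
    unfold Zk
    rw [Real.log_prod]
    · refine Finset.sum_le_sum fun p hp => ?_
      have hp2 : (2 : ℝ) ≤ p := by exact_mod_cast (Nat.prime_of_mem_primesBelow hp).two_le
      rw [Real.rpow_neg_one, Real.log_inv]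
      have hu : (p : ℝ)⁻¹ ≤ 1 / 2 := by
        rw [inv_le_comm₀ (by linarith) (by norm_num)]; norm_num; exact_mod_cast hp2
      have h0 : 0 < (p : ℝ)⁻¹ := by positivity
      have h3 := Real.one_sub_inv_le_log_of_pos (x := 1 - (p : ℝ)⁻¹) (by linarith)
      have h4 : (1 - (p : ℝ)⁻¹)⁻¹ - 1 ≤ (p : ℝ)⁻¹ + 2 * (p : ℝ)⁻¹ ^ 2 := by
        rw [sub_le_iff_le_add, inv_le_iff_one_le_mul₀ (by linarith)]
        nlinarith [mul_pos h0 h0]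
      rw [one_div, one_div, ← inv_pow]
      linarith
    · intro p hp
      have := rpow_neg_lt_one (Nat.prime_of_mem_primesBelow hp) one_pos
      exact inv_ne_zero (by linarith)
  have h4 : ∀ z : ℕ, ∑ n ∈ Finset.range (z + 1), (1 / (n : ℝ) ^ 2) ≤ 2 - 1 / (z : ℝ) := by
    intro z
    induction z with
    | zero => simp
    | succ n ih =>
      rw [Finset.sum_range_succ]
      rcases Nat.eq_zero_or_pos n with rfl | hn
      · norm_num
      have : (1 : ℝ) / ((n + 1 : ℕ) : ℝ) ^ 2 ≤ 1 / (n : ℝ) - 1 / ((n + 1 : ℕ) : ℝ) := by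
        push_cast
        have hn : (0 : ℝ) < n := by exact_mod_cast hn
        rw [div_sub_div _ _ (by positivity) (by positivity), div_le_div_iff₀ (by positivity)
          (by positivity)]
        ring_nf
        nlinarith
      linarith
  have h5 : ∑ p ∈ k.primesBelow, (1 / (p : ℝ) ^ 2) ≤ 2 := by
    have h6 := h4 k
    have h7 : (0 : ℝ) ≤ 1 / (k : ℝ) := by positivity
    refine le_trans (Finset.sum_le_sum_of_subset_of_nonneg (t := Finset.range (k + 1)) ?_
      fun _ _ _ => by positivity) (h6.trans (by linarith))
    intro p hp
    have := Nat.lt_of_mem_primesBelow hp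
    simp; omega
  rw [Finset.sum_add_distrib, ← Finset.mul_sum] at h2
  linarith

end NT
end

noncomputable section

lemma integrable_cauchy {σ : ℝ} (hσ : 0 < σ) : Integrable (fun t : ℝ => (1:ℝ) / (σ^2+t^2)) := by
  have h := (integrable_inv_one_add_sq.comp_div hσ.ne').const_mul (1/σ^2)
  refine h.congr (Filter.Eventually.of_forall fun t => ?_)
  simp only
  field_simp

lemma exp_abs_integrable {σ : ℝ} (hσ : 0 < σ) (z : ℂ) (hz : z.re = 0) :
    Integrable (fun v : ℝ => Complex.exp (z * v) * Complex.exp (-(σ * |v|))) ∧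
    ∫ v : ℝ, Complex.exp (z * v) * Complex.exp (-(σ * |v|)) = 1/(σ - z) + 1/(σ+z) := by
  have e1 : Set.EqOn (fun v : ℝ => Complex.exp (z * v) * Complex.exp (-(σ * |v|)))
      (fun v : ℝ => Complex.exp ((z - σ) * v)) (Set.Ioi 0) := by
    intro v hv
    have hv : (0:ℝ) < v := hv
    simp only
    rw [← Complex.exp_add, abs_of_pos hv]; congr 1; ring
  have e2 : Set.EqOn (fun v : ℝ => Complex.exp (z * v) * Complex.exp (-(σ * |v|)))
      (fun v : ℝ => Complex.exp ((z + σ) * v)) (Set.Iic 0) := by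
    intro v hv
    have hv : v ≤ 0 := hv
    simp only
    rw [← Complex.exp_add, abs_of_nonpos hv]; congr 1; push_cast; ring
  have h1 : (z - σ).re < 0 := by simp [hz, hσ]
  have h2 : 0 < (z + σ).re := by simp [hz, hσ]
  have i1 := (integrableOn_congr_fun e1 measurableSet_Ioi).2 (integrableOn_exp_mul_complex_Ioi h1 0)
  have i2 := (integrableOn_congr_fun e2 measurableSet_Iic).2 (integrableOn_exp_mul_complex_Iic h2 0)
  have i : Integrable (fun v : ℝ => Complex.exp (z * v) * Complex.exp (-(σ * |v|))) := by
    rw [← integrableOn_univ, ← Set.Iic_union_Ioi (a := (0:ℝ))]; exact i2.union i1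
  refine ⟨i, ?_⟩
  rw [← intervalIntegral.integral_Iic_add_Ioi i2 i1, setIntegral_congr_fun measurableSet_Ioi e1,
    setIntegral_congr_fun measurableSet_Iic e2, integral_exp_mul_complex_Ioi h1,
    integral_exp_mul_complex_Iic h2]
  have n1 : z - σ ≠ 0 := fun h => by simp [h] at h1
  have n2 : z + σ ≠ 0 := fun h => by simp [h] at h2
  have n3 : σ - z ≠ 0 := fun h => n1 (by linear_combination -h)
  have n4 : (σ:ℂ) + z ≠ 0 := fun h => n2 (by linear_combination h)
  simp
  rw [add_comm z, add_comm, ← neg_sub (σ:ℂ) z, neg_div, one_div, inv_neg]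
  simp

lemma cauchy_ft {σ : ℝ} (hσ : 0 < σ) (x : ℝ) :
    ∫ t : ℝ, Complex.exp (Complex.I * t * x) * ((1/(σ^2+t^2) : ℝ) : ℂ) =
      ((π/σ * Real.exp (-(σ*|x|)) : ℝ) : ℂ) := by
  set g : ℝ → ℂ := fun v => Complex.exp (-(σ * |v|)) with hg
  have gc : Continuous g := by
    rw [hg]; fun_prop
  have gi : Integrable g := by
    have := (exp_abs_integrable hσ 0 rfl).1
    simpa using this
  have F : FourierTransform.fourier g = fun w : ℝ => ((2*σ * (1/(σ^2 + (2*π*w)^2)) : ℝ):ℂ) := by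
    funext w
    rw [Real.fourier_real_eq_integral_exp_smul]
    have h := (exp_abs_integrable hσ (-(2*π*w) * Complex.I) (by simp)).2
    have : ∀ v : ℝ, Complex.exp (↑(-2 * π * v * w) * Complex.I) • g v
        = Complex.exp ((-(2*π*w) * Complex.I) * v) * Complex.exp (-(σ * |v|)) := by
      intro v; simp only [smul_eq_mul, hg]; congr 2; push_cast; ring
    simp_rw [this]; rw [h]
    have n1 : (σ:ℂ) + 2*π*w*Complex.I ≠ 0 := fun h => by
      have := congrArg Complex.re h; simp at this; exact hσ.ne' this
    have n2 : (σ:ℂ) - 2*π*w*Complex.I ≠ 0 := fun h => by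
      have := congrArg Complex.re h; simp at this; exact hσ.ne' this
    have n3 : ((σ^2 + (2*π*w)^2 : ℝ):ℂ) ≠ 0 := by
      exact_mod_cast (by positivity : σ^2 + (2*π*w)^2 ≠ 0)
    have e : ((σ^2 + (2*π*w)^2 : ℝ):ℂ) = ((σ:ℂ) + 2*π*w*Complex.I)*((σ:ℂ) - 2*π*w*Complex.I) := by
      push_cast; ring_nf; simp
    rw [Complex.ofReal_mul, Complex.ofReal_div, e]
    have : (σ:ℂ) - -(2*π*w)*Complex.I = (σ:ℂ) + 2*π*w*Complex.I := by ring
    rw [this]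
    have : (σ:ℂ) + -(2*π*w)*Complex.I = (σ:ℂ) - 2*π*w*Complex.I := by ring
    rw [this]
    field_simp
    push_cast
    ring
  have Fi : Integrable (FourierTransform.fourier g) := by
    rw [F]
    refine Integrable.ofReal ?_
    exact (((integrable_cauchy hσ).comp_mul_left' (by positivity : 2*π ≠ 0)).const_mul (2*σ))
  have inv := congrFun (gc.fourierInv_fourier_eq gi Fi) x
  rw [Real.fourierInv_eq', F] at inv
  have sub := Measure.integral_comp_mul_left (fun t : ℝ => Complex.exp (Complex.I * t * x) * ((1/(σ^2+t^2) : ℝ) : ℂ)) (2*π)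
  have : ∀ v : ℝ, Complex.exp (↑(2 * π * inner ℝ v x) * Complex.I) • ((2*σ * (1/(σ^2 + (2*π*v)^2)) : ℝ):ℂ)
      = (2*σ) * (Complex.exp (Complex.I * (2*π*v : ℝ) * x) * ((1/(σ^2+(2*π*v)^2) : ℝ) : ℂ)) := by
    intro v
    simp only [smul_eq_mul]
    rw [Complex.ofReal_mul (2*σ)]
    have : (↑(2 * π * inner ℝ v x) * Complex.I : ℂ) = Complex.I * (2*π*v : ℝ) * x := by
      simp; ring
    rw [this]; push_cast; ring
  simp_rw [this] at inv
  rw [integral_const_mul, sub, abs_of_pos (by positivity)] at inv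
  have hs : (σ:ℂ) ≠ 0 := by exact_mod_cast hσ.ne'
  have hp : (π:ℂ) ≠ 0 := by exact_mod_cast Real.pi_ne_zero
  have : g x = ((Real.exp (-(σ*|x|)) : ℝ):ℂ) := by simp [hg]
  rw [this] at inv
  rw [Complex.ofReal_mul, ← inv, Complex.real_smul]
  generalize (∫ y : ℝ, Complex.exp (Complex.I * y * x) * ((1/(σ^2+y^2) : ℝ) : ℂ)) = J
  push_cast
  field_simp
end

noncomputable section

lemma l2_expand {X : Type*} [MeasurableSpace X] {ν : Measure X} (φ : ℕ → X → ℂ)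
    (hm : ∀ m n, Integrable (fun x => φ m x * (starRingEnd ℂ) (φ n x)) ν)
    (hs : Summable fun p : ℕ × ℕ => ∫ x, ‖φ p.1 x * (starRingEnd ℂ) (φ p.2 x)‖ ∂ν)
    (hp : ∀ᵐ x ∂ν, Summable fun m => ‖φ m x‖) :
    ((∫ x, ‖∑' m, φ m x‖^2 ∂ν : ℝ):ℂ) =
      ∑' p : ℕ × ℕ, ∫ x, φ p.1 x * (starRingEnd ℂ) (φ p.2 x) ∂ν := by
  have h := (hasSum_integral_of_summable_integral_norm
    (F := fun (p : ℕ × ℕ) x => φ p.1 x * (starRingEnd ℂ) (φ p.2 x)) (fun p => hm p.1 p.2) hs)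
  rw [h.tsum_eq, ← integral_complex_ofReal]
  refine integral_congr_ae ?_
  filter_upwards [hp] with x hx
  have hx2 : Summable fun m => ‖(starRingEnd ℂ) (φ m x)‖ := by simpa using hx
  have := tsum_mul_tsum_of_summable_norm hx hx2
  rw [← this, ← Complex.conj_tsum, Complex.mul_conj, Complex.normSq_eq_norm_sq]

/-- partial sums -/
def Ssum (a : ℕ → ℂ) (u : ℝ) : ℂ := ∑ m ∈ Finset.Icc 1 ⌊u⌋₊, a m

structure GoodCoef (a : ℕ → ℂ) : Prop where
  z : a 0 = 0
  s : ∀ α : ℝ, 0 < α → Summable fun m : ℕ => ‖a m‖ * (m:ℝ)^(-α)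

lemma GoodCoef.growth {a : ℕ → ℂ} (h : GoodCoef a) {α : ℝ} (hα : 0 < α) :
    ∃ Z : ℝ, 0 ≤ Z ∧ ∀ n : ℕ, ∑ m ∈ Finset.Icc 1 n, ‖a m‖ ≤ Z * (n:ℝ)^α := by
  have hnn : ∀ m : ℕ, 0 ≤ ‖a m‖ * (m:ℝ)^(-α) := fun m => by positivity
  refine ⟨∑' m : ℕ, ‖a m‖ * (m:ℝ)^(-α), tsum_nonneg hnn, fun n => ?_⟩
  calc ∑ m ∈ Finset.Icc 1 n, ‖a m‖ ≤ ∑ m ∈ Finset.Icc 1 n, ‖a m‖ * (m:ℝ)^(-α) * (n:ℝ)^α := by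
        refine Finset.sum_le_sum fun m hm => ?_
        obtain ⟨h1, h2⟩ := Finset.mem_Icc.1 hm
        have hm0 : (0:ℝ) < m := by exact_mod_cast h1
        have : (1:ℝ) ≤ (m:ℝ)^(-α) * (n:ℝ)^α := by
          rw [Real.rpow_neg hm0.le, ← div_eq_inv_mul, one_le_div (by positivity)]
          exact Real.rpow_le_rpow hm0.le (by exact_mod_cast h2) hα.le
        nlinarith [norm_nonneg (a m)]
    _ = (∑ m ∈ Finset.Icc 1 n, ‖a m‖ * (m:ℝ)^(-α)) * (n:ℝ)^α := by rw [Finset.sum_mul]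
    _ ≤ _ := by
        gcongr
        exact (h.s α hα).sum_le_tsum _ (fun m _ => hnn m)

lemma Ssum_growth {a : ℕ → ℂ} {Z α : ℝ} (hα : 0 < α) (hZ : 0 ≤ Z)
    (h : ∀ n : ℕ, ∑ m ∈ Finset.Icc 1 n, ‖a m‖ ≤ Z * (n:ℝ)^α) {u : ℝ} (hu : 0 ≤ u) :
    ‖Ssum a u‖ ≤ Z * u^α := by
  calc ‖Ssum a u‖ ≤ ∑ m ∈ Finset.Icc 1 ⌊u⌋₊, ‖a m‖ := norm_sum_le _ _
    _ ≤ Z * (⌊u⌋₊:ℝ)^α := h _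
    _ ≤ _ := by gcongr; exact Nat.floor_le hu

lemma Ssum_meas (a : ℕ → ℂ) : Measurable (Ssum a) := by
  have : Measurable fun n : ℕ => ∑ m ∈ Finset.Icc 1 n, a m := measurable_from_top
  exact this.comp Nat.measurable_floor

lemma Ssum_integrable {a : ℕ → ℂ} (h : GoodCoef a) {σ : ℝ} (hσ : 0 < σ) :
    IntegrableOn (fun u : ℝ => ‖Ssum a u‖^2 * u^(-1-2*σ)) (Set.Ioi 1) := by
  obtain ⟨Z, hZ, hg⟩ := h.growth (half_pos hσ)
  have hi : IntegrableOn (fun u : ℝ => Z^2 * u^(-1-σ)) (Set.Ioi 1) :=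
    (integrableOn_Ioi_rpow_of_lt (by linarith) one_pos).const_mul _
  refine Integrable.mono' hi ?_ ?_
  · exact (((Ssum_meas a).norm.pow_const 2).mul (measurable_id.pow_const _)).aestronglyMeasurable
  · filter_upwards [ae_restrict_mem measurableSet_Ioi] with u hu
    have hu0 : (0:ℝ) < u := lt_trans one_pos hu
    have := Ssum_growth (half_pos hσ) hZ hg hu0.le
    rw [Real.norm_of_nonneg (by positivity)]
    calc ‖Ssum a u‖^2 * u^(-1-2*σ) ≤ (Z * u^(σ/2))^2 * u^(-1-2*σ) := by gcongr
      _ = Z^2 * (u^(σ/2) * u^(σ/2) * u^(-1-2*σ)) := by ring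
      _ = _ := by rw [← Real.rpow_add hu0, ← Real.rpow_add hu0]; congr 2; ring

lemma max_kernel {σ : ℝ} {m n : ℕ} (hm : 1 ≤ m) (hn : 1 ≤ n) :
    (m:ℝ)^(-σ) * (n:ℝ)^(-σ) * Real.exp (-(σ * |Real.log n - Real.log m|))
      = (max (m:ℝ) n)^(-(2*σ)) := by
  have hm0 : (0:ℝ) < m := by exact_mod_cast hm
  have hn0 : (0:ℝ) < n := by exact_mod_cast hn
  rw [Real.rpow_def_of_pos hm0, Real.rpow_def_of_pos hn0, Real.rpow_def_of_pos (lt_max_of_lt_left hm0),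
    ← Real.exp_add, ← Real.exp_add]
  congr 1
  rcases le_total (m:ℝ) n with h | h
  · rw [max_eq_right h, abs_of_nonneg (sub_nonneg.2 (Real.log_le_log hm0 h))]; ring
  · rw [max_eq_left h, abs_of_nonpos (sub_nonpos.2 (Real.log_le_log hn0 h))]; ring

lemma pair_summable {a : ℕ → ℂ} (h : GoodCoef a) {σ : ℝ} (hσ : 0 < σ) :
    Summable fun p : ℕ × ℕ => (‖a p.1‖ * (p.1:ℝ)^(-σ)) * (‖a p.2‖ * (p.2:ℝ)^(-σ)) :=
  (h.s σ hσ).mul_of_nonneg (h.s σ hσ) (fun m => by positivity) (fun m => by positivity)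

/-- the `t` side -/
lemma t_side {a : ℕ → ℂ} (h : GoodCoef a) {σ : ℝ} (hσ : 0 < σ) :
    ((∫ t : ℝ, ‖∑' m : ℕ, a m * (m:ℂ)^(-((σ:ℂ) + t * Complex.I))‖^2 / (σ^2+t^2) : ℝ):ℂ)
      = ∑' p : ℕ × ℕ, (a p.1 * (starRingEnd ℂ) (a p.2)) * ((π/σ * (max (p.1:ℝ) p.2)^(-(2*σ)) : ℝ):ℂ) := by
  set φ : ℕ → ℝ → ℂ := fun m t => a m * (m:ℂ)^(-((σ:ℂ) + t * Complex.I)) * ((1/√(σ^2+t^2) : ℝ):ℂ) with hφ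
  have hpos : ∀ t : ℝ, 0 < σ^2+t^2 := fun t => by positivity
  have hnorm : ∀ m : ℕ, ∀ t : ℝ, ‖a m * (m:ℂ)^(-((σ:ℂ) + t * Complex.I))‖ = ‖a m‖ * (m:ℝ)^(-σ) := by
    intro m t
    rcases Nat.eq_zero_or_pos m with rfl | hm
    · simp [h.z]
    · rw [norm_mul, Complex.norm_natCast_cpow_of_pos hm]; simp
  have hprod : ∀ m n : ℕ, 1 ≤ m → 1 ≤ n → ∀ t : ℝ, φ m t * (starRingEnd ℂ) (φ n t) =
      (a m * (starRingEnd ℂ) (a n) * ((m:ℝ)^(-σ) * (n:ℝ)^(-σ) : ℝ)) *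
      (Complex.exp (Complex.I * t * (Real.log n - Real.log m : ℝ)) * ((1/(σ^2+t^2) : ℝ):ℂ)) := by
    intro m n hm hn t
    have hm0 : (m:ℂ) ≠ 0 := by exact_mod_cast (by omega : m ≠ 0)
    have hn0 : (n:ℂ) ≠ 0 := by exact_mod_cast (by omega : n ≠ 0)
    have e1 : (m:ℂ)^(-((σ:ℂ) + t * Complex.I)) = (((m:ℝ)^(-σ) : ℝ):ℂ) * Complex.exp (-(Complex.I * t * Real.log m)) := by
      rw [Complex.ofReal_cpow (by positivity), Complex.ofReal_natCast, Complex.cpow_def_of_ne_zero hm0,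
        Complex.cpow_def_of_ne_zero hm0, ← Complex.exp_add, Complex.natCast_log]
      congr 1; push_cast; ring
    have e2 : (starRingEnd ℂ) ((n:ℂ)^(-((σ:ℂ) + t * Complex.I))) = (((n:ℝ)^(-σ) : ℝ):ℂ) * Complex.exp (Complex.I * t * Real.log n) := by
      rw [Complex.ofReal_cpow (by positivity), Complex.ofReal_natCast, Complex.cpow_def_of_ne_zero hn0,
        Complex.cpow_def_of_ne_zero hn0, ← Complex.exp_add, ← Complex.natCast_log, ← Complex.exp_conj]
      congr 1
      rw [map_mul, Complex.conj_ofReal]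
      simp only [map_neg, map_add, map_mul, Complex.conj_ofReal, Complex.conj_I]
      push_cast; ring
    have e3 : ((1/(σ^2+t^2) : ℝ):ℂ) = ((1/√(σ^2+t^2) : ℝ):ℂ) * ((1/√(σ^2+t^2) : ℝ):ℂ) := by
      rw [← Complex.ofReal_mul, div_mul_div_comm, Real.mul_self_sqrt (hpos t).le, one_mul]
    have e4 : Complex.exp (Complex.I * t * (Real.log n - Real.log m : ℝ)) =
        Complex.exp (-(Complex.I * t * Real.log m)) * Complex.exp (Complex.I * t * Real.log n) := by
      rw [← Complex.exp_add]; congr 1; push_cast; ring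
    simp only [hφ, map_mul, e1, e2, e3, e4, Complex.conj_ofReal]
    push_cast; ring
  have hz1 : ∀ n t, φ 0 t * (starRingEnd ℂ) (φ n t) = 0 := by intro n t; simp [hφ, h.z]
  have hz2 : ∀ n t, φ n t * (starRingEnd ℂ) (φ 0 t) = 0 := by intro n t; simp [hφ, h.z]
  have hn1 : ∀ m n : ℕ, ∀ t, ‖φ m t * (starRingEnd ℂ) (φ n t)‖ =
      ((‖a m‖ * (m:ℝ)^(-σ)) * (‖a n‖ * (n:ℝ)^(-σ))) * (1/(σ^2+t^2)) := by
    intro m n t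
    rw [norm_mul, Complex.norm_conj]
    simp only [hφ]
    rw [norm_mul, norm_mul (a n * _), hnorm, hnorm, Complex.norm_real, Real.norm_of_nonneg (by positivity)]
    have : 1/(σ^2+t^2) = 1/√(σ^2+t^2) * (1/√(σ^2+t^2)) := by
      rw [div_mul_div_comm, Real.mul_self_sqrt (hpos t).le, one_mul]
    rw [this]; ring
  have hci := integrable_cauchy hσ
  have hm : ∀ m n, Integrable (fun x => φ m x * (starRingEnd ℂ) (φ n x)) := by
    intro m n
    rcases Nat.eq_zero_or_pos m with rfl | hm
    · simp [hz1]
    rcases Nat.eq_zero_or_pos n with rfl | hn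
    · simp [hz2]
    refine Integrable.mono' (hci.const_mul ((‖a m‖ * (m:ℝ)^(-σ)) * (‖a n‖ * (n:ℝ)^(-σ)))) ?_
      (Filter.Eventually.of_forall fun t => (hn1 m n t).le)
    simp_rw [hprod m n hm hn]
    refine Continuous.aestronglyMeasurable ?_
    have : Continuous fun t : ℝ => (1/(σ^2+t^2) : ℝ) :=
      continuous_const.div (by fun_prop) (fun t => (hpos t).ne')
    fun_prop
  have key := l2_expand φ hm ?_ ?_
  · have e0 : ∀ t : ℝ, ‖∑' m, φ m t‖^2 = ‖∑' m : ℕ, a m * (m:ℂ)^(-((σ:ℂ) + t * Complex.I))‖^2 / (σ^2+t^2) := by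
      intro t
      simp only [hφ]
      rw [tsum_mul_right, norm_mul, Complex.norm_real, Real.norm_of_nonneg (by positivity), mul_pow,
        div_pow, Real.sq_sqrt (hpos t).le]
      ring
    simp_rw [e0] at key
    rw [key]
    refine tsum_congr fun p => ?_
    obtain ⟨m, n⟩ := p
    dsimp only
    rcases Nat.eq_zero_or_pos m with rfl | hm
    · simp [hz1, h.z]
    rcases Nat.eq_zero_or_pos n with rfl | hn
    · simp [hz2, h.z]
    simp_rw [hprod m n hm hn]
    rw [integral_const_mul, cauchy_ft hσ, mul_assoc, ← max_kernel hm hn]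
    push_cast; ring
  · simp_rw [hn1, integral_const_mul]
    exact (pair_summable h hσ).mul_right _
  · refine Filter.Eventually.of_forall fun t => ?_
    simp only [hφ, norm_mul _ ((1/√(σ^2+t^2) : ℝ):ℂ), hnorm]
    exact (h.s σ hσ).mul_right _

/-- the `u` side -/
lemma u_side {a : ℕ → ℂ} (h : GoodCoef a) {σ : ℝ} (hσ : 0 < σ) :
    ((∫ u in Set.Ioi (1:ℝ), ‖Ssum a u‖^2 * u^(-1-2*σ) : ℝ):ℂ)
      = ∑' p : ℕ × ℕ, (a p.1 * (starRingEnd ℂ) (a p.2)) * ((1/(2*σ) * (max (p.1:ℝ) p.2)^(-(2*σ)) : ℝ):ℂ) := by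
  set φ : ℕ → ℝ → ℂ := fun m u => a m * (((Set.Ici (m:ℝ)).indicator (fun u : ℝ => u^(-(1/2)-σ)) u : ℝ):ℂ) with hφ
  have hind : ∀ m n : ℕ, ∀ u : ℝ, 1 < u → (Set.Ici (m:ℝ)).indicator (fun u : ℝ => u^(-(1/2)-σ)) u *
      (Set.Ici (n:ℝ)).indicator (fun u : ℝ => u^(-(1/2)-σ)) u =
      (Set.Ici (max (m:ℝ) n)).indicator (fun u : ℝ => u^(-1-2*σ)) u := by
    intro m n u hu
    have hu0 : 0 < u := by linarith
    by_cases h1 : (m:ℝ) ≤ u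
    · by_cases h2 : (n:ℝ) ≤ u
      · rw [Set.indicator_of_mem (by exact h1), Set.indicator_of_mem (by exact h2),
          Set.indicator_of_mem (by exact max_le h1 h2), ← Real.rpow_add hu0]
        congr 1; ring
      · rw [Set.indicator_of_notMem (s := Set.Ici (n:ℝ)) (by exact h2), mul_zero,
          Set.indicator_of_notMem (s := Set.Ici (max (m:ℝ) n)) (fun hh => h2 (le_trans (le_max_right _ _) hh))]
    · rw [Set.indicator_of_notMem (s := Set.Ici (m:ℝ)) (by exact h1), zero_mul,
          Set.indicator_of_notMem (s := Set.Ici (max (m:ℝ) n)) (fun hh => h1 (le_trans (le_max_left _ _) hh))]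
  have hprod : ∀ m n : ℕ, ∀ u : ℝ, 1 < u → φ m u * (starRingEnd ℂ) (φ n u) =
      (a m * (starRingEnd ℂ) (a n)) *
        (((Set.Ici (max (m:ℝ) n)).indicator (fun u : ℝ => u^(-1-2*σ)) u : ℝ):ℂ) := by
    intro m n u hu
    rw [← hind m n u hu]
    simp only [hφ, map_mul, Complex.conj_ofReal]
    push_cast; ring
  have hz1 : ∀ n t, φ 0 t * (starRingEnd ℂ) (φ n t) = 0 := by intro n t; simp [hφ, h.z]
  have hz2 : ∀ n t, φ n t * (starRingEnd ℂ) (φ 0 t) = 0 := by intro n t; simp [hφ, h.z]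
  have hii : ∀ m n : ℕ, IntegrableOn ((Set.Ici (max (m:ℝ) n)).indicator (fun u : ℝ => u^(-1-2*σ))) (Set.Ioi 1) := by
    intro m n
    refine Integrable.indicator ?_ measurableSet_Ici
    exact integrableOn_Ioi_rpow_of_lt (by linarith) one_pos
  have hival : ∀ m n : ℕ, 1 ≤ m → 1 ≤ n → ∫ u in Set.Ioi (1:ℝ), (Set.Ici (max (m:ℝ) n)).indicator (fun u : ℝ => u^(-1-2*σ)) u
      = 1/(2*σ) * (max (m:ℝ) n)^(-(2*σ)) := by
    intro m n hm hn
    have hm1 : (1:ℝ) ≤ m := by exact_mod_cast hm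
    have hmx : (1:ℝ) ≤ max (m:ℝ) n := le_max_of_le_left hm1
    rw [← integral_Ici_eq_integral_Ioi, setIntegral_indicator measurableSet_Ici,
      Set.inter_eq_right.2 (Set.Ici_subset_Ici.2 hmx), integral_Ici_eq_integral_Ioi,
      integral_Ioi_rpow_of_lt (by linarith) (by linarith)]
    rw [show -1-2*σ+1 = -(2*σ) by ring]
    field_simp
  have hci : ∀ m n, IntegrableOn (fun x => φ m x * (starRingEnd ℂ) (φ n x)) (Set.Ioi 1) := by
    intro m n
    refine (integrableOn_congr_fun (fun u hu => hprod m n u hu) measurableSet_Ioi).2 ?_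
    exact (hii m n).ofReal.const_mul _
  have key := l2_expand (ν := volume.restrict (Set.Ioi (1:ℝ))) φ hci ?_ ?_
  · have e0 : ∫ u in Set.Ioi (1:ℝ), ‖∑' m, φ m u‖^2 = ∫ u in Set.Ioi (1:ℝ), ‖Ssum a u‖^2 * u^(-1-2*σ) := by
      refine setIntegral_congr_fun measurableSet_Ioi fun u hu => ?_
      have hu0 : (0:ℝ) < u := lt_trans one_pos hu
      have : ∑' m, φ m u = Ssum a u * ((u^(-(1/2)-σ) : ℝ):ℂ) := by
        rw [tsum_eq_sum (s := Finset.Icc 1 ⌊u⌋₊), Ssum, Finset.sum_mul]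
        · refine Finset.sum_congr rfl fun m hm => ?_
          simp only [hφ]
          rw [Set.indicator_of_mem]
          exact (Nat.le_floor_iff hu0.le).1 (Finset.mem_Icc.1 hm).2
        · intro m hm
          rcases Nat.eq_zero_or_pos m with rfl | h0
          · simp [hφ, h.z]
          · simp only [hφ]
            rw [Set.indicator_of_notMem]
            · simp
            · intro hh
              exact hm (Finset.mem_Icc.2 ⟨h0, (Nat.le_floor_iff hu0.le).2 hh⟩)
      simp only [this]
      rw [norm_mul, mul_pow, Complex.norm_real, Real.norm_of_nonneg (by positivity), sq (u^(-(1/2)-σ)), ← Real.rpow_add hu0]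
      congr 2; ring
    rw [e0] at key
    rw [key]
    refine tsum_congr fun p => ?_
    obtain ⟨m, n⟩ := p
    dsimp only
    rcases Nat.eq_zero_or_pos m with rfl | hm
    · simp [hz1, h.z]
    rcases Nat.eq_zero_or_pos n with rfl | hn
    · simp [hz2, h.z]
    rw [setIntegral_congr_fun measurableSet_Ioi (fun u hu => hprod m n u hu), integral_const_mul,
      integral_complex_ofReal, hival m n hm hn]
  · refine Summable.of_nonneg_of_le (fun p => integral_nonneg fun x => norm_nonneg _) (fun p => ?_)
      ((pair_summable h hσ).mul_right (1/(2*σ)))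
    obtain ⟨m, n⟩ := p
    dsimp only
    rcases Nat.eq_zero_or_pos m with rfl | hm
    · simp [hz1, h.z]
    rcases Nat.eq_zero_or_pos n with rfl | hn
    · simp [hz2, h.z]
    have : ∫ u in Set.Ioi (1:ℝ), ‖φ m u * (starRingEnd ℂ) (φ n u)‖ =
        ∫ u in Set.Ioi (1:ℝ), (‖a m‖ * ‖a n‖) * (Set.Ici (max (m:ℝ) n)).indicator (fun u : ℝ => u^(-1-2*σ)) u := by
      refine setIntegral_congr_fun measurableSet_Ioi fun u hu => ?_
      have hu0 : (0:ℝ) < u := lt_trans one_pos hu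
      rw [hprod m n u hu, norm_mul, norm_mul, Complex.norm_conj, Complex.norm_real, Real.norm_of_nonneg]
      exact Set.indicator_apply_nonneg (fun _ => by positivity)
    rw [this, integral_const_mul, hival m n hm hn, ← max_kernel hm hn]
    have e1 : Real.exp (-(σ * |Real.log n - Real.log m|)) ≤ 1 := by
      rw [Real.exp_le_one_iff]; have := abs_nonneg (Real.log n - Real.log m); nlinarith
    calc _ = (‖a m‖ * (m:ℝ)^(-σ)) * (‖a n‖ * (n:ℝ)^(-σ)) * (1/(2*σ)) * Real.exp (-(σ * |Real.log n - Real.log m|)) := by ring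
      _ ≤ (‖a m‖ * (m:ℝ)^(-σ)) * (‖a n‖ * (n:ℝ)^(-σ)) * (1/(2*σ)) * 1 := by gcongr
      _ = _ := by ring
  · filter_upwards with u
    refine summable_of_finite_support ((Finset.Icc 0 ⌊u⌋₊).finite_toSet.subset ?_)
    intro m hm
    simp only [Function.mem_support, hφ] at hm
    by_contra hc
    apply hm
    rw [Set.indicator_of_notMem]
    · simp
    · intro hh
      have hh : (m:ℝ) ≤ u := hh
      exact hc (by simpa using Nat.le_floor hh)

theorem plancherel {a : ℕ → ℂ} (h : GoodCoef a) {σ : ℝ} (hσ : 0 < σ) :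
    ∫ u in Set.Ioi (1:ℝ), ‖Ssum a u‖^2 * u^(-1-2*σ) =
     1/(2*π) * ∫ t : ℝ, ‖∑' m : ℕ, a m * (m:ℂ)^(-((σ:ℂ) + t * Complex.I))‖^2 / (σ^2+t^2) := by
  have h1 := t_side h hσ
  have h2 := u_side h hσ
  apply Complex.ofReal_injective
  rw [Complex.ofReal_mul, h1, h2, ← tsum_mul_left]
  refine tsum_congr fun p => ?_
  have : (σ:ℂ) ≠ 0 := by exact_mod_cast hσ.ne'
  have : (π:ℂ) ≠ 0 := by exact_mod_cast Real.pi_ne_zero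
  push_cast
  field_simp
end

noncomputable section

lemma sup_bound {a : ℕ → ℂ} (h : GoodCoef a) {σ δ : ℝ} (hσ : 0 < σ) (hδ : 0 < δ) {s : ℂ}
    (hs : s.re = σ + δ) :
    ‖∑' m : ℕ, a m * (m:ℂ)^(-s)‖^2 ≤
      ‖s‖^2/(2*δ) * ∫ u in Set.Ioi (1:ℝ), ‖Ssum a u‖^2 * u^(-1-2*σ) := by
  obtain ⟨Z, hZ, hg⟩ := h.growth hσ
  have hO : (fun n : ℕ ↦ ∑ k ∈ Finset.Icc 1 n, ‖a k‖) =O[Filter.atTop] fun n : ℕ ↦ (n : ℝ) ^ σ := by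
    refine Asymptotics.IsBigO.of_bound Z (Filter.Eventually.of_forall fun n => ?_)
    rw [Real.norm_of_nonneg (Finset.sum_nonneg fun _ _ => norm_nonneg _), Real.norm_of_nonneg (by positivity)]
    exact hg n
  have hL := LSeries_eq_mul_integral' a hσ.le (s := s) (by linarith) hO
  have hF : LSeries a s = ∑' m : ℕ, a m * (m:ℂ)^(-s) := by
    rw [LSeries]
    refine tsum_congr fun m => ?_
    rw [LSeries.term_def]
    split_ifs with h0
    · subst h0; simp [h.z]
    · rw [Complex.cpow_neg, div_eq_mul_inv]
  rw [← hF, hL, norm_mul, mul_pow, div_mul_eq_mul_div, mul_div_assoc]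
  gcongr
  have hSi := Ssum_integrable h hσ
  set fF : ℝ → ℝ := fun u => ‖Ssum a u‖ * u^(-(1/2)-σ) with hfF
  set gG : ℝ → ℝ := fun u => u^(-(1/2)-δ) with hgG
  have hfm : Measurable fF := (Ssum_meas a).norm.mul (measurable_id.pow_const _)
  have hgm : Measurable gG := measurable_id.pow_const _
  have hf2 : Set.EqOn (fun u => fF u ^ 2) (fun u => ‖Ssum a u‖^2 * u^(-1-2*σ)) (Set.Ioi 1) := by
    intro u hu
    have hu0 : (0:ℝ) < u := lt_trans one_pos hu
    simp only [hfF]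
    rw [mul_pow, sq (u^(-(1/2)-σ)), ← Real.rpow_add hu0]; congr 2; ring
  have hg2 : Set.EqOn (fun u => gG u ^ 2) (fun u => u^(-1-2*δ)) (Set.Ioi 1) := by
    intro u hu
    have hu0 : (0:ℝ) < u := lt_trans one_pos hu
    simp only [hgG]
    rw [sq (u^(-(1/2)-δ)), ← Real.rpow_add hu0]; congr 1; ring
  have hgi : IntegrableOn (fun u : ℝ => u^(-1-2*δ)) (Set.Ioi 1) :=
    integrableOn_Ioi_rpow_of_lt (by linarith) one_pos
  have hfL : MemLp fF (ENNReal.ofReal 2) (volume.restrict (Set.Ioi 1)) := by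
    rw [show ENNReal.ofReal 2 = 2 by norm_num, memLp_two_iff_integrable_sq hfm.aestronglyMeasurable]
    exact (integrableOn_congr_fun hf2 measurableSet_Ioi).2 hSi
  have hgL : MemLp gG (ENNReal.ofReal 2) (volume.restrict (Set.Ioi 1)) := by
    rw [show ENNReal.ofReal 2 = 2 by norm_num, memLp_two_iff_integrable_sq hgm.aestronglyMeasurable]
    exact (integrableOn_congr_fun hg2 measurableSet_Ioi).2 hgi
  have CS := integral_mul_le_Lp_mul_Lq_of_nonneg (μ := volume.restrict (Set.Ioi (1:ℝ)))
    Real.HolderConjugate.two_two (f := fF) (g := gG)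
    (by filter_upwards [ae_restrict_mem measurableSet_Ioi] with u hu
        have hu0 : (0:ℝ) < u := lt_trans one_pos hu
        simp only [hfF, Pi.zero_apply]; positivity)
    (by filter_upwards [ae_restrict_mem measurableSet_Ioi] with u hu
        have hu0 : (0:ℝ) < u := lt_trans one_pos hu
        simp only [hgG, Pi.zero_apply]; positivity) hfL hgL
  simp only [Real.rpow_two] at CS
  rw [setIntegral_congr_fun measurableSet_Ioi hf2, setIntegral_congr_fun measurableSet_Ioi hg2,
    integral_Ioi_rpow_of_lt (by linarith) one_pos] at CS
  set I := ∫ u in Set.Ioi (1:ℝ), ‖Ssum a u‖^2 * u^(-1-2*σ) with hI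
  have hI0 : 0 ≤ I := by
    rw [hI]
    refine setIntegral_nonneg measurableSet_Ioi fun u hu => ?_
    have hu0 : (0:ℝ) < u := lt_trans one_pos hu
    positivity
  have hn : ‖∫ t in Set.Ioi (1:ℝ), (∑ k ∈ Finset.Icc 1 ⌊t⌋₊, a k) * (t:ℂ) ^ (-(s + 1))‖ ≤
      ∫ u in Set.Ioi (1:ℝ), fF u * gG u := by
    refine (norm_integral_le_integral_norm _).trans (le_of_eq ?_)
    refine setIntegral_congr_fun measurableSet_Ioi fun u hu => ?_
    have hu0 : (0:ℝ) < u := lt_trans one_pos hu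
    simp only [hfF, hgG]
    rw [norm_mul, Complex.norm_cpow_eq_rpow_re_of_pos hu0, mul_assoc, ← Real.rpow_add hu0]
    rw [show (-(s+1)).re = -(1/2)-σ+(-(1/2)-δ) by simp [hs]; ring]
    rfl
  have h4 := hn.trans CS
  rw [show (-(1:ℝ)^(-1-2*δ+1))/(-1-2*δ+1) = 1/(2*δ) by
    rw [Real.one_rpow, show -1-2*δ+1 = -(2*δ) by ring, neg_div_neg_eq]] at h4
  calc _ ≤ (I ^ (1/2:ℝ) * (1/(2*δ))^(1/2:ℝ))^2 := by gcongr
    _ = I/(2*δ) := by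
      rw [mul_pow, ← Real.sqrt_eq_rpow, ← Real.sqrt_eq_rpow, Real.sq_sqrt hI0, Real.sq_sqrt (by positivity)]
      ring

section
variable {Ω : Type*} {m0 : MeasurableSpace Ω} {μ : Measure Ω} {f : Ω → ℕ → ℂ}

open Classical in
def smc (f : Ω → ℕ → ℂ) (k : ℕ) (ω : Ω) (m : ℕ) : ℂ := if m ∈ k.smoothNumbers then f ω m else 0

lemma zero_notMem_smooth (k : ℕ) : (0:ℕ) ∉ k.smoothNumbers := by
  intro h; exact Nat.ne_zero_of_mem_smoothNumbers h rfl

lemma smc_good (hf : SN μ f) (k : ℕ) (ω : Ω) : GoodCoef (smc f k ω) := by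
  refine ⟨by simp [smc, zero_notMem_smooth], fun α hα => ?_⟩
  have h := (Zk_hasSum k hα).1
  replace h := (summable_subtype_iff_indicator (f := fun m : ℕ => (m:ℝ)^(-α)) (s := k.smoothNumbers)).1 h
  refine h.congr fun m => ?_
  by_cases hm : m ∈ k.smoothNumbers
  · have : 1 ≤ m := Nat.pos_of_ne_zero (Nat.ne_zero_of_mem_smoothNumbers hm)
    rw [Set.indicator_of_mem hm]; simp [smc, hm, hf.nrm ω m this]
  · rw [Set.indicator_of_notMem hm]; simp [smc, hm]

lemma smc_euler (hf : SN μ f) (k : ℕ) (ω : Ω) {s : ℂ} (hs : 0 < s.re) :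
    ∑' m : ℕ, smc f k ω m * (m:ℂ)^(-s) = ∏ p ∈ k.primesBelow, (1 - (p:ℂ)^(-s) * f ω p)⁻¹ := by
  have hs0 : -s ≠ 0 := by intro h; rw [neg_eq_zero] at h; simp [h] at hs
  let F : ℕ →* ℂ :=
    { toFun := fun n => (n:ℂ)^(-s) * f ω n
      map_one' := by simp [hf.map_one]
      map_mul' := fun x y => by
        rcases Nat.eq_zero_or_pos x with rfl | hx
        · simp [hs0]
        rcases Nat.eq_zero_or_pos y with rfl | hy
        · simp [hs0]
        rw [hf.map_mul ω x y hx hy]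
        push_cast
        rw [Complex.natCast_mul_natCast_cpow]; ring }
  have h := (EulerProduct.summable_and_hasSum_smoothNumbers_prod_primesBelow_geometric (f := F) (by
    intro p hp
    change ‖(p:ℂ)^(-s) * f ω p‖ < 1
    rw [norm_mul, hf.nrm ω p hp.one_le, mul_one]
    exact coef_lt hp hs) k).2
  replace h := (hasSum_subtype_iff_indicator (f := fun m : ℕ => F m) (s := k.smoothNumbers)).1 h
  rw [← show _ = ∏ p ∈ k.primesBelow, (1 - (p:ℂ)^(-s) * f ω p)⁻¹ from h.tsum_eq]
  refine tsum_congr fun m => ?_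
  by_cases hm : m ∈ k.smoothNumbers
  · rw [Set.indicator_of_mem hm]; simp [smc, hm, F, mul_comm]
  · rw [Set.indicator_of_notMem hm]; simp [smc, hm]

lemma smc_norm_sq (hf : SN μ f) (k : ℕ) (ω : Ω) {s : ℂ} (hs : 0 < s.re) :
    ‖∑' m : ℕ, smc f k ω m * (m:ℂ)^(-s)‖^2 = Zk k (2*s.re) * Dk f k s ω := by
  rw [smc_euler hf k ω hs, norm_prod, Zk, Dk, ← Finset.prod_pow, ← Finset.prod_mul_distrib]
  refine Finset.prod_congr rfl fun p hp => ?_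
  have hpp := Nat.prime_of_mem_primesBelow hp
  have h1 : ‖(p:ℂ)^(-s)‖^2 = (p:ℝ)^(-(2*s.re)) := by
    rw [coef_norm hpp, ← Real.rpow_natCast, ← Real.rpow_mul (by positivity)]; congr 1; push_cast; ring
  have h2 : 1 - (p:ℝ)^(-(2*s.re)) ≠ 0 := by
    have := rpow_neg_lt_one hpp (a := 2*s.re) (by linarith); linarith
  rw [pw, h1, norm_inv, inv_pow]
  field_simp

lemma ofReal_int_le {g : ℝ → ℝ} (hg : ∀ t, 0 ≤ g t) :
    ENNReal.ofReal (∫ t, g t) ≤ ∫⁻ t, ENNReal.ofReal (g t) := by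
  by_cases h : Integrable g
  · rw [ofReal_integral_eq_lintegral_ofReal h (Filter.Eventually.of_forall hg)]
  · rw [integral_undef h]; simp

lemma S_int_le_Mk (hf : SN μ f) (k : ℕ) (ω : Ω) {σ : ℝ} (hσ : 0 < σ) :
    ENNReal.ofReal (∫ u in Set.Ioi (1:ℝ), ‖Ssum (smc f k ω) u‖^2 * u^(-1-2*σ)) ≤
      ENNReal.ofReal (Zk k (2*σ) / (2*π)) * Mk f k σ ω := by
  rw [plancherel (smc_good hf k ω) hσ]
  have e : ∀ t : ℝ, ‖∑' m : ℕ, smc f k ω m * (m:ℂ)^(-((σ:ℂ) + t * Complex.I))‖^2 / (σ^2+t^2)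
      = Zk k (2*σ) * (Dk f k (σ + t*Complex.I) ω / (σ^2+t^2)) := by
    intro t
    rw [smc_norm_sq hf k ω (by simpa using hσ)]; simp; ring
  simp_rw [e]
  rw [integral_const_mul, ← mul_assoc, ENNReal.ofReal_mul (by have := Zk_pos k (a := 2*σ) (by linarith); positivity), Mk]
  have : 1/(2*π) * Zk k (2*σ) = Zk k (2*σ) / (2*π) := by ring
  rw [this]
  gcongr
  refine ofReal_int_le fun t => ?_
  exact div_nonneg (Dk_nonneg k (by simpa using hσ) ω) (by positivity)

theorem euler_sup (hf : SN μ f) (k : ℕ) (ω : Ω) {δ : ℝ} (hδ : 0 < δ) (hδ2 : δ < 1/2) {s : ℂ}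
    (hs : s.re = 1/2) :
    ENNReal.ofReal (Zk k 1 * Dk f k s ω) ≤
      ENNReal.ofReal (‖s‖^2/(4*π*δ) * Zk k (1-2*δ)) * Mk f k (1/2-δ) ω := by
  have h1 := sup_bound (smc_good hf k ω) (σ := 1/2-δ) (δ := δ) (by linarith) hδ (s := s) (by rw [hs]; ring)
  rw [smc_norm_sq hf k ω (by rw [hs]; norm_num), hs] at h1
  have h2 := S_int_le_Mk hf k ω (σ := 1/2-δ) (by linarith)
  rw [show 2*(1/2-δ) = 1-2*δ by ring] at h2
  calc _ ≤ ENNReal.ofReal (‖s‖^2/(2*δ) * ∫ u in Set.Ioi (1:ℝ), ‖Ssum (smc f k ω) u‖^2 * u^(-1-2*(1/2-δ))) := by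
        refine ENNReal.ofReal_le_ofReal ?_
        convert h1 using 3; norm_num
    _ = ENNReal.ofReal (‖s‖^2/(2*δ)) * ENNReal.ofReal (∫ u in Set.Ioi (1:ℝ), ‖Ssum (smc f k ω) u‖^2 * u^(-1-2*(1/2-δ))) :=
        ENNReal.ofReal_mul (by positivity)
    _ ≤ ENNReal.ofReal (‖s‖^2/(2*δ)) * (ENNReal.ofReal (Zk k (1-2*δ) / (2*π)) * Mk f k (1/2-δ) ω) := by
        rw [show 2*(1/2-δ) = 1-2*δ by ring]
        gcongr
    _ = _ := by
        rw [← mul_assoc, ← ENNReal.ofReal_mul (by positivity)]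
        congr 2; field_simp; ring

theorem sum_le_Mk (hf : SN μ f) {k R : ℕ} (hR : R < k) (ω : Ω) :
    ENNReal.ofReal (∑ r ∈ Finset.Icc 1 R, ‖∑ m ∈ Finset.Icc 1 r, f ω m‖^2 / ((r:ℝ)*(r+1))) ≤
      ENNReal.ofReal (Zk k 1 / (2*π)) * Mk f k (1/2) ω := by
  have h2 := S_int_le_Mk hf k ω (σ := 1/2) (by norm_num)
  rw [show (2:ℝ)*(1/2) = 1 by norm_num] at h2
  refine le_trans (ENNReal.ofReal_le_ofReal ?_) h2
  have hi := Ssum_integrable (smc_good hf k ω) (σ := 1/2) (by norm_num)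
  rw [show (2:ℝ)*(1/2) = 1 by norm_num] at hi
  have hval : ∀ r ∈ Finset.Icc 1 R, ‖∑ m ∈ Finset.Icc 1 r, f ω m‖^2 / ((r:ℝ)*(r+1)) =
      ∫ u in Set.Ioo (r:ℝ) (r+1), ‖Ssum (smc f k ω) u‖^2 * u^(-1-1:ℝ) := by
    intro r hr
    obtain ⟨hr1, hr2⟩ := Finset.mem_Icc.1 hr
    have hr0 : (0:ℝ) < r := by exact_mod_cast hr1
    have e : Set.EqOn (fun u : ℝ => ‖Ssum (smc f k ω) u‖^2 * u^(-1-1:ℝ))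
        (fun u : ℝ => ‖∑ m ∈ Finset.Icc 1 r, f ω m‖^2 * u^(-1-1:ℝ)) (Set.Ioo (r:ℝ) (r+1)) := by
      intro u hu
      have : ⌊u⌋₊ = r := (Nat.floor_eq_iff (hr0.trans hu.1).le).2 ⟨hu.1.le, hu.2⟩
      simp only [Ssum, this]
      congr 3
      refine Finset.sum_congr rfl fun m hm => ?_
      obtain ⟨hm1, hm2⟩ := Finset.mem_Icc.1 hm
      rw [smc, if_pos]
      exact Nat.mem_smoothNumbers_of_lt hm1 (by omega)
    rw [setIntegral_congr_fun measurableSet_Ioo e, integral_const_mul, ← integral_Ioc_eq_integral_Ioo,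
      ← intervalIntegral.integral_of_le (by linarith), integral_rpow]
    · rw [show (-1-1+1:ℝ) = -1 by norm_num, Real.rpow_neg_one, Real.rpow_neg_one]
      field_simp
      ring
    · right
      refine ⟨by norm_num, ?_⟩
      rw [Set.uIcc_of_le (by linarith)]
      intro h0; linarith [h0.1]
  rw [Finset.sum_congr rfl hval, ← integral_biUnion_finset]
  · refine setIntegral_mono_set hi ?_ ?_
    · filter_upwards [ae_restrict_mem measurableSet_Ioi] with u hu
      have hu0 : (0:ℝ) < u := lt_trans one_pos hu
      simp only [Pi.zero_apply]; positivity
    · refine HasSubset.Subset.eventuallyLE (fun u hu => ?_)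
      simp only [Set.mem_iUnion] at hu
      obtain ⟨r, hr, hu⟩ := hu
      have : (1:ℝ) ≤ r := by exact_mod_cast (Finset.mem_Icc.1 hr).1
      exact lt_of_le_of_lt this hu.1
  · exact fun _ _ => measurableSet_Ioo
  · intro i _ j _ hij
    refine Set.disjoint_left.2 fun u hu hv => hij ?_
    have e1 : ⌊u⌋₊ = i := (Nat.floor_eq_iff (le_trans (Nat.cast_nonneg i) hu.1.le)).2 ⟨hu.1.le, hu.2⟩
    have e2 : ⌊u⌋₊ = j := (Nat.floor_eq_iff (le_trans (Nat.cast_nonneg j) hv.1.le)).2 ⟨hv.1.le, hv.2⟩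
    exact e1.symm.trans e2
  · intro r hr
    refine hi.mono_set fun u hu => ?_
    have : (1:ℝ) ≤ r := by exact_mod_cast (Finset.mem_Icc.1 hr).1
    exact lt_of_le_of_lt this hu.1
end
end

noncomputable section

lemma V_det1 (S : ℕ → ℂ) {x z M h : ℕ} (hh : 1 ≤ h) (hM : h ≤ M) (hzM : z ≤ M) {B : ℝ}
    (hB : ∀ a : ℕ, (((Finset.range h).filter fun n => (a + n).Prime ∧ z < a + n).card : ℝ) ≤ B) :
    ∑ p ∈ (Finset.Ioc M x).filter Nat.Prime, ‖S (x/p)‖^2 ≤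
      2*B/h * ∑ n ∈ Finset.Icc (M+1-h) x, ‖S (x/n)‖^2 +
      2/h * ∑ p ∈ (Finset.Ioc M x).filter Nat.Prime, ∑ i ∈ Finset.range h, ‖S (x/p) - S (x/(p-i))‖^2 := by
  have hh0 : (0:ℝ) < h := by exact_mod_cast hh
  set P := (Finset.Ioc M x).filter Nat.Prime with hP
  have h1 : ∀ p ∈ P, ‖S (x/p)‖^2 ≤ 2/h * ∑ i ∈ Finset.range h, ‖S (x/(p-i))‖^2 +
      2/h * ∑ i ∈ Finset.range h, ‖S (x/p) - S (x/(p-i))‖^2 := by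
    intro p _
    have : ∀ i ∈ Finset.range h, ‖S (x/p)‖^2 ≤ 2 * ‖S (x/(p-i))‖^2 + 2 * ‖S (x/p) - S (x/(p-i))‖^2 := by
      intro i _
      have h3 : ‖S (x/p)‖ ≤ ‖S (x/(p-i))‖ + ‖S (x/p) - S (x/(p-i))‖ := by
        have := norm_add_le (S (x/(p-i))) (S (x/p) - S (x/(p-i)))
        simpa using this
      calc ‖S (x/p)‖^2 ≤ (‖S (x/(p-i))‖ + ‖S (x/p) - S (x/(p-i))‖)^2 := by gcongr
        _ ≤ _ := by nlinarith [sq_nonneg (‖S (x/(p-i))‖ - ‖S (x/p) - S (x/(p-i))‖)]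
    have h4 := Finset.sum_le_sum this
    rw [Finset.sum_const, Finset.card_range, nsmul_eq_mul, Finset.sum_add_distrib, ← Finset.mul_sum,
      ← Finset.mul_sum] at h4
    rw [div_mul_eq_mul_div, div_mul_eq_mul_div, ← add_div, le_div_iff₀ hh0]
    linarith
  refine (Finset.sum_le_sum h1).trans ?_
  rw [Finset.sum_add_distrib, ← Finset.mul_sum, ← Finset.mul_sum]
  refine add_le_add ?_ le_rfl
  rw [show 2*B/h * ∑ n ∈ Finset.Icc (M+1-h) x, ‖S (x/n)‖^2 =
    2/h * (B * ∑ n ∈ Finset.Icc (M+1-h) x, ‖S (x/n)‖^2) by ring]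
  refine mul_le_mul_of_nonneg_left ?_ (by positivity)
  rw [Finset.sum_comm]
  have h5 : ∀ i ∈ Finset.range h, ∑ p ∈ P, ‖S (x/(p-i))‖^2 ≤
      ∑ n ∈ Finset.Icc (M+1-h) x, if ((n+i).Prime ∧ z < n+i) then ‖S (x/n)‖^2 else 0 := by
    intro i hi
    rw [Finset.mem_range] at hi
    have hinj : Set.InjOn (fun p : ℕ => p - i) (P : Set ℕ) := by
      intro p hp q hq hpq
      have hp := (Finset.mem_Ioc.1 (Finset.mem_filter.1 hp).1).1
      have hq := (Finset.mem_Ioc.1 (Finset.mem_filter.1 hq).1).1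
      simp only at hpq
      omega
    rw [← Finset.sum_image (s := P) (g := fun p : ℕ => p - i) (f := fun n => ‖S (x/n)‖^2) hinj,
      ← Finset.sum_filter]
    refine Finset.sum_le_sum_of_subset_of_nonneg ?_ (fun _ _ _ => by positivity)
    intro n hn
    obtain ⟨p, hp, rfl⟩ := Finset.mem_image.1 hn
    obtain ⟨hp1, hp2⟩ := Finset.mem_filter.1 hp
    obtain ⟨hp3, hp4⟩ := Finset.mem_Ioc.1 hp1
    have : p - i + i = p := by omega
    simp only [Finset.mem_filter, Finset.mem_Icc, this]
    refine ⟨⟨by omega, by omega⟩, hp2, by omega⟩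
  refine (Finset.sum_le_sum h5).trans ?_
  rw [Finset.sum_comm, Finset.mul_sum]
  refine Finset.sum_le_sum fun n _ => ?_
  rw [← Finset.sum_filter, Finset.sum_const, nsmul_eq_mul]
  gcongr
  exact hB n

lemma V_det2 (S : ℕ → ℂ) {x M h : ℕ} (hM : 2*h ≤ M) (hM1 : M*M ≤ x) (hM2 : x < (M+1)*(M+1)) (hM3 : 1 ≤ M) :
    ∑ n ∈ Finset.Icc (M+1-h) x, ‖S (x/n)‖^2 ≤
      13 * x * ∑ r ∈ Finset.Icc 1 x, ‖S r‖^2/((r:ℝ)*(r+1)) := by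
  have hmaps : ∀ n ∈ Finset.Icc (M+1-h) x, x/n ∈ Finset.Icc 1 x := by
    intro n hn
    obtain ⟨h1, h2⟩ := Finset.mem_Icc.1 hn
    exact Finset.mem_Icc.2 ⟨(Nat.one_le_div_iff (by omega)).2 h2, Nat.div_le_self _ _⟩
  rw [← Finset.sum_fiberwise_of_maps_to hmaps, Finset.mul_sum]
  refine Finset.sum_le_sum fun r hr => ?_
  have hr1 := (Finset.mem_Icc.1 hr).1
  have hr0 : (0:ℝ) < r := by exact_mod_cast hr1
  have e : ∑ n ∈ (Finset.Icc (M+1-h) x).filter (fun n => x/n = r), ‖S (x/n)‖^2 =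
      ((Finset.Icc (M+1-h) x).filter (fun n => x/n = r)).card * ‖S r‖^2 := by
    rw [← nsmul_eq_mul, ← Finset.sum_const]
    exact Finset.sum_congr rfl fun n hn => by rw [(Finset.mem_filter.1 hn).2]
  rw [e]
  have key : (((Finset.Icc (M+1-h) x).filter (fun n => x/n = r)).card : ℝ) ≤ 13*x/((r:ℝ)*(r+1)) := by
    rcases Finset.eq_empty_or_nonempty ((Finset.Icc (M+1-h) x).filter (fun n => x/n = r)) with h0 | ⟨n, hn⟩
    · rw [h0]; simp; positivity
    · obtain ⟨hn1, hn2⟩ := Finset.mem_filter.1 hn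
      obtain ⟨hn3, hn4⟩ := Finset.mem_Icc.1 hn1
      have hrM : r ≤ 2*M+1 := by
        have : r * n ≤ x := by rw [← hn2]; exact Nat.div_mul_le_self x n
        have h7 : r * (M+1) < 2*((M+1)*(M+1)) := by
          have : r * (M+1) ≤ r * (2*n) := Nat.mul_le_mul_left _ (by omega)
          nlinarith
        have : r < 2*(M+1) := by
          by_contra hc
          push Not at hc
          nlinarith
        omega
      have hrr : r*(r+1) ≤ 12*x := by nlinarith
      have hsub : (Finset.Icc (M+1-h) x).filter (fun n => x/n = r) ⊆ Finset.Ioc (x/(r+1)) (x/r) := by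
        intro m hm
        obtain ⟨hm1, hm2⟩ := Finset.mem_filter.1 hm
        obtain ⟨hm3, hm4⟩ := Finset.mem_Icc.1 hm1
        have hm0 : 0 < m := by omega
        have h8 : r * m ≤ x := by rw [← hm2]; exact Nat.div_mul_le_self x m
        have h9 : x < (r+1) * m := by
          rw [← hm2, mul_comm]; exact Nat.lt_mul_div_succ x hm0
        refine Finset.mem_Ioc.2 ⟨(Nat.div_lt_iff_lt_mul (by omega)).2 (by linarith [mul_comm m (r+1)]), (Nat.le_div_iff_mul_le hr1).2 (by linarith [mul_comm m r])⟩
      have hc := Finset.card_le_card hsub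
      rw [Nat.card_Ioc] at hc
      have hle : x/(r+1) ≤ x/r := Nat.div_le_div_left (by omega) hr1
      have hc' : (((Finset.Icc (M+1-h) x).filter (fun n => x/n = r)).card : ℝ) ≤ ((x/r : ℕ):ℝ) - ((x/(r+1) : ℕ):ℝ) := by
        rw [← Nat.cast_sub hle]; exact_mod_cast hc
      have h10 : ((x/r : ℕ):ℝ) ≤ x/r := Nat.cast_div_le
      have h11 : (x:ℝ)/(r+1) - 1 ≤ ((x/(r+1) : ℕ):ℝ) := by
        have h12 := Nat.lt_mul_div_succ x (b := r+1) (by omega)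
        have h12' : (x:ℝ) < (r+1) * (((x/(r+1) : ℕ):ℝ) + 1) := by exact_mod_cast h12
        rw [sub_le_iff_le_add, div_le_iff₀ (by positivity)]
        linarith
      have h13 : (1:ℝ) ≤ 12*x/((r:ℝ)*(r+1)) := by
        rw [one_le_div (by positivity)]; exact_mod_cast hrr
      have h14 : (x:ℝ)/r - x/(r+1) = x/((r:ℝ)*(r+1)) := by field_simp; ring
      have h15 : 13*(x:ℝ)/((r:ℝ)*(r+1)) = x/((r:ℝ)*(r+1)) + 12*x/((r:ℝ)*(r+1)) := by ring
      rw [h15]; linarith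
  calc _ ≤ 13*x/((r:ℝ)*(r+1)) * ‖S r‖^2 := by gcongr
    _ = _ := by ring

lemma tele {x M h i : ℕ} (hi : i < h) (hM : h ≤ M) :
    ∑ m ∈ Finset.Ioc M x, x/(m-i) ≤ ∑ m ∈ Finset.Ioc M x, x/m + h * (x/(M+1-h)) := by
  have hinj : Set.InjOn (fun p : ℕ => p - i) (Finset.Ioc M x : Set ℕ) := by
    intro p hp q hq hpq
    have hp := (Finset.mem_Ioc.1 hp).1
    have hq := (Finset.mem_Ioc.1 hq).1
    simp only at hpq
    omega
  rw [← Finset.sum_image (s := Finset.Ioc M x) (g := fun p : ℕ => p - i) (f := fun n => x/n) hinj]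
  have hsub : (Finset.Ioc M x).image (fun p : ℕ => p - i) ⊆ Finset.Ioc M x ∪ Finset.Ioc (M-i) M := by
    intro n hn
    obtain ⟨p, hp, rfl⟩ := Finset.mem_image.1 hn
    obtain ⟨hp3, hp4⟩ := Finset.mem_Ioc.1 hp
    simp only [Finset.mem_union, Finset.mem_Ioc]
    omega
  calc _ ≤ ∑ n ∈ Finset.Ioc M x ∪ Finset.Ioc (M-i) M, x/n := Finset.sum_le_sum_of_subset hsub
    _ = ∑ n ∈ Finset.Ioc M x, x/n + ∑ n ∈ Finset.Ioc (M-i) M, x/n := by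
        refine Finset.sum_union (Finset.disjoint_left.2 fun n h1 h2 => ?_)
        rw [Finset.mem_Ioc] at h1 h2; omega
    _ ≤ _ := by
        gcongr
        calc _ ≤ ∑ n ∈ Finset.Ioc (M-i) M, x/(M+1-h) := by
              refine Finset.sum_le_sum fun n hn => ?_
              rw [Finset.mem_Ioc] at hn
              exact Nat.div_le_div_left (by omega) (by omega)
          _ = i * (x/(M+1-h)) := by
              rw [Finset.sum_const, Nat.card_Ioc, smul_eq_mul]; congr 1; omega
          _ ≤ _ := Nat.mul_le_mul_right _ hi.le
end

noncomputable section
section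
variable {Ω : Type*} {m0 : MeasurableSpace Ω} {μ : Measure Ω} {f : Ω → ℕ → ℂ}

lemma diff_l2 [IsProbabilityMeasure μ] (hf : SN μ f) {a b : ℕ} (hab : a ≤ b) :
    Integrable (fun ω => ‖∑ m ∈ Finset.Icc 1 a, f ω m - ∑ m ∈ Finset.Icc 1 b, f ω m‖^2) μ ∧
    ∫ ω, ‖∑ m ∈ Finset.Icc 1 a, f ω m - ∑ m ∈ Finset.Icc 1 b, f ω m‖^2 ∂μ = (b:ℝ) - a := by
  have e : ∀ ω, ‖∑ m ∈ Finset.Icc 1 a, f ω m - ∑ m ∈ Finset.Icc 1 b, f ω m‖^2 =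
      ‖∑ m ∈ Finset.Ioc a b, f ω m‖^2 := by
    intro ω
    have : ∑ m ∈ Finset.Icc 1 b, f ω m = ∑ m ∈ Finset.Icc 1 a, f ω m + ∑ m ∈ Finset.Ioc a b, f ω m := by
      rw [← Finset.sum_union]
      · congr 1; ext m; simp only [Finset.mem_Icc, Finset.mem_union, Finset.mem_Ioc]; omega
      · refine Finset.disjoint_left.2 fun n h1 h2 => ?_
        rw [Finset.mem_Icc] at h1; rw [Finset.mem_Ioc] at h2; omega
    rw [this, sub_add_cancel_left, norm_neg]
  simp_rw [e]
  constructor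
  · refine Integrable.of_bound (C := ((b - a : ℕ):ℝ)^2) ?_ (Filter.Eventually.of_forall fun ω => ?_)
    · exact ((Finset.measurable_sum _ fun m _ => hf.meas m).norm.pow_const 2).aestronglyMeasurable
    · rw [Real.norm_of_nonneg (by positivity)]
      gcongr
      refine (norm_sum_le _ _).trans ?_
      calc _ ≤ ∑ m ∈ Finset.Ioc a b, (1:ℝ) := Finset.sum_le_sum fun m hm => by
            rw [hf.nrm ω m (by rw [Finset.mem_Ioc] at hm; omega)]
        _ = _ := by simp
  · rw [f_l2 hf _ (fun m hm => by rw [Finset.mem_Ioc] at hm; omega), Nat.card_Ioc, Nat.cast_sub hab]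

lemma Vst_eq (ω : Ω) (x : ℕ) : Vst f ω x =
    ∑ p ∈ (Finset.Ioc (Nat.sqrt x) x).filter Nat.Prime, ‖∑ m ∈ Finset.Icc 1 (x/p), f ω m‖^2 := by
  unfold Vst
  refine Finset.sum_congr ?_ fun p _ => by rw [Nat.floor_div_eq_div]
  ext p
  simp only [Finset.mem_filter, Finset.mem_Icc, Finset.mem_Ioc]
  constructor
  · rintro ⟨⟨h1, h2⟩, h3, h4⟩
    refine ⟨⟨?_, h2⟩, h3⟩
    rw [Real.sqrt_lt' (by exact_mod_cast h1)] at h4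
    rw [Nat.sqrt_lt']; exact_mod_cast h4
  · rintro ⟨⟨h1, h2⟩, h3⟩
    refine ⟨⟨by omega, h2⟩, h3, ?_⟩
    rw [Real.sqrt_lt' (by exact_mod_cast (by omega : 0 < p))]
    rw [Nat.sqrt_lt'] at h1; exact_mod_cast h1

theorem V_bound [IsProbabilityMeasure μ] (hf : SN μ f) :
    ∃ C : ℝ, 0 < C ∧ ∀ x : ℕ, 2^20 ≤ x → ∃ E : Ω → ℝ, (∀ ω, 0 ≤ E ω) ∧ Measurable E ∧
      ∫⁻ ω, ENNReal.ofReal (E ω) ∂μ ≤ ENNReal.ofReal (6 * (x:ℝ)^(-(1/10:ℝ))) ∧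
      ∀ ω, ENNReal.ofReal (Vst f ω x / x) ≤ ENNReal.ofReal C * Mk f (x+1) (1/2) ω + ENNReal.ofReal (E ω) := by
  obtain ⟨C, hC, HC⟩ := Zk_le_log
  refine ⟨1560*C, by positivity, fun x hx => ?_⟩
  have hx0 : (0:ℝ) < x := by exact_mod_cast (by omega : 0 < x)
  have hx20 : (2:ℝ)^20 ≤ x := by exact_mod_cast hx
  set z := ⌊(x:ℝ)^(1/20:ℝ)⌋₊ with hz
  have hz1 : (z:ℝ) ≤ (x:ℝ)^(1/20:ℝ) := Nat.floor_le (by positivity)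
  have hz2 : (x:ℝ)^(1/20:ℝ) < z + 1 := Nat.lt_floor_add_one _
  have hz3 : 2 ≤ z := by
    refine Nat.le_floor ?_
    calc ((2:ℕ):ℝ) = ((2:ℝ)^20)^(1/20:ℝ) := by
          rw [← Real.rpow_natCast, ← Real.rpow_mul (by norm_num)]; norm_num
      _ ≤ _ := by gcongr
  have hz20 : z^20 ≤ x := by
    have : (z:ℝ)^20 ≤ x := by
      calc (z:ℝ)^20 ≤ ((x:ℝ)^(1/20:ℝ))^20 := by gcongr
        _ = (x:ℝ) := by rw [← Real.rpow_natCast, ← Real.rpow_mul hx0.le]; norm_num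
    exact_mod_cast this
  set M := Nat.sqrt x with hM
  have hzM : z^10 ≤ M := by rw [hM, Nat.le_sqrt']; calc (z^10)^2 = z^20 := by ring
                               _ ≤ x := hz20
  set h := z^8 with hh
  have hh1 : 1 ≤ h := Nat.one_le_pow _ _ (by omega)
  have h2M : 2*h ≤ M := by
    refine le_trans ?_ hzM
    rw [hh, show z^10 = z^2 * z^8 by ring]
    exact Nat.mul_le_mul_right _ (by nlinarith)
  have hzleM : z ≤ M := le_trans (Nat.le_self_pow (by norm_num) z) hzM
  have hM1 : M*M ≤ x := Nat.sqrt_le x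
  have hM2 : x < (M+1)*(M+1) := Nat.lt_succ_sqrt x
  have hM3 : 1 ≤ M := by omega
  have hlz : 0 < Real.log (z+1) := Real.log_pos (by norm_cast; omega)
  have hlx : 0 < Real.log x := Real.log_pos (by linarith)
  have hlzx : Real.log x ≤ 20 * Real.log (z+1) := by
    have := Real.log_le_log (by positivity) hz2.le
    rw [Real.log_rpow hx0] at this; linarith
  have hh0 : (0:ℝ) < h := by exact_mod_cast hh1
  have hB : ∀ a : ℕ, (((Finset.range h).filter fun n => (a + n).Prime ∧ z < a + n).card : ℝ) ≤
      3*h/Real.log (z+1) := by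
    intro a
    refine (sieve_count (by omega) h a).trans ?_
    have hG : Real.log (z+1) ≤ 2 * Gz z := Gz_log
    have h1 : (h:ℝ)/Gz z ≤ 2*h/Real.log (z+1) := by
      rw [div_le_div_iff₀ (by linarith) hlz]; nlinarith
    have h2 : (z:ℝ)^4 ≤ h/Real.log (z+1) := by
      rw [le_div_iff₀ hlz, hh]
      have h3 : Real.log (z+1) ≤ z := by
        have := Real.log_le_sub_one_of_pos (show (0:ℝ) < z+1 by positivity); linarith
      have h4 : (z:ℝ) ≤ (z:ℝ)^4 := by exact_mod_cast Nat.le_self_pow (by norm_num) z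
      push_cast
      calc (z:ℝ)^4 * Real.log (z+1) ≤ (z:ℝ)^4 * (z:ℝ)^4 := by gcongr; linarith
        _ = _ := by ring
    calc _ ≤ 2*h/Real.log (z+1) + h/Real.log (z+1) := add_le_add h1 h2
      _ = _ := by ring
  set P := (Finset.Ioc M x).filter Nat.Prime with hP
  let D : ℕ → ℕ → Ω → ℝ := fun p i ω =>
    ‖∑ m ∈ Finset.Icc 1 (x/p), f ω m - ∑ m ∈ Finset.Icc 1 (x/(p-i)), f ω m‖^2
  have hpi : ∀ p ∈ Finset.Ioc M x, ∀ i ∈ Finset.range h, x/p ≤ x/(p-i) := by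
    intro p hp i hi
    rw [Finset.mem_Ioc] at hp; rw [Finset.mem_range] at hi
    exact Nat.div_le_div_left (by omega) (by omega)
  have hPs : P ⊆ Finset.Ioc M x := Finset.filter_subset _ _
  let E : Ω → ℝ := fun ω => 2/(h*x) * ∑ p ∈ P, ∑ i ∈ Finset.range h, D p i ω
  have hD : ∀ p ∈ Finset.Ioc M x, ∀ i ∈ Finset.range h, Integrable (D p i) μ ∧
      ∫ ω, D p i ω ∂μ = ((x/(p-i) : ℕ):ℝ) - ((x/p : ℕ):ℝ) :=
    fun p hp i hi => diff_l2 hf (hpi p hp i hi)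
  have hE0 : ∀ ω, 0 ≤ E ω := fun ω => by
    refine mul_nonneg (by positivity) (Finset.sum_nonneg fun p _ => Finset.sum_nonneg fun i _ => ?_)
    positivity
  have hDm : ∀ p i, Measurable (D p i) := fun p i =>
    ((Finset.measurable_sum _ fun m _ => hf.meas m).sub (Finset.measurable_sum _ fun m _ => hf.meas m)).norm.pow_const 2
  have hEm : Measurable E :=
    (Finset.measurable_sum _ fun p _ => Finset.measurable_sum _ fun i _ => hDm p i).const_mul _
  have hSi : ∀ p ∈ P, Integrable (fun ω => ∑ i ∈ Finset.range h, D p i ω) μ := fun p hp =>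
    integrable_finsetSum _ fun i hi => (hD p (hPs hp) i hi).1
  have hEi : Integrable E μ := (integrable_finsetSum _ hSi).const_mul _
  refine ⟨E, hE0, hEm, ?_, fun ω => ?_⟩
  · rw [← ofReal_integral_eq_lintegral_ofReal hEi (Filter.Eventually.of_forall hE0)]
    refine ENNReal.ofReal_le_ofReal ?_
    have e1 : ∫ ω, E ω ∂μ = 2/(h*x) * ∑ p ∈ P, ∑ i ∈ Finset.range h, (((x/(p-i) : ℕ):ℝ) - ((x/p : ℕ):ℝ)) := by
      simp only [E]
      rw [integral_const_mul, integral_finsetSum _ hSi]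
      congr 1
      refine Finset.sum_congr rfl fun p hp => ?_
      rw [integral_finsetSum _ fun i hi => (hD p (hPs hp) i hi).1]
      exact Finset.sum_congr rfl fun i hi => (hD p (hPs hp) i hi).2
    have e2 : ∑ p ∈ P, ∑ i ∈ Finset.range h, (((x/(p-i) : ℕ):ℝ) - ((x/p : ℕ):ℝ)) ≤
        h * (h * (3*M)) := by
      calc _ ≤ ∑ p ∈ Finset.Ioc M x, ∑ i ∈ Finset.range h, (((x/(p-i) : ℕ):ℝ) - ((x/p : ℕ):ℝ)) := by
            refine Finset.sum_le_sum_of_subset_of_nonneg hPs fun p hp _ => Finset.sum_nonneg fun i hi => ?_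
            rw [sub_nonneg]; exact_mod_cast hpi p hp i hi
        _ = ∑ i ∈ Finset.range h, ∑ p ∈ Finset.Ioc M x, (((x/(p-i) : ℕ):ℝ) - ((x/p : ℕ):ℝ)) := Finset.sum_comm
        _ ≤ ∑ i ∈ Finset.range h, ((h:ℝ) * (3*M)) := by
            refine Finset.sum_le_sum fun i hi => ?_
            have t := tele (x := x) (Finset.mem_range.1 hi) (by omega : h ≤ M)
            have t3 : x/(M+1-h) ≤ 3*M := by
              have : x/(M+1-h) < 2*(M+1) := by
                rw [Nat.div_lt_iff_lt_mul (by omega)]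
                have : (M+1)*(M+1) ≤ (M+1) * (2*(M+1-h)) := Nat.mul_le_mul_left _ (by omega)
                nlinarith
              omega
            have t2 : ∑ m ∈ Finset.Ioc M x, x/(m-i) ≤ ∑ m ∈ Finset.Ioc M x, x/m + h*(3*M) :=
              t.trans (Nat.add_le_add_left (Nat.mul_le_mul_left _ t3) _)
            rw [Finset.sum_sub_distrib, sub_le_iff_le_add']
            exact_mod_cast t2
        _ = _ := by simp
    rw [e1]
    have hMx : (M:ℝ) ≤ (x:ℝ)^(1/2:ℝ) := by
      rw [← Real.sqrt_eq_rpow]; exact Real.le_sqrt_of_sq_le (by rw [sq]; exact_mod_cast hM1)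
    have hhx : (h:ℝ) ≤ (x:ℝ)^(2/5:ℝ) := by
      rw [hh]; push_cast
      calc (z:ℝ)^8 ≤ ((x:ℝ)^(1/20:ℝ))^8 := by gcongr
        _ = _ := by rw [← Real.rpow_natCast, ← Real.rpow_mul hx0.le]; norm_num
    calc _ ≤ (2:ℝ)/((h:ℝ)*x) * ((h:ℝ) * ((h:ℝ) * (3*(M:ℝ)))) := by gcongr
      _ = 6 * ((h:ℝ) * M * (x:ℝ)^(-1:ℝ)) := by rw [Real.rpow_neg_one]; field_simp; ring
      _ ≤ 6 * ((x:ℝ)^(2/5:ℝ) * (x:ℝ)^(1/2:ℝ) * (x:ℝ)^(-1:ℝ)) := by gcongr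
      _ = _ := by rw [← Real.rpow_add hx0, ← Real.rpow_add hx0]; norm_num
  · set Q := ∑ r ∈ Finset.Icc 1 x, ‖∑ m ∈ Finset.Icc 1 r, f ω m‖^2/((r:ℝ)*(r+1)) with hQ
    have hQ0 : 0 ≤ Q := Finset.sum_nonneg fun r _ => by positivity
    have d1 := V_det1 (fun n => ∑ m ∈ Finset.Icc 1 n, f ω m) (x := x) hh1 (by omega) hzleM hB
    have d2 := V_det2 (fun n => ∑ m ∈ Finset.Icc 1 n, f ω m) h2M hM1 hM2 hM3
    have hV : Vst f ω x / x ≤ 1560/Real.log x * Q + E ω := by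
      rw [div_le_iff₀ hx0, Vst_eq]
      refine d1.trans ?_
      have e3 : 2/h * ∑ p ∈ P, ∑ i ∈ Finset.range h, D p i ω = E ω * x := by
        simp only [E]; field_simp
      have e4 : 2*(3*(h:ℝ)/Real.log (z+1))/h ≤ 120/Real.log x := by
        rw [div_le_div_iff₀ hh0 hlx, mul_div_assoc', div_mul_eq_mul_div, div_le_iff₀ hlz]
        nlinarith
      calc _ ≤ 120/Real.log x * (13*x*Q) + E ω * x := by
            refine add_le_add ?_ e3.le
            gcongr
        _ = _ := by ring
    have s1 := sum_le_Mk hf (Nat.lt_succ_self x) ω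
    have hZ : Zk (x+1) 1 ≤ 2*C*Real.log x := by
      refine (HC (x+1) (by omega)).trans ?_
      have : Real.log ((x+1:ℕ):ℝ) ≤ 2*Real.log x := by
        rw [← Real.log_rpow hx0]
        refine Real.log_le_log (by positivity) ?_
        rw [Real.rpow_two]; push_cast; nlinarith
      nlinarith
    calc _ ≤ ENNReal.ofReal (1560/Real.log x * Q + E ω) := ENNReal.ofReal_le_ofReal hV
      _ = ENNReal.ofReal (1560/Real.log x) * ENNReal.ofReal Q + ENNReal.ofReal (E ω) := by
          rw [ENNReal.ofReal_add (by positivity) (hE0 ω), ENNReal.ofReal_mul (by positivity)]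
      _ ≤ ENNReal.ofReal (1560/Real.log x) * (ENNReal.ofReal (Zk (x+1) 1 / (2*π)) * Mk f (x+1) (1/2) ω) + ENNReal.ofReal (E ω) := by
          gcongr
      _ ≤ _ := by
          rw [← mul_assoc, ← ENNReal.ofReal_mul (by positivity)]
          refine add_le_add ?_ le_rfl
          refine mul_le_mul_left (ENNReal.ofReal_le_ofReal ?_) _
          have hpi := Real.pi_gt_three
          rw [div_mul_div_comm, div_le_iff₀ (by positivity)]
          calc 1560 * Zk (x+1) 1 ≤ 1560 * (2*C*Real.log x) := by gcongr
            _ = 1560*C*(Real.log x*2) * 1 := by ring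
            _ ≤ 1560*C*(Real.log x*2) * π := by gcongr; linarith
            _ = _ := by ring
end
end

noncomputable section

section G1
variable {Ω : Type*} {m0 : MeasurableSpace Ω} {μ : Measure Ω} {f : Ω → ℕ → ℂ}

/-- The doubly logarithmic scale of `k`. -/
def jj (k : ℕ) : ℕ := Nat.log 2 (Nat.log 2 k)

/-- The shift attached to scale `j`. -/
def dl (j : ℕ) : ℝ := (1/2:ℝ)^j/4

theorem dl_pos (j : ℕ) : 0 < dl j := by unfold dl; positivity
theorem dl_le (j : ℕ) : dl j ≤ 1/4 := by
  unfold dl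
  have : (1/2:ℝ)^j ≤ 1 := pow_le_one₀ (by norm_num) (by norm_num)
  linarith

theorem jj_zero : jj 0 = 0 := by simp [jj]
theorem jj_mono : Monotone jj := fun _ _ h => Nat.log_mono_right (Nat.log_mono_right h)

theorem natlog_succ_le (k : ℕ) : Nat.log 2 (k+1) ≤ Nat.log 2 k + 1 := by
  rcases Nat.eq_zero_or_pos k with h | h
  · subst h; simp
  calc Nat.log 2 (k+1) ≤ Nat.log 2 (k*2) := Nat.log_mono_right (by omega)
    _ = _ := Nat.log_mul_base (by norm_num) (by omega)

theorem jj_succ (k : ℕ) : jj (k+1) ≤ jj k + 1 :=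
  (Nat.log_mono_right (natlog_succ_le k)).trans (natlog_succ_le _)

/-- `log k` is at most `2 ^ (j+1) log 2`. -/
theorem jj_upper (k : ℕ) : Real.log (k+1) ≤ 2^(jj k + 1) * Real.log 2 := by
  have h1 : k + 1 ≤ 2^(Nat.log 2 k + 1) := Nat.lt_pow_succ_log_self (by norm_num) k
  have h2 : Nat.log 2 k + 1 ≤ 2^(jj k + 1) := Nat.lt_pow_succ_log_self (by norm_num) _
  have h3 : ((k:ℝ)+1) ≤ 2^(Nat.log 2 k + 1) := by exact_mod_cast h1
  have h4 : ((Nat.log 2 k + 1 : ℕ):ℝ) ≤ 2^(jj k + 1) := by exact_mod_cast h2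
  have hl : 0 ≤ Real.log 2 := Real.log_nonneg (by norm_num)
  calc Real.log (k+1) ≤ Real.log (2^(Nat.log 2 k + 1)) := Real.log_le_log (by positivity) h3
    _ = ((Nat.log 2 k + 1 : ℕ):ℝ) * Real.log 2 := by rw [Real.log_pow]
    _ ≤ _ := by gcongr

theorem jj_lower {k : ℕ} (hk : 2 ≤ k) : 2^(jj k) * Real.log 2 ≤ Real.log k := by
  have h1 : 2^(Nat.log 2 k) ≤ k := Nat.pow_log_le_self 2 (by omega)
  have h0 : Nat.log 2 k ≠ 0 := (Nat.log_pos (by norm_num) hk).ne'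
  have h2 : 2^(jj k) ≤ Nat.log 2 k := Nat.pow_log_le_self 2 h0
  have h3 : (2:ℝ)^(Nat.log 2 k) ≤ k := by exact_mod_cast h1
  have h4 : (2:ℝ)^(jj k) ≤ (Nat.log 2 k : ℕ) := by exact_mod_cast h2
  have hl : 0 ≤ Real.log 2 := Real.log_nonneg (by norm_num)
  calc 2^(jj k) * Real.log 2 ≤ (Nat.log 2 k : ℕ) * Real.log 2 := by gcongr
    _ = Real.log (2^(Nat.log 2 k)) := by rw [Real.log_pow]
    _ ≤ _ := Real.log_le_log (by positivity) h3

theorem dl_log {k : ℕ} : 2 * dl (jj k) * Real.log k ≤ 1 := by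
  have h := jj_upper k
  have h2 : Real.log k ≤ Real.log (k+1) := by
    rcases Nat.eq_zero_or_pos k with h | h
    · subst h; simp
    · exact Real.log_le_log (by exact_mod_cast h) (by linarith)
  have hl : Real.log 2 ≤ 1 := by linarith [Real.log_two_lt_d9]
  have e : (1/2:ℝ)^(jj k) * 2^(jj k) = 1 := by rw [← mul_pow]; norm_num
  calc 2 * dl (jj k) * Real.log k ≤ 2 * dl (jj k) * (2^(jj k + 1) * Real.log 2) := by
        have := dl_pos (jj k); gcongr; linarith
    _ = ((1/2:ℝ)^(jj k) * 2^(jj k)) * Real.log 2 := by unfold dl; rw [pow_succ]; ring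
    _ ≤ 1 := by rw [e]; linarith

theorem jj_primes (k : ℕ) : Real.log 2 * jj k - 5 ≤ ∑ p ∈ k.primesBelow, (1/p:ℝ) := by
  have hs : 0 ≤ ∑ p ∈ k.primesBelow, (1/p:ℝ) := Finset.sum_nonneg fun _ _ => by positivity
  by_cases hk : 2 ≤ k
  · have h1 := sum_inv_primes k hk
    have h2 := jj_lower hk
    have hl : 0 < Real.log 2 := Real.log_pos (by norm_num)
    have h3 := Real.log_le_log (by positivity) h2
    rw [Real.log_mul (by positivity) hl.ne', Real.log_pow] at h3
    have h4 : -1 ≤ Real.log (Real.log 2) := by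
      rw [Real.le_log_iff_exp_le hl]
      have := Real.exp_neg_one_lt_d9
      linarith [Real.log_two_gt_d9]
    linarith
  · have : jj k = 0 := by interval_cases k <;> simp [jj]
    rw [this]; push_cast; linarith

theorem exp_W (hf : SN μ f) (k : ℕ) (ω : Ω) {s : ℂ} (hs : s.re = 1/2) :
    Real.exp (2 * ∑ p ∈ k.primesBelow, yw ((p:ℂ)^(-s)) (f ω p)) * Zk k 1 = Dk f k s ω := by
  unfold Zk Dk
  rw [Finset.mul_sum, Real.exp_sum, ← Finset.prod_mul_distrib]
  refine Finset.prod_congr rfl fun p hp => ?_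
  have hpp := Nat.prime_of_mem_primesBelow hp
  have hn : ‖(p:ℂ)^(-s)‖ < 1 := coef_lt hpp (by rw [hs]; norm_num)
  have hn2 : ‖(p:ℂ)^(-s)‖^2 = (p:ℝ)^(-(1:ℝ)) := by
    rw [coef_norm hpp, hs, ← Real.rpow_natCast, ← Real.rpow_mul (by positivity)]; norm_num
  have hz : ‖f ω p‖ = 1 := hf.nrm ω p hpp.one_le
  have h1 : 0 < ‖1 - (p:ℂ)^(-s) * f ω p‖ := by
    refine norm_pos_iff.2 fun h => ?_
    have : ‖(p:ℂ)^(-s) * f ω p‖ = 1 := by rw [← sub_eq_zero.1 h]; simp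
    rw [norm_mul, hz, mul_one] at this; linarith
  have h2 : 0 < 1 - ‖(p:ℂ)^(-s)‖^2 := by nlinarith [norm_nonneg ((p:ℂ)^(-s))]
  unfold yw pw
  rw [← hn2, mul_add, Real.exp_add, two_mul, two_mul, Real.exp_add, Real.exp_add, Real.exp_neg,
    Real.exp_log h1, Real.exp_log h2]
  field_simp

theorem W_bound : ∃ C : ℝ, 4 ≤ C ∧ ∀ {Ω : Type*} {m0 : MeasurableSpace Ω} {μ : Measure Ω}
    {f : Ω → ℕ → ℂ} (_ : SN μ f) (k : ℕ) (_ : 2 ≤ k) (ω : Ω) (s : ℂ) (_ : s.re = 1/2) (lam : ℝ)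
    (_ : 1 ≤ lam) (_ : Mk f k (1/2 - dl (jj k)) ω ≤ ENNReal.ofReal (lam * (1 + jj k)^2)),
    ∑ p ∈ k.primesBelow, yw ((p:ℂ)^(-s)) (f ω p) ≤
      1/2 * Real.log (C * lam * ‖s‖^2) + Real.log (1 + jj k) := by
  set CZ := Real.exp (4*Real.exp 1*(3*1)) with hCZ
  have hCZ1 : 1 ≤ CZ := Real.one_le_exp (by positivity)
  refine ⟨4*CZ, by linarith, ?_⟩
  intro Ω m0 μ f hf k hk ω s hs lam hlam hM
  have hd := dl_pos (jj k)
  have hd4 := dl_le (jj k)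
  have hlk : 0 < Real.log k := Real.log_pos (by exact_mod_cast hk)
  have e := euler_sup hf k ω hd (by linarith) hs
  have hs0 : 0 < ‖s‖ := norm_pos_iff.2 fun h => by rw [h] at hs; norm_num at hs
  have hZ : Zk k (1-2*dl (jj k)) ≤ CZ * Zk k 1 := by
    have hdl := dl_log (k := k)
    exact Zk_compare hk (by linarith) (by linarith) (by linarith) (by linarith) (by linarith)
  have hZ1 := Zk_pos k (a := 1) one_pos
  have hZ0 := Zk_pos k (a := 1-2*dl (jj k)) (by linarith)
  have hW := exp_W hf k ω hs
  set W := ∑ p ∈ k.primesBelow, yw ((p:ℂ)^(-s)) (f ω p) with hWd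
  have e2 : Zk k 1 * Dk f k s ω ≤
      (‖s‖^2/(4*π*dl (jj k)) * Zk k (1-2*dl (jj k))) * (lam * (1 + jj k)^2) := by
    refine (ENNReal.ofReal_le_ofReal_iff (by positivity)).1 (e.trans ?_)
    rw [ENNReal.ofReal_mul (p := ‖s‖^2/(4*π*dl (jj k)) * Zk k (1-2*dl (jj k))) (by positivity)]
    exact mul_le_mul' le_rfl hM
  have e3 : Zk k 1 * Dk f k s ω ≤
      (‖s‖^2/(4*π*dl (jj k)) * (CZ * Zk k 1)) * (lam * (1 + jj k)^2) := e2.trans (by gcongr)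
  have e4 : Dk f k s ω ≤ ‖s‖^2/(4*π*dl (jj k)) * CZ * (lam * (1 + jj k)^2) := by
    refine le_of_mul_le_mul_left (e3.trans (le_of_eq ?_)) hZ1
    ring
  have e5 : 1/(4*π*dl (jj k)) ≤ 4 * Real.log k := by
    have h1 := jj_lower hk
    have h2 : (1/2:ℝ)^(jj k) * 2^(jj k) = 1 := by rw [← mul_pow]; norm_num
    rw [div_le_iff₀ (by positivity)]
    unfold dl
    have hp : (0:ℝ) < (1/2:ℝ)^(jj k) := by positivity
    have h3 : Real.log 2 ≤ (1/2:ℝ)^(jj k) * Real.log k := by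
      calc Real.log 2 = (1/2:ℝ)^(jj k) * (2^(jj k) * Real.log 2) := by rw [← mul_assoc, h2, one_mul]
        _ ≤ _ := by gcongr
    have := Real.log_two_gt_d9
    have hpi := Real.pi_gt_three
    nlinarith
  have e6 : Real.exp (2*W) * Zk k 1 ≤ (4*CZ*lam*‖s‖^2) * (1+jj k)^2 * Zk k 1 := by
    rw [hW]
    calc _ ≤ (1/(4*π*dl (jj k))) * ‖s‖^2 * CZ * (lam * (1 + jj k)^2) := e4.trans (le_of_eq (by ring))
      _ ≤ (4 * Zk k 1) * ‖s‖^2 * CZ * (lam * (1 + jj k)^2) := by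
          have : 1/(4*π*dl (jj k)) ≤ 4 * Zk k 1 := e5.trans (by linarith [Zk_ge_log (k := k)])
          gcongr
      _ = _ := by ring
  have e7 : Real.exp (2*W) ≤ (4*CZ*lam*‖s‖^2) * (1+jj k)^2 := le_of_mul_le_mul_right e6 hZ1
  have e8 := Real.log_le_log (Real.exp_pos _) e7
  rw [Real.log_exp, Real.log_mul (by positivity) (by positivity), Real.log_pow] at e8
  push_cast at e8
  linarith
end G1
end

noncomputable section

section G2
variable {Ω : Type*} {m0 : MeasurableSpace Ω} {μ : Measure Ω} {f : Ω → ℕ → ℂ}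

/-- The good event controlling all scales up to `k0`. -/
def goodA (f : Ω → ℕ → ℂ) (k0 : ℕ) (lam : ℝ) : Set Ω :=
  {ω | ∀ k, k ≤ k0 → 2 ≤ k → Mk f k (1/2 - dl (jj k)) ω ≤ ENNReal.ofReal (lam * (1 + jj k)^2)}

theorem goodA_meas (k0 : ℕ) (lam : ℝ) : MeasurableSet[fil f k0] (goodA f k0 lam) := by
  unfold goodA
  simp only [Set.setOf_forall]
  refine MeasurableSet.iInter fun k => MeasurableSet.iInter fun hk => MeasurableSet.iInter fun _ => ?_
  have h : MeasurableSet[fil f k] {ω | Mk f k (1/2 - dl (jj k)) ω ≤ ENNReal.ofReal (lam * (1 + jj k)^2)} :=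
    Mk_meas k _ measurableSet_Iic
  exact fil_mono hk _ h

theorem goodA_compl [IsProbabilityMeasure μ] (hf : SN μ f) : ∃ C : ℝ, 0 < C ∧ ∀ (k0 : ℕ) (lam : ℝ),
    1 ≤ lam → μ (goodA f k0 lam)ᶜ ≤ ENNReal.ofReal (C / lam) := by
  have hsum : Summable fun j : ℕ => 4*π/(1+(j:ℝ))^2 := by
    have := (summable_nat_add_iff 1).2 (Real.summable_one_div_nat_pow.2 (by norm_num : 1 < 2))
    refine (this.mul_left (4*π)).congr fun j => ?_
    push_cast; rw [add_comm]; ring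
  have hpos : ∀ j : ℕ, 0 ≤ 4*π/(1+(j:ℝ))^2 := fun j => by positivity
  refine ⟨∑' j : ℕ, 4*π/(1+(j:ℝ))^2, hsum.tsum_pos hpos 0 (by positivity), fun k0 lam hlam => ?_⟩
  set U : ℕ → Set Ω := fun j => Set.univ ∩ {ω | ∃ k, 0 ≤ k ∧ k ≤ 0 + k0 ∧
    ENNReal.ofReal (lam * (1 + j)^2) < Mk f k (1/2 - dl j) ω} with hU
  have hsub : (goodA f k0 lam)ᶜ ⊆ ⋃ j, U j := by
    intro ω hω
    simp only [goodA, Set.mem_compl_iff, Set.mem_setOf_eq] at hω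
    push Not at hω
    obtain ⟨k, hk, _, h⟩ := hω
    exact Set.mem_iUnion.2 ⟨jj k, Set.mem_univ _, k, Nat.zero_le _, by omega, h⟩
  have hUj : ∀ j, μ (U j) ≤ ENNReal.ofReal (4*π/(1+(j:ℝ))^2/lam) := by
    intro j
    have hd := dl_pos j
    have hd4 := dl_le j
    have hl0 : 0 < lam * (1 + (j:ℝ))^2 := by positivity
    have h := Mk_doob hf.toIsSteinhausRMF (σ := 1/2 - dl j) (by linarith)
      (ENNReal.ofReal (lam * (1 + j)^2)) k0 0 (S := Set.univ) MeasurableSet.univ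
    rw [setLIntegral_univ, Mk_mean hf.toIsSteinhausRMF 0 (by linarith)] at h
    have h2 : μ (U j) ≤ ENNReal.ofReal (π/(1/2 - dl j)) / ENNReal.ofReal (lam * (1 + j)^2) := by
      rw [ENNReal.le_div_iff_mul_le (Or.inl (by simpa using hl0)) (Or.inl ENNReal.ofReal_ne_top), mul_comm]
      exact h
    refine h2.trans ?_
    rw [← ENNReal.ofReal_div_of_pos hl0]
    refine ENNReal.ofReal_le_ofReal ?_
    rw [div_div (4*π), mul_comm lam]
    have hp4 : π/(1/2 - dl j) ≤ 4*π := by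
      rw [div_le_iff₀ (by linarith)]
      nlinarith [Real.pi_pos]
    exact div_le_div_of_nonneg_right hp4 (by positivity)
  calc μ (goodA f k0 lam)ᶜ ≤ μ (⋃ j, U j) := measure_mono hsub
    _ ≤ ∑' j, μ (U j) := measure_iUnion_le _
    _ ≤ ∑' j : ℕ, ENNReal.ofReal (4*π/(1+(j:ℝ))^2/lam) := ENNReal.tsum_le_tsum hUj
    _ = ENNReal.ofReal (∑' j : ℕ, 4*π/(1+(j:ℝ))^2/lam) :=
        (ENNReal.ofReal_tsum_of_nonneg (fun j => by positivity) (hsum.div_const _)).symm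
    _ = _ := by rw [tsum_div_const]

theorem tail_int : Integrable fun t : ℝ => (1+t^2)^(-(3/4):ℝ) := by
  have h := integrable_rpow_neg_one_add_norm_sq (E := ℝ) (μ := volume) (r := 3/2) (by simp; norm_num)
  refine h.congr (Filter.Eventually.of_forall fun t => ?_)
  simp only [Real.norm_eq_abs, sq_abs]; norm_num

theorem Bt_bound {C lam t : ℝ} (hC : 4 ≤ C) (hlam : 1 ≤ lam) :
    (1 + 1/2 * Real.log (C * lam * (1/4+t^2))) / (1/4+t^2) ≤
      (4 * (3 + Real.log C)) * (1 + Real.log lam) * (1+t^2)^(-(3/4):ℝ) := by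
  have hu : (1:ℝ) ≤ 1+t^2 := by nlinarith
  have hlC : 0 ≤ Real.log C := Real.log_nonneg (by linarith)
  have hll : 0 ≤ Real.log lam := Real.log_nonneg hlam
  have h1 : Real.log (C * lam * (1/4+t^2)) ≤ Real.log C + Real.log lam + 4*(1+t^2)^(1/4:ℝ) := by
    rw [Real.log_mul (by positivity) (by positivity), Real.log_mul (by positivity) (by positivity)]
    have a1 : Real.log (1/4+t^2) ≤ Real.log (1+t^2) := Real.log_le_log (by positivity) (by linarith)
    have a2 := Real.log_le_rpow_div (x := 1+t^2) (by positivity) (ε := 1/4) (by norm_num)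
    linarith
  set w := (1+t^2)^(1/4:ℝ) with hw
  have hw1 : 1 ≤ w := Real.one_le_rpow hu (by norm_num)
  have h2 : 1 + 1/2 * Real.log (C * lam * (1/4+t^2)) ≤ (3 + Real.log C) * (1 + Real.log lam) * w := by
    have : 1 ≤ (1 + Real.log lam) * w := by nlinarith
    nlinarith [mul_nonneg hlC hll, mul_nonneg hlC (sub_nonneg.2 this), mul_nonneg hll (sub_nonneg.2 hw1)]
  have h3 : (1+t^2)^(-(3/4):ℝ) = w / (1+t^2) := by
    rw [hw, show (-(3/4):ℝ) = 1/4 - 1 by norm_num, Real.rpow_sub (by positivity), Real.rpow_one]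
  rw [h3, div_le_iff₀ (by positivity)]
  have h4 : 1 ≤ 4 * (1/4+t^2)/(1+t^2) := by rw [le_div_iff₀ (by positivity)]; nlinarith
  calc _ ≤ (3 + Real.log C) * (1 + Real.log lam) * w * 1 := by rw [mul_one]; exact h2
    _ ≤ (3 + Real.log C) * (1 + Real.log lam) * w * (4 * (1/4+t^2)/(1+t^2)) := by gcongr
    _ = _ := by ring

theorem goodA_mass [IsProbabilityMeasure μ] (hf : SN μ f) : ∃ C : ℝ, 0 < C ∧ ∀ (k0 : ℕ) (lam : ℝ),
    1 ≤ lam → ∫⁻ ω in goodA f k0 lam, Mk f k0 (1/2) ω ∂μ ≤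
      ENNReal.ofReal (C * (1 + Real.log lam) / √(1 + jj k0)) := by
  obtain ⟨C1, hC1, HW⟩ := W_bound
  obtain ⟨C2, hC2, HB⟩ := tilt_ballot (Real.log 2) 5 (Real.log_pos (by norm_num)) (by norm_num)
  set I := ∫ t : ℝ, (1+t^2)^(-(3/4):ℝ) with hI
  have hI0 : 0 ≤ I := integral_nonneg fun t => by positivity
  have hlC : 0 ≤ Real.log C1 := Real.log_nonneg (by linarith)
  refine ⟨C2 * (4 * (3 + Real.log C1)) * (I + 1), by positivity, fun k0 lam hlam => ?_⟩
  have hll : 0 ≤ Real.log lam := Real.log_nonneg hlam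
  set A := goodA f k0 lam with hA
  have hAm : MeasurableSet A := fil_le hf.toIsSteinhausRMF k0 _ (goodA_meas k0 lam)
  have hsq : 0 < √(1 + jj k0 : ℝ) := Real.sqrt_pos.2 (by positivity)
  -- pointwise tilt bound
  have htilt : ∀ t : ℝ, ∫⁻ ω in A, ENNReal.ofReal (Dk f k0 (((1/2:ℝ):ℂ) + t * Complex.I) ω) ∂μ ≤
      ENNReal.ofReal (C2 * (1 + 1/2 * Real.log (C1 * lam * (1/4+t^2))) / √(1 + jj k0 : ℝ)) := by
    intro t
    set s : ℂ := ((1/2:ℝ):ℂ) + t * Complex.I with hs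
    have hsre : s.re = 1/2 := by simp [hs]
    have hsn : ‖s‖^2 = 1/4 + t^2 := by
      rw [← Complex.normSq_eq_norm_sq, Complex.normSq_apply]; simp [hs]; ring
    have hB0 : 0 ≤ 1/2 * Real.log (C1 * lam * (1/4+t^2)) := by
      refine mul_nonneg (by norm_num) (Real.log_nonneg ?_)
      nlinarith [sq_nonneg t, mul_nonneg (by linarith : 0 ≤ C1 - 4) (by linarith : 0 ≤ lam), mul_nonneg (by positivity : 0 ≤ C1 * lam) (sq_nonneg t)]
    have hb := HB hf k0 s hsre _ hB0 jj jj_zero jj_mono jj_succ (fun k _ => jj_primes k)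
    haveI := tilt_prob hf k0 (s := s) (by rw [hsre]; norm_num)
    have hsub : A ⊆ {ω | ∀ i ≤ k0, ∑ p ∈ i.primesBelow, yw ((p : ℂ) ^ (-s)) (f ω p)
        ≤ 1/2 * Real.log (C1 * lam * (1/4+t^2)) + Real.log (1 + jj i)} := by
      intro ω hω i hi
      by_cases h2 : 2 ≤ i
      · rw [← hsn]
        exact HW hf i h2 ω s hsre lam hlam (hω i hi h2)
      · have : i.primesBelow = ∅ := by interval_cases i <;> decide
        rw [this, Finset.sum_empty]
        have : 0 ≤ Real.log (1 + jj i) := Real.log_nonneg (by simp)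
        linarith
    have h1 : (tilt μ f k0 s) A = ∫⁻ ω in A, ENNReal.ofReal (Dk f k0 s ω) ∂μ := by
      unfold tilt; rw [withDensity_apply _ hAm]
    rw [← h1, ← ENNReal.ofReal_toReal (measure_ne_top (tilt μ f k0 s) A)]
    exact ENNReal.ofReal_le_ofReal ((measureReal_mono hsub).trans hb)
  have hjm : Measurable (Function.uncurry fun (ω : Ω) (t : ℝ) =>
      ENNReal.ofReal (Dk f k0 (((1/2:ℝ):ℂ) + t * Complex.I) ω / ((1/2)^2+t^2))) := by
    have := (Dk_meas2 (f := f) k0 (1/2)).mono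
      (sup_le_sup (MeasurableSpace.comap_mono (fil_le hf.toIsSteinhausRMF k0)) le_rfl) le_rfl
    exact ENNReal.measurable_ofReal.comp (Measurable.div this (by fun_prop))
  calc ∫⁻ ω in A, Mk f k0 (1/2) ω ∂μ
      = ∫⁻ t : ℝ, ∫⁻ ω in A, ENNReal.ofReal (Dk f k0 (((1/2:ℝ):ℂ) + t * Complex.I) ω / ((1/2)^2+t^2)) ∂μ := by
        unfold Mk
        rw [lintegral_lintegral_swap]
        exact hjm.aemeasurable
    _ ≤ ∫⁻ t : ℝ, ENNReal.ofReal (C2 * (4 * (3 + Real.log C1)) * (1 + Real.log lam) / √(1 + jj k0 : ℝ) * (1+t^2)^(-(3/4):ℝ)) := by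
        refine lintegral_mono fun t => ?_
        have hq : (0:ℝ) < 1/4 + t^2 := by positivity
        have e : ∀ ω, ENNReal.ofReal (Dk f k0 (((1/2:ℝ):ℂ) + t * Complex.I) ω / ((1/2)^2+t^2)) =
            ENNReal.ofReal (1/(1/4+t^2)) * ENNReal.ofReal (Dk f k0 (((1/2:ℝ):ℂ) + t * Complex.I) ω) := by
          intro ω
          rw [← ENNReal.ofReal_mul (by positivity)]; congr 1; norm_num; ring
        simp_rw [e]
        rw [lintegral_const_mul' _ _ ENNReal.ofReal_ne_top]
        calc _ ≤ ENNReal.ofReal (1/(1/4+t^2)) * ENNReal.ofReal (C2 * (1 + 1/2 * Real.log (C1 * lam * (1/4+t^2))) / √(1 + jj k0 : ℝ)) := by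
              gcongr; exact htilt t
          _ = ENNReal.ofReal (C2 / √(1 + jj k0 : ℝ) * ((1 + 1/2 * Real.log (C1 * lam * (1/4+t^2))) / (1/4+t^2))) := by
              rw [← ENNReal.ofReal_mul (by positivity)]; congr 1; ring
          _ ≤ _ := by
              refine ENNReal.ofReal_le_ofReal ?_
              calc _ ≤ C2 / √(1 + jj k0 : ℝ) * ((4 * (3 + Real.log C1)) * (1 + Real.log lam) * (1+t^2)^(-(3/4):ℝ)) :=
                    mul_le_mul_of_nonneg_left (Bt_bound hC1 hlam) (by positivity)
                _ = _ := by ring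
    _ = ENNReal.ofReal (∫ t : ℝ, C2 * (4 * (3 + Real.log C1)) * (1 + Real.log lam) / √(1 + jj k0 : ℝ) * (1+t^2)^(-(3/4):ℝ)) :=
        (ofReal_integral_eq_lintegral_ofReal (tail_int.const_mul _) (Filter.Eventually.of_forall fun t => by positivity)).symm
    _ ≤ _ := by
        refine ENNReal.ofReal_le_ofReal ?_
        rw [integral_const_mul, ← hI]
        calc _ ≤ C2 * (4 * (3 + Real.log C1)) * (1 + Real.log lam) / √(1 + jj k0 : ℝ) * (I+1) := by gcongr; linarith
          _ = _ := by ring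

/-- Maximal bound for the mass after `k0`. -/
theorem mass_max [IsProbabilityMeasure μ] (hf : SN μ f) : ∃ C : ℝ, 0 < C ∧ ∀ (k0 n : ℕ) (lam τ : ℝ),
    1 ≤ lam → 0 < τ → μ {ω | ∃ k, k0 ≤ k ∧ k ≤ k0 + n ∧ ENNReal.ofReal τ < Mk f k (1/2) ω} ≤
      ENNReal.ofReal (C / lam + C * (1 + Real.log lam) / (τ * √(1 + jj k0))) := by
  obtain ⟨C1, hC1, H1⟩ := goodA_compl hf
  obtain ⟨C2, hC2, H2⟩ := goodA_mass hf
  refine ⟨C1 + C2, by positivity, fun k0 n lam τ hlam hτ => ?_⟩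
  have hll : 0 ≤ Real.log lam := Real.log_nonneg hlam
  set S := {ω | ∃ k, k0 ≤ k ∧ k ≤ k0 + n ∧ ENNReal.ofReal τ < Mk f k (1/2) ω} with hS
  have hd := Mk_doob hf.toIsSteinhausRMF (σ := 1/2) (by norm_num) (ENNReal.ofReal τ) n k0 (goodA_meas k0 lam)
  have h2 : μ (goodA f k0 lam ∩ S) ≤ ENNReal.ofReal (C2 * (1 + Real.log lam) / (τ * √(1 + jj k0))) := by
    have : μ (goodA f k0 lam ∩ S) ≤ ENNReal.ofReal (C2 * (1 + Real.log lam) / √(1 + jj k0)) / ENNReal.ofReal τ := by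
      rw [ENNReal.le_div_iff_mul_le (Or.inl (by simpa using hτ)) (Or.inl ENNReal.ofReal_ne_top), mul_comm]
      exact hd.trans (H2 k0 lam hlam)
    refine this.trans (le_of_eq ?_)
    rw [← ENNReal.ofReal_div_of_pos hτ, div_div, mul_comm τ]
  calc μ S ≤ μ ((goodA f k0 lam)ᶜ ∪ (goodA f k0 lam ∩ S)) := measure_mono fun ω hω => by
        by_cases h : ω ∈ goodA f k0 lam
        · exact Or.inr ⟨h, hω⟩
        · exact Or.inl h
    _ ≤ _ := measure_union_le _ _
    _ ≤ ENNReal.ofReal (C1/lam) + ENNReal.ofReal (C2 * (1 + Real.log lam) / (τ * √(1 + jj k0))) :=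
        add_le_add (H1 k0 lam hlam) h2
    _ = ENNReal.ofReal (C1/lam + C2 * (1 + Real.log lam) / (τ * √(1 + jj k0))) :=
        (ENNReal.ofReal_add (by positivity) (by positivity)).symm
    _ ≤ _ := by
        refine ENNReal.ofReal_le_ofReal ?_
        gcongr <;> linarith
end G2
end

noncomputable section

section G3
variable {Ω : Type*} {m0 : MeasurableSpace Ω} {μ : Measure Ω} {f : Ω → ℕ → ℂ}

theorem tp_lower (ε : ℝ) (i : ℕ) : Real.exp ((i:ℝ)^ε) / 2 ≤ testPoint ε i := by
  unfold testPoint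
  have h1 : (1:ℝ) ≤ Real.exp ((i:ℝ)^ε) := Real.one_le_exp (by positivity)
  have h2 : 1 ≤ ⌊Real.exp ((i:ℝ)^ε)⌋₊ := Nat.le_floor (by simpa using h1)
  have h3 := Nat.lt_floor_add_one (Real.exp ((i:ℝ)^ε))
  have h4 : (1:ℝ) ≤ (⌊Real.exp ((i:ℝ)^ε)⌋₊ : ℝ) := by exact_mod_cast h2
  linarith

/-- The error sums converge. -/
theorem tp_summable {ε : ℝ} (hε : 0 < ε) :
    Summable fun i : ℕ => ((testPoint ε i : ℕ):ℝ)^(-(1/20):ℝ) := by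
  set n := ⌈2/ε⌉₊ with hn
  have hn2 : 2 ≤ ε * n := by
    have := Nat.le_ceil (2/ε)
    rw [div_le_iff₀ hε] at this; linarith
  rw [← summable_nat_add_iff 1]
  have hs := (summable_nat_add_iff 1).2 (Real.summable_one_div_nat_pow.2 (by norm_num : 1 < 2))
  refine Summable.of_nonneg_of_le (fun i => by positivity) (fun i => ?_)
    (hs.mul_left ((2:ℝ) * ((n.factorial : ℝ) * 20^n)))
  set a : ℝ := ((i+1:ℕ):ℝ) with ha
  have ha1 : 1 ≤ a := by rw [ha]; push_cast; linarith [(Nat.cast_nonneg i : (0:ℝ) ≤ i)]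
  have hl := tp_lower ε (i+1)
  rw [← ha] at hl
  have hu : 0 < a^ε := by positivity
  have h1 : ((testPoint ε (i+1) : ℕ):ℝ)^(-(1/20):ℝ) ≤ (Real.exp (a^ε)/2)^(-(1/20):ℝ) :=
    Real.rpow_le_rpow_of_nonpos (by positivity) hl (by norm_num)
  have h2 : (Real.exp (a^ε)/2)^(-(1/20):ℝ) ≤ 2 * Real.exp (-(a^ε/20)) := by
    rw [Real.div_rpow (by positivity) (by norm_num), ← Real.exp_mul, Real.rpow_neg (by norm_num : (0:ℝ) ≤ 2), div_inv_eq_mul, mul_comm]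
    have : (2:ℝ)^(1/20:ℝ) ≤ 2 := by
      calc (2:ℝ)^(1/20:ℝ) ≤ 2^(1:ℝ) := Real.rpow_le_rpow_of_exponent_le (by norm_num) (by norm_num)
        _ = 2 := Real.rpow_one 2
    rw [show a^ε * (-(1/20):ℝ) = -(a^ε/20) by ring]
    gcongr
  have h3 := Real.pow_div_factorial_le_exp (a^ε/20) (by positivity) n
  have h4 : Real.exp (-(a^ε/20)) ≤ n.factorial * 20^n * (1/a^2) := by
    rw [Real.exp_neg]
    have hp : a^2 ≤ (a^ε)^n := by
      rw [← Real.rpow_natCast, ← Real.rpow_natCast, ← Real.rpow_mul (by positivity)]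
      exact Real.rpow_le_rpow_of_exponent_le ha1 (by exact_mod_cast hn2)
    have h5 : a^2/(20^n*n.factorial) ≤ Real.exp (a^ε/20) := by
      refine le_trans ?_ h3
      rw [div_pow, div_div]
      gcongr
    calc (Real.exp (a^ε/20))⁻¹ ≤ (a^2/(20^n*n.factorial))⁻¹ := by gcongr
      _ = _ := by rw [inv_div]; ring
  calc _ ≤ 2 * Real.exp (-(a^ε/20)) := h1.trans h2
    _ ≤ 2 * (n.factorial * 20^n * (1/a^2)) := by gcongr
    _ = _ := by ring

theorem sqrt_loglog_le {x : ℝ} (hx : 3 ≤ x) : √(Real.log (Real.log x)) ≤ 20 * x^(1/20:ℝ) := by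
  have h1 : 1 ≤ Real.log x := by
    rw [Real.le_log_iff_exp_le (by linarith)]; linarith [Real.exp_one_lt_d9]
  have h2 : Real.log (Real.log x) ≤ Real.log x := (Real.log_le_sub_one_of_pos (by linarith)).trans (by linarith)
  have h3 := Real.log_le_rpow_div (x := x) (by linarith) (ε := 1/20) (by norm_num)
  calc √(Real.log (Real.log x)) ≤ Real.log x := Real.sqrt_le_iff.2 ⟨by linarith, by nlinarith⟩
    _ ≤ _ := by linarith

theorem E_event [IsProbabilityMeasure μ] {ε : ℝ} (hε : 0 < ε) (E : ℕ → Ω → ℝ)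
    (hE0 : ∀ x ω, 0 ≤ E x ω) (hEm : ∀ x, Measurable (E x))
    (hEi : ∀ x : ℕ, 2^20 ≤ x → ∫⁻ ω, ENNReal.ofReal (E x ω) ∂μ ≤ ENNReal.ofReal (6*(x:ℝ)^(-(1/10):ℝ))) :
    ∃ C : ℝ, 0 < C ∧ ∀ T : ℝ, 1 ≤ T → μ {ω | ∃ i, 2^20 ≤ testPoint ε i ∧
      T/2 < E (testPoint ε i) ω * √(Real.log (Real.log (testPoint ε i)))} ≤ ENNReal.ofReal (C/T) := by
  have hs := tp_summable hε
  have h0 : ∀ i : ℕ, 0 ≤ ((testPoint ε i : ℕ):ℝ)^(-(1/20):ℝ) := fun i => by positivity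
  refine ⟨240 * (∑' i : ℕ, ((testPoint ε i : ℕ):ℝ)^(-(1/20):ℝ)) + 1, ?_, fun T hT => ?_⟩
  · have : 0 ≤ ∑' i : ℕ, ((testPoint ε i : ℕ):ℝ)^(-(1/20):ℝ) := tsum_nonneg h0
    positivity
  have hT0 : 0 < T := by linarith
  have hi : ∀ i, μ {ω | 2^20 ≤ testPoint ε i ∧
      T/2 < E (testPoint ε i) ω * √(Real.log (Real.log (testPoint ε i)))} ≤
      ENNReal.ofReal (240/T * ((testPoint ε i : ℕ):ℝ)^(-(1/20):ℝ)) := by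
    intro i
    set x := testPoint ε i with hx
    by_cases h20 : 2^20 ≤ x
    swap
    · have : {ω | 2^20 ≤ x ∧ T/2 < E x ω * √(Real.log (Real.log x))} = ∅ :=
        Set.eq_empty_of_forall_notMem fun ω hω => h20 hω.1
      rw [this, measure_empty]; exact zero_le
    have hx20 : (2:ℝ)^20 ≤ x := by exact_mod_cast h20
    have hx0 : (0:ℝ) < x := by linarith [(by norm_num : (0:ℝ) < 2^20)]
    have hsl := sqrt_loglog_le (x := x) (by linarith [(by norm_num : (3:ℝ) ≤ 2^20)])
    set c : ℝ := T / (40 * (x:ℝ)^(1/20:ℝ)) with hc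
    have hc0 : 0 < c := by positivity
    have hsub : {ω | 2^20 ≤ x ∧ T/2 < E x ω * √(Real.log (Real.log x))} ⊆
        {ω | ENNReal.ofReal c ≤ ENNReal.ofReal (E x ω)} := by
      rintro ω ⟨_, hω⟩
      refine ENNReal.ofReal_le_ofReal ?_
      rw [hc, div_le_iff₀ (by positivity)]
      have := mul_le_mul_of_nonneg_left hsl (hE0 x ω)
      linarith
    have hmk := mul_meas_ge_le_lintegral (μ := μ) (f := fun ω => ENNReal.ofReal (E x ω))
      (ENNReal.measurable_ofReal.comp (hEm x)) (ENNReal.ofReal c)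
    have : μ {ω | ENNReal.ofReal c ≤ ENNReal.ofReal (E x ω)} ≤
        ENNReal.ofReal (6*(x:ℝ)^(-(1/10):ℝ)) / ENNReal.ofReal c := by
      rw [ENNReal.le_div_iff_mul_le (Or.inl (by simpa using hc0)) (Or.inl ENNReal.ofReal_ne_top), mul_comm]
      exact hmk.trans (hEi x h20)
    refine (measure_mono hsub).trans (this.trans (le_of_eq ?_))
    rw [← ENNReal.ofReal_div_of_pos hc0]
    congr 1
    have e : (x:ℝ)^(-(1/20):ℝ) = (x:ℝ)^(-(1/10):ℝ) * (x:ℝ)^(1/20:ℝ) := by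
      rw [← Real.rpow_add hx0]; norm_num
    rw [e, hc]
    field_simp
    norm_num
  calc μ {ω | ∃ i, 2^20 ≤ testPoint ε i ∧
        T/2 < E (testPoint ε i) ω * √(Real.log (Real.log (testPoint ε i)))}
      ≤ μ (⋃ i, {ω | 2^20 ≤ testPoint ε i ∧
        T/2 < E (testPoint ε i) ω * √(Real.log (Real.log (testPoint ε i)))}) :=
        measure_mono fun ω ⟨i, hω⟩ => Set.mem_iUnion.2 ⟨i, hω⟩
    _ ≤ ∑' i, _ := measure_iUnion_le _
    _ ≤ ∑' i, ENNReal.ofReal (240/T * ((testPoint ε i : ℕ):ℝ)^(-(1/20):ℝ)) := ENNReal.tsum_le_tsum hi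
    _ = ENNReal.ofReal (∑' i, 240/T * ((testPoint ε i : ℕ):ℝ)^(-(1/20):ℝ)) :=
        (ENNReal.ofReal_tsum_of_nonneg (fun i => mul_nonneg (by positivity) (h0 i)) (hs.mul_left _)).symm
    _ ≤ _ := by
        refine ENNReal.ofReal_le_ofReal ?_
        rw [tsum_mul_left, add_div, div_mul_eq_mul_div]
        have : 0 < 1/T := by positivity
        linarith

/-- `1 + j` dominates the exponent at `k0 = ⌊X⌋`. -/
theorem jj_floor {N : ℝ} : N ≤ 1 + jj ⌊Real.exp ((2:ℝ)^N)⌋₊ := by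
  set k := ⌊Real.exp ((2:ℝ)^N)⌋₊ with hk
  have h1 : Real.exp ((2:ℝ)^N) ≤ (k:ℝ)+1 := (Nat.lt_floor_add_one _).le
  have h2 := Real.log_le_log (Real.exp_pos _) h1
  rw [Real.log_exp] at h2
  have h3 := h2.trans (jj_upper k)
  have hl : Real.log 2 ≤ 1 := by linarith [Real.log_two_lt_d9]
  have h4 : (2:ℝ)^N ≤ (2:ℝ)^((jj k + 1 : ℕ):ℝ) := by
    rw [Real.rpow_natCast]
    exact h3.trans (by nlinarith [(by positivity : (0:ℝ) < 2^(jj k + 1))])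
  have h5 := (Real.rpow_le_rpow_left_iff (by norm_num : (1:ℝ) < 2)).1 h4
  push_cast at h5; linarith

theorem final_SN [IsProbabilityMeasure μ] (hf : SN μ f) {ε : ℝ} (hε : 0 < ε) :
    ∃ C : ℝ, 0 < C ∧ ∃ L : ℕ, ∀ ℓ : ℕ, L ≤ ℓ → 2 ≤ ℓ → ∀ T : ℝ, 1 ≤ T →
      μ {ω | ¬ ∀ i : ℕ, 1 ≤ i → Xpt ε ((ℓ:ℝ) - 1) < (testPoint ε i : ℝ) →
        (testPoint ε i : ℝ) ≤ Xpt ε (ℓ:ℝ) →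
        Vst f ω (testPoint ε i) * √(Real.log (Real.log (testPoint ε i))) / (testPoint ε i : ℝ) ≤ T} ≤
      ENNReal.ofReal (C * T^(-(1/4:ℝ))) := by
  obtain ⟨CV, hCV, HV⟩ := V_bound hf
  have HV' : ∀ x : ℕ, ∃ E : Ω → ℝ, (∀ ω, 0 ≤ E ω) ∧ Measurable E ∧ (2^20 ≤ x →
      ∫⁻ ω, ENNReal.ofReal (E ω) ∂μ ≤ ENNReal.ofReal (6*(x:ℝ)^(-(1/10:ℝ))) ∧
      ∀ ω, ENNReal.ofReal (Vst f ω x / x) ≤ ENNReal.ofReal CV * Mk f (x+1) (1/2) ω + ENNReal.ofReal (E ω)) := by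
    intro x
    by_cases h : 2^20 ≤ x
    · obtain ⟨E, h1, h2, h3, h4⟩ := HV x h
      exact ⟨E, h1, h2, fun _ => ⟨h3, h4⟩⟩
    · exact ⟨fun _ => 0, fun _ => le_rfl, measurable_const, fun h' => absurd h' h⟩
  choose E hE0 hEm hE using HV'
  obtain ⟨CE, hCE, HE⟩ := E_event hε E hE0 hEm (fun x hx => (hE x hx).1)
  obtain ⟨CM, hCM, HM⟩ := mass_max hf
  set K := 1/(4*ε) with hK
  have hK0 : 0 < K := by positivity
  -- large ℓ
  obtain ⟨L, hL⟩ : ∃ L : ℕ, ∀ ℓ : ℕ, L ≤ ℓ → 2 ≤ ℓ → (2:ℝ)^20 ≤ Xpt ε ((ℓ:ℝ)-1) := by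
    refine ⟨⌈((20:ℝ))^(1/K)⌉₊ + 1, fun ℓ hℓ _ => ?_⟩
    have h1 : (20:ℝ)^(1/K) ≤ (ℓ:ℝ) - 1 := by
      have := Nat.le_ceil ((20:ℝ)^(1/K))
      have h2 : ((⌈((20:ℝ))^(1/K)⌉₊ + 1 : ℕ):ℝ) ≤ ℓ := by exact_mod_cast hℓ
      push_cast at h2; linarith
    have h2 : (20:ℝ) ≤ ((ℓ:ℝ)-1)^K := by
      calc (20:ℝ) = ((20:ℝ)^(1/K))^K := by
            rw [← Real.rpow_mul (by norm_num), one_div_mul_cancel hK0.ne', Real.rpow_one]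
        _ ≤ _ := by gcongr
    unfold Xpt
    rw [← hK]
    have h3 : (20:ℝ) ≤ (2:ℝ)^(((ℓ:ℝ)-1)^K) := by
      calc (20:ℝ) ≤ (2:ℝ)^(20:ℝ) := by norm_num
        _ ≤ _ := Real.rpow_le_rpow_of_exponent_le (by norm_num) h2
    calc (2:ℝ)^20 ≤ (Real.exp 1)^20 := by gcongr; linarith [Real.exp_one_gt_d9]
      _ = Real.exp 20 := by rw [← Real.exp_nat_mul]; norm_num
      _ ≤ _ := Real.exp_le_exp.2 h3
  set G := √((2:ℝ)^K) with hG
  have hG0 : 0 < G := Real.sqrt_pos.2 (by positivity)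
  refine ⟨CM + CM*(2*CV*G) + CE, by positivity, L, fun ℓ hℓ hℓ2 T hT => ?_⟩
  have hT0 : 0 < T := by linarith
  have hℓ2' : (2:ℝ) ≤ ℓ := by exact_mod_cast hℓ2
  set N := (ℓ:ℝ)^K with hN
  have hN0 : 0 < N := by positivity
  set k0 := ⌊Xpt ε ((ℓ:ℝ)-1)⌋₊ with hk0
  set n := ⌊Xpt ε (ℓ:ℝ)⌋₊ + 1 with hn
  set lam := T^(1/4:ℝ) with hlam
  have hlam1 : 1 ≤ lam := Real.one_le_rpow hT (by norm_num)
  have hsN : 0 < √N := Real.sqrt_pos.2 hN0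
  set τ := T/(2*CV*√N) with hτ
  have hτ0 : 0 < τ := by positivity
  have hX20 := hL ℓ hℓ hℓ2
  have hsub : {ω | ¬ ∀ i : ℕ, 1 ≤ i → Xpt ε ((ℓ:ℝ) - 1) < (testPoint ε i : ℝ) →
        (testPoint ε i : ℝ) ≤ Xpt ε (ℓ:ℝ) →
        Vst f ω (testPoint ε i) * √(Real.log (Real.log (testPoint ε i))) / (testPoint ε i : ℝ) ≤ T} ⊆
      {ω | ∃ k, k0 ≤ k ∧ k ≤ k0 + n ∧ ENNReal.ofReal τ < Mk f k (1/2) ω} ∪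
      {ω | ∃ i, 2^20 ≤ testPoint ε i ∧
        T/2 < E (testPoint ε i) ω * √(Real.log (Real.log (testPoint ε i)))} := by
    intro ω hω
    by_contra hcon
    refine hω fun i _ hi1 hi2 => ?_
    simp only [Set.mem_union, not_or] at hcon
    obtain ⟨hc1, hc2⟩ := hcon
    set x := testPoint ε i with hx
    have hxR : (2:ℝ)^20 ≤ x := hX20.trans hi1.le
    have hx20 : 2^20 ≤ x := by exact_mod_cast hxR
    have hx0 : (0:ℝ) < x := by linarith [(by norm_num : (0:ℝ) < 2^20)]
    have hMx : Mk f (x+1) (1/2) ω ≤ ENNReal.ofReal τ := by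
      by_contra hlt
      refine hc1 ⟨x+1, ?_, ?_, not_le.1 hlt⟩
      · have : k0 ≤ x := by
          rw [hk0]; exact Nat.floor_le_of_le hi1.le
        omega
      · have : x ≤ ⌊Xpt ε (ℓ:ℝ)⌋₊ := Nat.le_floor hi2
        omega
    have hEx : E x ω * √(Real.log (Real.log x)) ≤ T/2 := by
      by_contra hlt
      exact hc2 ⟨i, hx20, not_le.1 hlt⟩
    have hV := (hE x hx20).2 ω
    have hV2 : Vst f ω x / x ≤ CV * τ + E x ω := by
      have hE0' := hE0 x ω
      refine (ENNReal.ofReal_le_ofReal_iff (by positivity)).1 (hV.trans ?_)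
      rw [ENNReal.ofReal_add (by positivity) hE0', ENNReal.ofReal_mul hCV.le]
      exact add_le_add (mul_le_mul' le_rfl hMx) le_rfl
    have hlog : √(Real.log (Real.log x)) ≤ √N := by
      refine Real.sqrt_le_sqrt ?_
      have hlx : 0 < Real.log x := Real.log_pos (by linarith [(by norm_num : (1:ℝ) < 2^20)])
      have a1 : Real.log x ≤ (2:ℝ)^N := by
        have := Real.log_le_log hx0 hi2
        unfold Xpt at this
        rwa [Real.log_exp] at this
      have a2 := Real.log_le_log hlx a1
      rw [Real.log_rpow (by norm_num)] at a2
      have hl : Real.log 2 ≤ 1 := by linarith [Real.log_two_lt_d9]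
      nlinarith
    calc Vst f ω x * √(Real.log (Real.log x)) / x = (Vst f ω x / x) * √(Real.log (Real.log x)) := by ring
      _ ≤ (CV * τ + E x ω) * √(Real.log (Real.log x)) := by gcongr
      _ = CV * τ * √(Real.log (Real.log x)) + E x ω * √(Real.log (Real.log x)) := by ring
      _ ≤ CV * τ * √N + T/2 := by gcongr
      _ = T := by rw [hτ]; field_simp; norm_num
  have hm1 := HM k0 n lam τ hlam1 hτ0
  have hm2 := HE T hT
  have hsqj : √N ≤ G * √(1 + jj k0) := by
    rw [hG, ← Real.sqrt_mul (by positivity)]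
    refine Real.sqrt_le_sqrt ?_
    have a1 : ((ℓ:ℝ)-1)^K ≤ 1 + jj k0 := by
      rw [hk0]; unfold Xpt; rw [← hK]; exact jj_floor
    calc N ≤ (2*((ℓ:ℝ)-1))^K := by rw [hN]; gcongr; linarith
      _ = 2^K * ((ℓ:ℝ)-1)^K := Real.mul_rpow (by norm_num) (by linarith)
      _ ≤ _ := by gcongr
  have hsj : 0 < √(1 + jj k0 : ℝ) := Real.sqrt_pos.2 (by positivity)
  have hll : 0 ≤ Real.log lam := Real.log_nonneg hlam1
  have hlam0 : 0 < lam := by linarith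
  have hinv : T^(-(1/4:ℝ)) = 1/lam := by rw [Real.rpow_neg hT0.le, hlam, one_div (T^(1/4:ℝ))]
  have hTl : lam * lam ≤ T := by
    rw [hlam, ← Real.rpow_add hT0]
    calc T^((1/4:ℝ)+1/4) ≤ T^(1:ℝ) := Real.rpow_le_rpow_of_exponent_le hT (by norm_num)
      _ = T := Real.rpow_one T
  have hlT : lam/T ≤ 1/lam := by rw [div_le_div_iff₀ hT0 hlam0]; linarith
  have h1T : 1/T ≤ 1/lam := by
    refine one_div_le_one_div_of_le hlam0 (by nlinarith)
  refine (measure_mono hsub).trans ((measure_union_le _ _).trans ((add_le_add hm1 hm2).trans ?_))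
  rw [← ENNReal.ofReal_add (by positivity) (by positivity)]
  refine ENNReal.ofReal_le_ofReal ?_
  rw [hinv]
  have b1 : CM * (1 + Real.log lam) / (τ * √(1 + jj k0)) ≤ CM*(2*CV*G) * (lam/T) := by
    have c1 : 1/(τ * √(1 + jj k0)) ≤ 2*CV*G/T := by
      rw [div_le_div_iff₀ (by positivity) hT0, one_mul, hτ]
      have : T ≤ 2*CV*G*(T/(2*CV*√N) * √(1 + jj k0)) := by
        calc T = T/√N * √N := by field_simp
          _ ≤ T/√N * (G * √(1 + jj k0)) := by gcongr
          _ = _ := by field_simp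
      exact this
    have c2 : 1 + Real.log lam ≤ lam := by linarith [Real.log_le_sub_one_of_pos hlam0]
    calc CM * (1 + Real.log lam) / (τ * √(1 + jj k0)) = CM * (1 + Real.log lam) * (1/(τ * √(1 + jj k0))) := by ring
      _ ≤ CM * lam * (2*CV*G/T) := by gcongr
      _ = _ := by ring
  have b2 : CM*(2*CV*G) * (lam/T) ≤ CM*(2*CV*G) * (1/lam) := by gcongr
  have b3 : CE/T ≤ CE * (1/lam) := by
    calc CE/T = CE * (1/T) := by ring
      _ ≤ _ := by gcongr
  calc _ ≤ CM/lam + CM*(2*CV*G) * (1/lam) + CE * (1/lam) := by linarith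
    _ = _ := by ring
end G3
end

/-- For every `T ≥ 1` and sufficiently large `ℓ`, the probability that some test point
`x_i ∈ (X_{ℓ-1}, X_ℓ]` has `V(x_i)√(log log x_i)/x_i > T` is
`≪_ε (√(ℓ^K)/T)^{4/ε} 2^{-ℓ^K/ε} + T^{-1/4}`. -/
theorem variance_event_steinhaus
    {Ω : Type*} [MeasurableSpace Ω] (μ : Measure Ω) [IsProbabilityMeasure μ]
    (f : Ω → ℕ → ℂ) (hf : IsSteinhausRMF μ f) :
    ∃ ε₀ : ℝ, 0 < ε₀ ∧ ∀ ε : ℝ, 0 < ε → ε < ε₀ →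
      ∃ C : ℝ, 0 < C ∧ ∃ L : ℕ, ∀ ℓ : ℕ, L ≤ ℓ → 2 ≤ ℓ → ∀ T : ℝ, 1 ≤ T →
        μ {ω | ¬ ∀ i : ℕ, 1 ≤ i →
              Xpt ε ((ℓ : ℝ) - 1) < (testPoint ε i : ℝ) →
              (testPoint ε i : ℝ) ≤ Xpt ε (ℓ : ℝ) →
              Vst f ω (testPoint ε i) *
                  Real.sqrt (Real.log (Real.log (testPoint ε i))) / (testPoint ε i : ℝ) ≤ T} ≤
          ENNReal.ofReal (C *
            ((Real.sqrt ((ℓ : ℝ) ^ (1 / (4 * ε))) / T) ^ (4 / ε) *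
                (2 : ℝ) ^ (-((ℓ : ℝ) ^ (1 / (4 * ε))) / ε) +
              T ^ (-(1 / 4 : ℝ)))) := by
  obtain ⟨g, hg, hfg⟩ := exists_SN hf
  refine ⟨1, one_pos, fun ε hε _ => ?_⟩
  obtain ⟨C, hC, L, H⟩ := final_SN hg hε
  refine ⟨C, hC, L, fun ℓ hℓ hℓ2 T hT => ?_⟩
  refine (le_trans (measure_mono_ae ?_) (H ℓ hℓ hℓ2 T hT)).trans (ENNReal.ofReal_le_ofReal ?_)
  · filter_upwards [hfg] with ω hω h
    have e : ∀ x, Vst f ω x = Vst g ω x := fun x => by unfold Vst; rw [hω]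
    intro h2
    refine h fun i a b c => ?_
    rw [e]
    exact h2 i a b c
  · have hT0 : 0 < T := by linarith
    refine mul_le_mul_of_nonneg_left (le_add_of_nonneg_left ?_) hC.le
    positivity
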